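/- A multiset {a,b,c,d} of positive integers is representable if and only if {a,b,c,d} = {4,2,2,1}, or {a,b,c,d} = {4,2,2,2}, or all of a, b, c, d are at most 3 and {a,b,c,d} ≠ {3,3,3,1}. -/

import Mathlib

/-- `x` blocks `v` and `w` if `x` lies strictly between `v` and `w`. -/
def Blocks {E : Type*} [AddCommGroup E] [Module ℝ E] (x v w : E) : Prop :=
  x ∈ openSegment ℝ v w

/-- `v` and `w` are visible with respect to `P` if no point of `P` blocks them. -/
def Visible {E : Type*} [AddCommGroup E] [Module ℝ E] (P : Set E) (v w : E) : Prop :=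
  ∀ x ∈ P, ¬ Blocks x v w

/-- `c` is a blocked colouring of `P`: distinct points of `P` are visible
iff they get different colours. -/
def BlockedColouring {E : Type*} [AddCommGroup E] [Module ℝ E] {k : ℕ}
    (P : Set E) (c : E → Fin k) : Prop :=
  ∀ v ∈ P, ∀ w ∈ P, v ≠ w → (Visible P v w ↔ c v ≠ c w)

/-- `P` is `k`-blocked. -/
def KBlocked {E : Type*} [AddCommGroup E] [Module ℝ E] (k : ℕ) (P : Set E) : Prop :=
  P.Finite ∧ ∃ c : E → Fin k, BlockedColouring P c

/-- `P` is `{n₁,…,n_k}`-blocked where `N` is the multiset of colour class sizes. -/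
def IsNBlocked {E : Type*} [AddCommGroup E] [Module ℝ E] (N : Multiset ℕ) (P : Set E) : Prop :=
  P.Finite ∧ ∃ (k : ℕ) (c : E → Fin k), BlockedColouring P c ∧
    N = Finset.univ.val.map (fun i : Fin k => (P ∩ c ⁻¹' {i}).ncard)

/-- A multiset of positive integers is representable if some planar point set is
`N`-blocked. -/
def Representable (N : Multiset ℕ) : Prop :=
  ∃ P : Set (ℝ × ℝ), IsNBlocked N P

/-- A set is in convex position if no point lies in the convex hull of the others. -/
def ConvexPosition {E : Type*} [AddCommGroup E] [Module ℝ E] (K : Set E) : Prop :=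
  ∀ x ∈ K, x ∉ convexHull ℝ (K \ {x})

/-- `P` is `N`-midpoint-blocked: `N`-blocked, and midpoints of monochromatic pairs
belong to `P`. -/
def IsNMidpointBlocked {E : Type*} [AddCommGroup E] [Module ℝ E]
    (N : Multiset ℕ) (P : Set E) : Prop :=
  P.Finite ∧ ∃ (k : ℕ) (c : E → Fin k), BlockedColouring P c ∧
    (∀ v ∈ P, ∀ w ∈ P, v ≠ w → c v = c w → midpoint ℝ v w ∈ P) ∧
    N = Finset.univ.val.map (fun i : Fin k => (P ∩ c ⁻¹' {i}).ncard)

namespace FourBlocked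

/-- Facts about a labelled, coloured point set: a triple is counterclockwise (`P`), a point is
strictly between two others (`B`), a point has a colour (`C`), a point has a prescribed colour and
lies in a triangle, both taken from a table (`I`). -/
inductive Atom where
  | P (i j k : ℕ)
  | B (p q r : ℕ)
  | C (i c : ℕ)
  | I (k x : ℕ)

/-- Evaluates `n` to a numeral before passing it on. -/
noncomputable def force {α : Type} (n : ℕ) (k : ℕ → α) : α :=
  @Nat.rec (fun _ => α) (k (nat_lit 0)) (fun m _ => k (Nat.succ m)) n

/-- `if b then t else f`, in a form that reduces quickly. -/
noncomputable def sel {α : Type} (b : Bool) (t f : α) : α := @Bool.rec (fun _ => α) f t b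

namespace Atom

noncomputable def code3 (b i j k : ℕ) : ℕ := Nat.add (Nat.mul (Nat.add (Nat.mul i b) j) b) k

noncomputable def rot (b i j k : ℕ) : ℕ :=
  sel (Nat.ble i j) (sel (Nat.ble i k) (code3 b i j k) (code3 b k i j))
    (sel (Nat.ble j k) (code3 b j k i) (code3 b k i j))

noncomputable def idx (b : ℕ) (a : Atom) : ℕ :=
  @Atom.rec (fun _ => ℕ)
    (fun i j k => Nat.add (Nat.mul (nat_lit 4) (rot b i j k)) (nat_lit 1))
    (fun p q r => Nat.add (Nat.mul (nat_lit 4) (sel (Nat.ble p r) (code3 b p q r) (code3 b r q p)))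
      (nat_lit 2))
    (fun i c => Nat.mul (nat_lit 4) (Nat.add (Nat.mul (nat_lit 4) i) c))
    (fun k x => Nat.add (Nat.mul (nat_lit 4) (Nat.add (Nat.mul b k) x)) (nat_lit 3)) a

noncomputable def inRange (n : ℕ) (a : Atom) : Bool :=
  @Atom.rec (fun _ => Bool)
    (fun i j k => sel (Nat.blt i n) (sel (Nat.blt j n) (Nat.blt k n) false) false)
    (fun i j k => sel (Nat.blt i n) (sel (Nat.blt j n) (Nat.blt k n) false) false)
    (fun i c => sel (Nat.blt i n) (Nat.blt c (nat_lit 4)) false)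
    (fun _ x => Nat.blt x n) a

noncomputable def ok (n : ℕ) (a : Atom) : Bool :=
  sel (a.inRange n) (Nat.blt (a.idx n) (nat_lit 16384)) false

end Atom

inductive Lit where
  | yes (a : Atom)
  | no (a : Atom)

/-- A clause is encoded as the bitwise disjunction of the masks of its literals. -/
noncomputable def Lit.mask (b : ℕ) (l : Lit) : ℕ :=
  @Lit.rec (fun _ => ℕ) (fun a => Nat.shiftLeft (nat_lit 1) (a.idx b))
    (fun a => Nat.shiftLeft (nat_lit 1) (Nat.add (nat_lit 16384) (a.idx b))) l

def Lit.atom : Lit → Atom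
  | yes a => a
  | no a => a

/-- The tautology on variable `0`. -/
noncomputable def trueMask : ℕ := Nat.lor (nat_lit 1) (Nat.shiftLeft (nat_lit 1) (nat_lit 16384))

noncomputable def checkedMask (n : ℕ) (c : List Lit) : ℕ :=
  @List.rec Lit (fun _ => ℕ) (nat_lit 0)
    (fun l _ ih => sel (l.atom.ok n) (Nat.lor (l.mask n) ih) trueMask) c

/-- The number of points, the maximal colour class sizes, additional clauses, and the table of
triangles for `Atom.I`. -/
structure Setup where
  n : ℕ
  maxc : ℕ → ℕ
  hyps : List (List Lit)
  tbl : List (ℕ × ℕ × ℕ × ℕ)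

open Lit (yes no)

def trivialClause : List Lit := [yes (.C (nat_lit 0) (nat_lit 0)), no (.C (nat_lit 0) (nat_lit 0))]

noncomputable def signAtom (s i j k : ℕ) : Atom := sel (Nat.beq s (nat_lit 0)) (.P i j k) (.P i k j)

noncomputable def weakLits (o a b c d e f : ℕ) (r : List Lit) : List Lit :=
  sel (Nat.beq o (nat_lit 0)) (yes (.P a c b) :: yes (.P d f e) :: r)
    (sel (Nat.beq o (nat_lit 1)) (yes (.P a b c) :: yes (.P d e f) :: r)
      (sel (Nat.beq o (nat_lit 2)) (yes (.P a b c) :: yes (.P a c b) :: r)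
        (yes (.P d e f) :: yes (.P d f e) :: r)))

/-- A clause derived from the Grassmann-Plücker relation. -/
noncomputable def gpClause (a b c d e s o : ℕ) : List Lit :=
  no (signAtom s a b c) :: no (signAtom s a d e) ::
    weakLits (Nat.mod o (nat_lit 4)) a b d a e c (weakLits (Nat.div o (nat_lit 4)) a b e a c d [])

noncomputable def guarded (b : Bool) (c : List Lit) : List Lit := sel b c trivialClause

/-- The literals `l q` for `q < n` with `q ∉ {x, y, z}`. -/
noncomputable def rangeLits (x y z : ℕ) (l : ℕ → Lit) (n : ℕ) : List Lit :=
  @Nat.rec (fun _ => List Lit) []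
    (fun q ih => sel (Nat.beq q x) ih (sel (Nat.beq q y) ih (sel (Nat.beq q z) ih (l q :: ih)))) n

noncomputable def distinct3 (x y z : ℕ) : Bool :=
  sel (Nat.beq x y) false (sel (Nat.beq x z) false (!Nat.beq y z))

noncomputable def case4 (k : ℕ) (a b c d : List Lit) : List Lit :=
  sel (Nat.ble k (nat_lit 1)) (sel (Nat.beq k (nat_lit 0)) a b) (sel (Nat.beq k (nat_lit 2)) c d)

noncomputable def hullLits (o p q r x : ℕ) : List Lit :=
  sel (Nat.ble o (nat_lit 3))
    (no (.P p q r) :: sel (Nat.beq o (nat_lit 1)) [no (.P q p x)]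
      (sel (Nat.beq o (nat_lit 2)) [no (.P r q x)] [no (.P p r x)]))
    (no (.P p r q) :: sel (Nat.beq o (nat_lit 4)) [no (.P r p x)]
      (sel (Nat.beq o (nat_lit 5)) [no (.P q r x)] [no (.P p q x)]))

/-- The instances of the rules satisfied by every blocked point set. -/
noncomputable def ruleClause (S : Setup) (k x0 x1 x2 x3 x4 x5 x6 : ℕ) : List Lit :=
  let row := Nat.add x0 (Nat.mul (nat_lit 16) x1)
  sel (Nat.ble k (nat_lit 7))
    (sel (Nat.ble k (nat_lit 3))
      (case4 k (S.hyps.getD row trivialClause)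
        [yes (.C x0 (nat_lit 0)), yes (.C x0 (nat_lit 1)), yes (.C x0 (nat_lit 2)),
          yes (.C x0 (nat_lit 3))]
        (guarded (!Nat.beq x1 x2) [no (.C x0 x1), no (.C x0 x2)])
        (guarded (Nat.blt (S.maxc x0) [x1, x2, x3, x4].dedup.length)
          [no (.C x1 x0), no (.C x2 x0), no (.C x3 x0), no (.C x4 x0)]))
      (case4 (Nat.sub k (nat_lit 4)) [no (.B x0 x1 x2), no (.C x0 x3), yes (.C x2 x3)]
        [no (.B x0 x1 x2), no (.C x0 x3), no (.C x1 x3)]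
        [no (.B x0 x1 x2), no (.P x0 x1 x2)]
        [no (.B x0 x1 x2), no (.B x1 x0 x2)]))
    (sel (Nat.ble k (nat_lit 11))
      (case4 (Nat.sub k (nat_lit 8))
        (guarded (!Nat.beq x1 x2) [no (.B x0 x1 x3), no (.B x0 x2 x3)])
        (guarded (!Nat.beq x0 x1) (no (.C x0 x2) :: no (.C x1 x2) ::
          rangeLits x0 x1 x0 (fun q => yes (.B x0 q x1)) S.n))
        [no (.P x0 x1 x2), no (.P x0 x2 x1)]
        (guarded (distinct3 x0 x1 x2) [yes (.P x0 x1 x2), yes (.P x0 x2 x1),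
          yes (.B x0 x1 x2), yes (.B x1 x2 x0), yes (.B x2 x0 x1)]))
      (case4 (Nat.sub k (nat_lit 12))
        (no (.B x0 x1 x2) :: case4 x4 [no (.P x3 x0 x1), yes (.P x3 x1 x2)]
          [no (.P x3 x1 x2), yes (.P x3 x0 x2)] [no (.P x3 x0 x2), yes (.P x3 x0 x1)]
          (guarded (sel (Nat.beq x3 x1) false (distinct3 x3 x0 x2)) [yes (.P x3 x0 x1),
            yes (.P x3 x1 x0)]))
        (let t := S.tbl.getD row (0, 0, 0, 0);
          guarded (sel (Nat.blt t.2.2.2 (nat_lit 4)) (sel (Nat.beq x2 t.2.2.2) false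
            (distinct3 t.1 t.2.1 t.2.2.1)) false)
            (no (.C t.1 x2) :: no (.C t.2.1 x2) :: no (.C t.2.2.1 x2) ::
              rangeLits t.1 t.2.1 t.2.2.1 (fun q => yes (.I row q)) S.n))
        (let t := S.tbl.getD row (0, 0, 0, 0);
          no (.I row x2) :: sel (Nat.beq x3 (nat_lit 0)) [yes (.C x2 t.2.2.2)]
            (hullLits x3 t.1 t.2.1 t.2.2.1 x2))
        (gpClause x0 x1 x2 x3 x4 (Nat.mod x5 (nat_lit 2))
          (Nat.add (Nat.div x5 (nat_lit 2)) (Nat.mul (nat_lit 8) x6)))))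

/-- The next hexadecimal digit, and the rest. -/
noncomputable def digit {α : Type} (t : ℕ) (k : ℕ → ℕ → α) : α :=
  force (Nat.mod t (nat_lit 16)) fun d => force (Nat.div t (nat_lit 16)) fun t' => k d t'

noncomputable def tagMask (S : Setup) (t : ℕ) : ℕ :=
  digit t fun k t => digit t fun x0 t => digit t fun x1 t => digit t fun x2 t => digit t fun x3 t =>
    digit t fun x4 t => digit t fun x5 t => digit t fun x6 _ =>
      checkedMask S.n (ruleClause S k x0 x1 x2 x3 x4 x5 x6)

/-- The rule tag at the end of a stream, and the remaining stream. -/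
noncomputable def nextTag {α : Type} (D : ℕ) (k : ℕ → ℕ → α) : α :=
  force (Nat.shiftLeft (nat_lit 1) (Nat.mul (nat_lit 4)
    (Nat.mod (Nat.shiftRight (nat_lit 9603438319704040483)
      (Nat.mul (nat_lit 4) (Nat.mod D (nat_lit 16)))) (nat_lit 16)))) fun w =>
  force (Nat.mod D w) fun t => force (Nat.div D w) fun D' => k t D'

/-- Clause databases: binary trees indexed by natural numbers. -/
inductive DB where
  | nil
  | node (c : ℕ) (l r : DB)

namespace DB

noncomputable def get (t : DB) : ℕ → ℕ :=
  @DB.rec (fun _ => ℕ → ℕ) (fun _ => trueMask)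
    (fun c _ _ ihl ihr i => sel (Nat.beq i (nat_lit 0)) c
      (sel (Nat.beq (Nat.mod i (nat_lit 2)) (nat_lit 0))
        (force (Nat.pred (Nat.div i (nat_lit 2))) ihl) (force (Nat.div i (nat_lit 2)) ihr))) t

noncomputable def insert (m : ℕ) (t : DB) : ℕ → DB :=
  @DB.rec (fun _ => ℕ → DB) (fun _ => node m nil nil)
    (fun c l r ihl ihr i => sel (Nat.beq i (nat_lit 0)) (node m l r)
      (sel (Nat.beq (Nat.mod i (nat_lit 2)) (nat_lit 0))
        (force (Nat.pred (Nat.div i (nat_lit 2))) fun i => node c (ihl i) r)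
        (force (Nat.div i (nat_lit 2)) fun i => node c l (ihr i)))) t

end DB

noncomputable def isPow (m : ℕ) : Bool := Nat.beq (Nat.land m (Nat.sub m (nat_lit 1))) (nat_lit 0)

/-- Literals falsified by the unit clause `m`. -/
noncomputable def flip (m : ℕ) : ℕ :=
  sel (Nat.beq (Nat.shiftRight m (nat_lit 16384)) (nat_lit 0)) (Nat.shiftLeft m (nat_lit 16384))
    (Nat.shiftRight m (nat_lit 16384))

noncomputable def remaining (c F : ℕ) : ℕ := Nat.xor c (Nat.land c F)

/-- Unit propagation along the hints `D` reaches a contradiction. -/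
noncomputable def refute (db : DB) (fuel : ℕ) : ℕ → ℕ → Bool :=
  @Nat.rec (fun _ => ℕ → ℕ → Bool) (fun _ _ => false)
    (fun _ ih D F => force (remaining (db.get (Nat.mod D (nat_lit 4096))) F) fun m =>
      sel (Nat.beq m (nat_lit 0)) true
        (sel (isPow m) (force (Nat.div D (nat_lit 4096)) fun D =>
          force (Nat.lor F (flip m)) fun F => ih D F) false)) fuel

noncomputable def addUnit (m F : ℕ) : ℕ := sel (isPow m) (Nat.lor F (flip m)) F

noncomputable def unitPhase (S : Setup) (fuel : ℕ) : ℕ → ℕ → ℕ :=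
  @Nat.rec (fun _ => ℕ → ℕ → ℕ) (fun _ F => F)
    (fun _ ih D F => sel (Nat.beq D (nat_lit 0)) F
      (nextTag D fun t D => force (remaining (tagMask S t) F) fun m =>
        force (addUnit m F) fun F => ih D F)) fuel

noncomputable def loadPhase {α : Type} (S : Setup) (F : ℕ) (k : ℕ → DB → α) (fuel : ℕ) :
    ℕ → ℕ → DB → α :=
  @Nat.rec (fun _ => ℕ → ℕ → DB → α) (fun _ i db => k i db)
    (fun _ ih D i db => sel (Nat.beq D (nat_lit 0)) (k i db)
      (nextTag D fun t D => force (remaining (tagMask S t) F) fun m =>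
        force i fun i => ih D (Nat.succ i) (db.insert m i))) fuel

noncomputable def lemmaMask (k : ℕ) : ℕ → ℕ :=
  @Nat.rec (fun _ => ℕ → ℕ) (fun _ => nat_lit 0)
    (fun _ ih D => Nat.lor (Nat.shiftLeft (nat_lit 1) (Nat.mod D (nat_lit 65536)))
      (ih (Nat.div D (nat_lit 65536)))) k

noncomputable def run (Ds : List ℕ) : ℕ → DB → ℕ → Bool :=
  @List.rec ℕ (fun _ => ℕ → DB → ℕ → Bool) (fun _ _ _ => false)
    (fun D _ ih i db F => force (Nat.mod D (nat_lit 256)) fun k =>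
      force (Nat.div D (nat_lit 256)) fun D =>
      force (lemmaMask k D) fun m =>
      sel (refute db (nat_lit 300) (Nat.shiftRight D (Nat.mul (nat_lit 16) k)) (Nat.lor F m))
        (sel (Nat.beq m (nat_lit 0)) true
          (sel (isPow m) (force (Nat.lor F (flip m)) fun F => ih i db F)
            (force i fun i => ih (Nat.succ i) (db.insert m i) F))) false) Ds

noncomputable def unitsAll (S : Setup) (us : List ℕ) : ℕ → ℕ :=
  @List.rec ℕ (fun _ => ℕ → ℕ) (fun F => F)
    (fun D _ ih F => force (unitPhase S (nat_lit 100) D F) fun F => ih F) us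

noncomputable def loadAll {α : Type} (S : Setup) (F : ℕ) (k : ℕ → DB → α) (us : List ℕ) :
    ℕ → DB → α :=
  @List.rec ℕ (fun _ => ℕ → DB → α) k
    (fun D _ ih i db => loadPhase S F ih (nat_lit 100) D i db) us

/-- The streams `us` and `as` of rule instances, used as units and as clauses, and the lemmas `ls`
derived from them by unit propagation are contradictory. -/
noncomputable def verify (S : Setup) (us as ls : List ℕ) : Bool :=
  force (unitsAll S us (nat_lit 0)) fun F =>
    loadAll S F (fun i db => run ls i db F) as (nat_lit 0) .nil

end FourBlocked

namespace FourBlocked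

theorem force_eq {α : Type} (n : ℕ) (k : ℕ → α) : force n k = k n := by cases n <;> rfl

theorem sel_eq {α : Type} (b : Bool) (t f : α) : sel b t f = if b = true then t else f := by
  cases b <;> rfl

/-- Twice the signed area of the triangle `abc`. -/
def orient (a b c : ℝ × ℝ) : ℝ := (b.1 - a.1) * (c.2 - a.2) - (b.2 - a.2) * (c.1 - a.1)

/-- `q` lies strictly between `p` and `r`. -/
def Btw (p q r : ℝ × ℝ) : Prop :=
  orient p q r = 0 ∧ (p.1 - q.1) * (r.1 - q.1) + (p.2 - q.2) * (r.2 - q.2) < 0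

/-- `x` is on the inner side of every edge of the triangle `pqr`. -/
def InTri (p q r x : ℝ × ℝ) : Prop :=
  (0 < orient p q r → ¬ 0 < orient q p x ∧ ¬ 0 < orient r q x ∧ ¬ 0 < orient p r x) ∧
    (0 < orient p r q → ¬ 0 < orient r p x ∧ ¬ 0 < orient q r x ∧ ¬ 0 < orient p q x)

theorem orient_rot (a b c : ℝ × ℝ) : orient b c a = orient a b c := by
  unfold orient; ring

theorem orient_swap (a b c : ℝ × ℝ) : orient a c b = -orient a b c := by
  unfold orient; ring

theorem Btw.symm {p q r : ℝ × ℝ} (h : Btw p q r) : Btw r q p := by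
  refine ⟨?_, ?_⟩
  · have := h.1; unfold orient at *; linarith
  · linarith [h.2]

theorem orient_grassmann (a b c d e : ℝ × ℝ) :
    orient a b c * orient a d e + orient a b d * orient a e c +
      orient a b e * orient a c d = 0 := by
  unfold orient; ring

/-- A labelled point set with a blocked colouring by `0, 1, 2, 3`, where colour `c` is used at
most `maxc c` times. -/
structure Config (n : ℕ) (f : ℕ → ℝ × ℝ) (col maxc : ℕ → ℕ) : Prop where
  col_lt : ∀ i < n, col i < 4
  count : ∀ c < 4, ∀ T : Finset ℕ, (∀ i ∈ T, i < n ∧ col i = c) → T.card ≤ maxc c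
  inj : ∀ i < n, ∀ j < n, f i = f j → i = j
  btw_eq : ∀ p < n, ∀ q < n, ∀ r < n, Btw (f p) (f q) (f r) → col p = col r
  btw_ne : ∀ p < n, ∀ q < n, ∀ r < n, Btw (f p) (f q) (f r) → col p ≠ col q
  btw_unique : ∀ p < n, ∀ q < n, ∀ q' < n, ∀ r < n,
    Btw (f p) (f q) (f r) → Btw (f p) (f q') (f r) → q = q'
  exists_btw : ∀ p < n, ∀ r < n, p ≠ r → col p = col r → ∃ q < n, Btw (f p) (f q) (f r)
  off_line : ∀ p < n, ∀ q < n, ∀ r < n, ∀ x < n, Btw (f p) (f q) (f r) →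
    x ≠ p → x ≠ q → x ≠ r → orient (f x) (f p) (f q) ≠ 0
  hull : ∀ p < n, ∀ q < n, ∀ r < n, p ≠ q → p ≠ r → q ≠ r → col p = col q → col q = col r →
    ∀ c < 4, ∃ x < n, col x = c ∧ InTri (f p) (f q) (f r) (f x)

section Semantics

variable (f : ℕ → ℝ × ℝ) (col : ℕ → ℕ) (tbl : List (ℕ × ℕ × ℕ × ℕ))

def Atom.Holds : Atom → Prop
  | .P i j k => 0 < orient (f i) (f j) (f k)
  | .B p q r => Btw (f p) (f q) (f r)
  | .C i c => col i = c
  | .I k x => col x = (tbl.getD k (0, 0, 0, 0)).2.2.2 ∧ InTri (f (tbl.getD k (0, 0, 0, 0)).1)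
      (f (tbl.getD k (0, 0, 0, 0)).2.1) (f (tbl.getD k (0, 0, 0, 0)).2.2.1) (f x)

def Lit.Holds : Lit → Prop
  | .yes a => a.Holds f col tbl
  | .no a => ¬ a.Holds f col tbl

def ClauseHolds (c : List Lit) : Prop := ∃ l ∈ c, l.Holds f col tbl

/-- The truth value of the variable with index `v`. -/
def Val (n v : ℕ) : Prop :=
  Atom.Holds f col tbl (if v % 4 = 0 then .C (v / 4 / 4) (v / 4 % 4)
    else if v % 4 = 1 then .P (v / 4 / n / n) (v / 4 / n % n) (v / 4 % n)
    else if v % 4 = 2 then .B (v / 4 / n / n) (v / 4 / n % n) (v / 4 % n)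
    else .I (v / 4 / n) (v / 4 % n))

def BitTrue (n j : ℕ) : Prop :=
  if j / 16384 % 2 = 0 then Val f col tbl n (j % 16384) else ¬ Val f col tbl n (j % 16384)

def MaskHolds (n m : ℕ) : Prop := ∃ j, m.testBit j = true ∧ BitTrue f col tbl n j

/-- All literals of the mask are false. -/
def MaskFalse (n m : ℕ) : Prop := ∀ j, m.testBit j = true → ¬ BitTrue f col tbl n j

variable {f col tbl}

theorem not_maskHolds {n m : ℕ} : ¬ MaskHolds f col tbl n m ↔ MaskFalse f col tbl n m := by
  simp [MaskHolds, MaskFalse]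

theorem MaskFalse.zero {n : ℕ} : MaskFalse f col tbl n 0 := by simp [MaskFalse]

theorem MaskFalse.lor {n m m' : ℕ} (h : MaskFalse f col tbl n m) (h' : MaskFalse f col tbl n m') :
    MaskFalse f col tbl n (Nat.lor m m') := by
  intro j hj
  have : (m ||| m').testBit j = true := hj
  rw [Nat.testBit_or, Bool.or_eq_true] at this
  exact this.elim (h j) (h' j)

theorem testBit_one_shiftLeft (i j : ℕ) : (Nat.shiftLeft 1 i).testBit j = decide (i = j) := by
  have : Nat.shiftLeft 1 i = 2 ^ i := by
    change 1 <<< i = 2 ^ i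
    rw [Nat.one_shiftLeft]
  rw [this, Nat.testBit_two_pow]

theorem maskHolds_trueMask (n : ℕ) : MaskHolds f col tbl n trueMask := by
  by_cases h : Val f col tbl n 0
  · refine ⟨0, ?_, by simpa [BitTrue] using h⟩
    change (1 ||| Nat.shiftLeft 1 16384).testBit 0 = true
    rw [Nat.testBit_or]; rfl
  · refine ⟨16384, ?_, by simpa [BitTrue] using h⟩
    change (1 ||| Nat.shiftLeft 1 16384).testBit 16384 = true
    rw [Nat.testBit_or, testBit_one_shiftLeft]; simp

theorem MaskHolds.remaining {n m F : ℕ} (h : MaskHolds f col tbl n m)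
    (hF : MaskFalse f col tbl n F) : MaskHolds f col tbl n (remaining m F) := by
  obtain ⟨j, hj, hb⟩ := h
  refine ⟨j, ?_, hb⟩
  change (m ^^^ (m &&& F)).testBit j = true
  have : F.testBit j = false := by
    by_contra h'
    exact hF j (by simpa using h') hb
  rw [Nat.testBit_xor, Nat.testBit_and, hj, this]; rfl

theorem MaskHolds.ne_zero {n m : ℕ} (h : MaskHolds f col tbl n m) : m ≠ 0 := by
  rintro rfl
  obtain ⟨j, hj, -⟩ := h
  simp at hj

theorem eq_two_pow_of_isPow {m : ℕ} (h0 : m ≠ 0) (h : isPow m = true) : ∃ j, m = 2 ^ j := by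
  have h1 : m &&& (m - 1) = 0 := Nat.eq_of_beq_eq_true h
  exact ((Nat.and_sub_one_eq_zero_iff_isPowerOfTwo h0).1 h1)

theorem MaskHolds.maskFalse_flip {n m : ℕ} (h : MaskHolds f col tbl n m) (hp : isPow m = true) :
    MaskFalse f col tbl n (flip m) := by
  obtain ⟨i, rfl⟩ := eq_two_pow_of_isPow h.ne_zero hp
  obtain ⟨j, hj, hb⟩ := h
  obtain rfl : i = j := by simpa [Nat.testBit_two_pow] using hj
  intro k hk
  have e : flip (2 ^ i) = if i < 16384 then 2 ^ (i + 16384) else 2 ^ (i - 16384) := by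
    unfold flip
    rw [sel_eq]
    change (if Nat.beq (2 ^ i >>> 16384) 0 = true then 2 ^ i <<< 16384 else 2 ^ i >>> 16384) = _
    rw [Nat.shiftLeft_eq, ← pow_add, Nat.shiftRight_eq_div_pow]
    by_cases hi : i < 16384
    · rw [Nat.div_eq_of_lt (Nat.pow_lt_pow_right (by norm_num) hi), if_pos hi]
      rfl
    · rw [Nat.pow_div (by omega) (by norm_num), if_neg hi, if_neg]
      intro h
      exact absurd (Nat.eq_of_beq_eq_true h) (by positivity)
  rw [e] at hk
  split_ifs at hk with hi <;> simp only [Nat.testBit_two_pow, decide_eq_true_eq] at hk <;> subst hk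
  · have e1 : (i + 16384) % 16384 = i % 16384 := by omega
    unfold BitTrue at hb ⊢
    rw [e1]
    rw [if_pos (by omega)] at hb
    rw [if_neg (by omega)]
    simpa using hb
  · have e1 : (i - 16384) % 16384 = i % 16384 := by omega
    unfold BitTrue at hb ⊢
    rw [e1]
    by_cases h2 : i / 16384 % 2 = 0
    · rw [if_pos h2] at hb
      rw [if_neg (by omega)]
      simpa using hb
    · rw [if_neg h2] at hb
      rwa [if_pos (by omega)]

theorem MaskHolds.maskFalse_addUnit {n m F : ℕ} (h : MaskHolds f col tbl n m)
    (hF : MaskFalse f col tbl n F) : MaskFalse f col tbl n (addUnit m F) := by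
  unfold addUnit
  rw [sel_eq]
  split_ifs with hp
  · exact hF.lor (h.maskFalse_flip hp)
  · exact hF

/-- All clauses of the database hold. -/
def DB.Holds (f : ℕ → ℝ × ℝ) (col : ℕ → ℕ) (tbl : List (ℕ × ℕ × ℕ × ℕ)) (n : ℕ) : DB → Prop
  | .nil => True
  | .node c l r => MaskHolds f col tbl n c ∧ l.Holds f col tbl n ∧ r.Holds f col tbl n

theorem DB.Holds.get {n : ℕ} {t : DB} (h : t.Holds f col tbl n) (i : ℕ) :
    MaskHolds f col tbl n (t.get i) := by
  induction t generalizing i with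
  | nil => exact maskHolds_trueMask n
  | node c l r ihl ihr =>
    obtain ⟨hc, hl, hr⟩ := h
    change MaskHolds f col tbl n (sel _ c (sel _ (force _ l.get) (force _ r.get)))
    rw [sel_eq, sel_eq, force_eq, force_eq]
    split_ifs
    exacts [hc, ihl hl _, ihr hr _]

theorem DB.Holds.insert {n m : ℕ} (hm : MaskHolds f col tbl n m) {t : DB}
    (h : t.Holds f col tbl n) (i : ℕ) : (t.insert m i).Holds f col tbl n := by
  induction t generalizing i with
  | nil => exact ⟨hm, trivial, trivial⟩
  | node c l r ihl ihr =>
    obtain ⟨hc, hl, hr⟩ := h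
    change DB.Holds f col tbl n (sel _ (.node m l r)
      (sel _ (force _ fun i => .node c (l.insert m i) r)
        (force _ fun i => .node c l (r.insert m i))))
    rw [sel_eq, sel_eq, force_eq, force_eq]
    split_ifs
    exacts [⟨hm, hl, hr⟩, ⟨hc, ihl hl _, hr⟩, ⟨hc, hl, ihr hr _⟩]

theorem refute_sound {n : ℕ} {db : DB} (hdb : db.Holds f col tbl n) (fuel D F : ℕ)
    (hF : MaskFalse f col tbl n F) : refute db fuel D F = false := by
  induction fuel generalizing D F with
  | zero => rfl
  | succ k ih =>
    change (force (remaining (db.get (Nat.mod D 4096)) F) fun m => sel (Nat.beq m 0) true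
        (sel (isPow m) (force (Nat.div D 4096) fun D =>
          force (Nat.lor F (flip m)) fun F => refute db k D F) false)) = false
    have hm := (hdb.get (Nat.mod D 4096)).remaining hF
    rw [force_eq, sel_eq, sel_eq, force_eq, force_eq, if_neg]
    · split_ifs with hp
      · exact ih _ _ (hF.lor (hm.maskFalse_flip hp))
      · rfl
    · intro h
      exact hm.ne_zero (Nat.eq_of_beq_eq_true h)

theorem run_sound {n : ℕ} (Ds : List ℕ) (i : ℕ) {db : DB} {F : ℕ} (hdb : db.Holds f col tbl n)
    (hF : MaskFalse f col tbl n F) : run Ds i db F = false := by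
  induction Ds generalizing i db F with
  | nil => rfl
  | cons D Ds ih =>
    change (force (Nat.mod D 256) fun k => force (Nat.div D 256) fun D =>
      force (lemmaMask k D) fun m =>
      sel (refute db 300 (Nat.shiftRight D (Nat.mul 16 k)) (Nat.lor F m))
        (sel (Nat.beq m 0) true
          (sel (isPow m) (force (Nat.lor F (flip m)) fun F => run Ds i db F)
            (force i fun i => run Ds (Nat.succ i) (db.insert m i) F))) false) = false
    simp only [force_eq, sel_eq]
    by_cases h1 : refute db 300 (Nat.shiftRight (Nat.div D 256) (Nat.mul 16 (Nat.mod D 256)))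
        (Nat.lor F (lemmaMask (Nat.mod D 256) (Nat.div D 256))) = true
    · have hm : MaskHolds f col tbl n (lemmaMask (Nat.mod D 256) (Nat.div D 256)) := by
        by_contra hm
        rw [not_maskHolds] at hm
        rw [refute_sound hdb _ _ _ (hF.lor hm)] at h1
        exact absurd h1 (by simp)
      rw [if_pos h1, if_neg fun h => hm.ne_zero (Nat.eq_of_beq_eq_true h)]
      split_ifs with h3
      · exact ih _ hdb (hF.lor (hm.maskFalse_flip h3))
      · exact ih _ (hdb.insert hm _) hF
    · rw [if_neg h1]

variable {S : Setup}

theorem nextTag_ind {α : Type} {motive : α → Prop} {D : ℕ} {k : ℕ → ℕ → α}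
    (h : ∀ t D', motive (k t D')) : motive (nextTag D k) := by
  unfold nextTag
  simp only [force_eq]
  exact h _ _

theorem maskFalse_unitPhase (hS : ∀ t, MaskHolds f col tbl S.n (tagMask S t)) (fuel D : ℕ) {F : ℕ}
    (hF : MaskFalse f col tbl S.n F) : MaskFalse f col tbl S.n (unitPhase S fuel D F) := by
  induction fuel generalizing D F with
  | zero => exact hF
  | succ k ih =>
    change MaskFalse f col tbl S.n (sel (Nat.beq D 0) F
      (nextTag D fun t D => force (remaining (tagMask S t) F) fun m =>
        force (addUnit m F) fun F => unitPhase S k D F))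
    rw [sel_eq]
    split_ifs
    · exact hF
    · refine nextTag_ind fun t D' => ?_
      simp only [force_eq]
      exact ih _ (((hS t).remaining hF).maskFalse_addUnit hF)

theorem loadPhase_sound (hS : ∀ t, MaskHolds f col tbl S.n (tagMask S t)) {F : ℕ}
    (hF : MaskFalse f col tbl S.n F) {k : ℕ → DB → Bool}
    (hk : ∀ i db, db.Holds f col tbl S.n → k i db = false) (fuel D i : ℕ) {db : DB}
    (hdb : db.Holds f col tbl S.n) : loadPhase S F k fuel D i db = false := by
  induction fuel generalizing D i db with
  | zero => exact hk _ _ hdb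
  | succ m ih =>
    change sel (Nat.beq D 0) (k i db)
      (nextTag D fun t D => force (remaining (tagMask S t) F) fun m' =>
        force i fun i => loadPhase S F k m D (Nat.succ i) (db.insert m' i)) = false
    rw [sel_eq]
    split_ifs
    · exact hk _ _ hdb
    · refine nextTag_ind (motive := fun b => b = false) fun t D' => ?_
      simp only [force_eq]
      exact ih _ _ (hdb.insert ((hS t).remaining hF) _)

theorem verify_eq_false (hS : ∀ t, MaskHolds f col tbl S.n (tagMask S t)) (us as ls : List ℕ) :
    verify S us as ls = false := by
  have hU : ∀ (us : List ℕ) (F : ℕ), MaskFalse f col tbl S.n F →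
      MaskFalse f col tbl S.n (unitsAll S us F) := by
    intro us
    induction us with
    | nil => exact fun F hF => hF
    | cons D us ih =>
      intro F hF
      change MaskFalse f col tbl S.n (force (unitPhase S 100 D F) fun F => unitsAll S us F)
      rw [force_eq]
      exact ih _ (maskFalse_unitPhase hS _ _ hF)
  have hL : ∀ (as : List ℕ) (F : ℕ), MaskFalse f col tbl S.n F → ∀ i db,
      db.Holds f col tbl S.n → loadAll S F (fun i db => run ls i db F) as i db = false := by
    intro as F hF
    induction as with
    | nil => exact fun i db hdb => run_sound ls i hdb hF
    | cons D as ih =>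
      intro i db hdb
      change loadPhase S F (loadAll S F (fun i db => run ls i db F) as) 100 D i db = false
      exact loadPhase_sound hS hF ih _ _ _ hdb
  unfold verify
  rw [force_eq]
  exact hL as _ (hU us 0 .zero) 0 .nil trivial

end Semantics
end FourBlocked

namespace FourBlocked
section Semantics
variable {f : ℕ → ℝ × ℝ} {col : ℕ → ℕ} {tbl : List (ℕ × ℕ × ℕ × ℕ)}

theorem code3_eq (b i j k : ℕ) : Atom.code3 b i j k = (i * b + j) * b + k := rfl

theorem code3_decode {b i j k : ℕ} (hj : j < b) (hk : k < b) :
    Atom.code3 b i j k / b / b = i ∧ Atom.code3 b i j k / b % b = j ∧ Atom.code3 b i j k % b =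
      k := by
  have hb : 0 < b := by omega
  have h1 : ((i * b + j) * b + k) / b = i * b + j := by
    rw [mul_comm _ b, Nat.mul_add_div hb, Nat.div_eq_of_lt hk, add_zero]
  have h2 : (i * b + j) / b = i := by
    rw [mul_comm _ b, Nat.mul_add_div hb, Nat.div_eq_of_lt hj, add_zero]
  rw [code3_eq, h1, h2, Nat.mul_add_mod_of_lt hj, Nat.mul_add_mod_of_lt hk]
  exact ⟨rfl, rfl, rfl⟩

theorem blt_iff {a b : ℕ} : Nat.blt a b = true ↔ a < b := by
  simp [Nat.blt]

theorem Atom.inRange_P {n i j k : ℕ} : (Atom.P i j k).inRange n = true ↔ i < n ∧ j < n ∧ k < n := by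
  change sel (Nat.blt i n) (sel (Nat.blt j n) (Nat.blt k n) false) false = true ↔ _
  simp only [sel_eq, blt_iff]
  split_ifs <;> simp_all

theorem Atom.inRange_B {n i j k : ℕ} : (Atom.B i j k).inRange n = true ↔ i < n ∧ j < n ∧ k < n :=
  Atom.inRange_P

theorem Atom.inRange_C {n i c : ℕ} : (Atom.C i c).inRange n = true ↔ i < n ∧ c < 4 := by
  change sel (Nat.blt i n) (Nat.blt c 4) false = true ↔ _
  simp only [sel_eq, blt_iff]
  split_ifs <;> simp_all

theorem Atom.inRange_I {n k x : ℕ} : (Atom.I k x).inRange n = true ↔ x < n := blt_iff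

theorem Atom.val_idx {n : ℕ} (a : Atom) (h : a.inRange n = true) :
    Val f col tbl n (a.idx n) ↔ a.Holds f col tbl := by
  cases a with
  | P i j k =>
    obtain ⟨hi, hj, hk⟩ := Atom.inRange_P.1 h
    have key : ∀ i j k, j < n → k < n →
        (Val f col tbl n (4 * Atom.code3 n i j k + 1) ↔ (Atom.P i j k).Holds f col tbl) := by
      intro i j k hj hk
      obtain ⟨h1, h2, h3⟩ := code3_decode (i := i) hj hk
      unfold Val
      rw [if_neg (by omega), if_pos (by omega),
        show (4 * Atom.code3 n i j k + 1) / 4 = Atom.code3 n i j k by omega, h1, h2, h3]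
    change Val f col tbl n (4 * Atom.rot n i j k + 1) ↔ _
    unfold Atom.rot
    simp only [sel_eq]
    split_ifs
    · exact key _ _ _ hj hk
    · rw [key _ _ _ hi hj]; simp only [Atom.Holds, orient_rot]
    · rw [key _ _ _ hk hi]; simp only [Atom.Holds, orient_rot]
    · rw [key _ _ _ hi hj]; simp only [Atom.Holds, orient_rot]
  | B i j k =>
    obtain ⟨hi, hj, hk⟩ := Atom.inRange_B.1 h
    have key : ∀ i j k, j < n → k < n →
        (Val f col tbl n (4 * Atom.code3 n i j k + 2) ↔ (Atom.B i j k).Holds f col tbl) := by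
      intro i j k hj hk
      obtain ⟨h1, h2, h3⟩ := code3_decode (i := i) hj hk
      unfold Val
      rw [if_neg (by omega), if_neg (by omega), if_pos (by omega),
        show (4 * Atom.code3 n i j k + 2) / 4 = Atom.code3 n i j k by omega, h1, h2, h3]
    change Val f col tbl n (4 * (sel (Nat.ble i k) (Atom.code3 n i j k) (Atom.code3 n k j i)) + 2) ↔
      _
    rw [sel_eq]
    split_ifs
    · exact key _ _ _ hj hk
    · rw [key _ _ _ hj hi]; exact ⟨Btw.symm, Btw.symm⟩
  | C i c =>
    obtain ⟨hi, hc⟩ := Atom.inRange_C.1 h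
    change Val f col tbl n (4 * (4 * i + c)) ↔ _
    unfold Val
    rw [if_pos (by omega), show 4 * (4 * i + c) / 4 / 4 = i by omega,
      show 4 * (4 * i + c) / 4 % 4 = c by omega]
  | I k x =>
    have hx := Atom.inRange_I.1 h
    change Val f col tbl n (4 * (n * k + x) + 3) ↔ _
    unfold Val
    rw [if_neg (by omega), if_neg (by omega), if_neg (by omega),
      show (4 * (n * k + x) + 3) / 4 = n * k + x by omega, Nat.mul_add_div (by omega),
      Nat.div_eq_of_lt hx, add_zero, Nat.mul_add_mod, Nat.mod_eq_of_lt hx]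

/-- `c` holds as soon as its atoms are in range. -/
def Sound (f : ℕ → ℝ × ℝ) (col : ℕ → ℕ) (tbl : List (ℕ × ℕ × ℕ × ℕ)) (n : ℕ) (c : List Lit) :
    Prop :=
  (∀ l ∈ c, l.atom.inRange n = true) → ClauseHolds f col tbl c

theorem MaskHolds.lor {n m m' : ℕ} (h : MaskHolds f col tbl n m ∨ MaskHolds f col tbl n m') :
    MaskHolds f col tbl n (Nat.lor m m') := by
  obtain ⟨j, hj, hb⟩ | ⟨j, hj, hb⟩ := h <;> refine ⟨j, ?_, hb⟩ <;>
    change (m ||| m').testBit j = true <;> rw [Nat.testBit_or, hj] <;> simp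

theorem Lit.maskHolds {n : ℕ} {l : Lit} (hok : l.atom.ok n = true) (hl : l.Holds f col tbl) :
    MaskHolds f col tbl n (l.mask n) := by
  have h2 : l.atom.inRange n = true ∧ l.atom.idx n < 16384 := by
    unfold Atom.ok at hok
    rw [sel_eq] at hok
    split_ifs at hok with h
    · exact ⟨h, blt_iff.1 hok⟩
  cases l with
  | yes a =>
    refine ⟨a.idx n, ?_, ?_⟩
    · change (Nat.shiftLeft 1 _).testBit _ = true
      rw [testBit_one_shiftLeft]; simp
    · change a.inRange n = true ∧ a.idx n < 16384 at h2
      unfold BitTrue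
      rw [Nat.div_eq_of_lt h2.2, if_pos rfl, Nat.mod_eq_of_lt h2.2]
      exact (a.val_idx h2.1).2 hl
  | no a =>
    refine ⟨16384 + a.idx n, ?_, ?_⟩
    · change (Nat.shiftLeft 1 _).testBit _ = true
      rw [testBit_one_shiftLeft]; exact decide_eq_true rfl
    · change a.inRange n = true ∧ a.idx n < 16384 at h2
      unfold BitTrue
      rw [if_neg (by omega), show (16384 + a.idx n) % 16384 = a.idx n by omega]
      exact fun h => hl ((a.val_idx h2.1).1 h)

theorem maskHolds_checkedMask {n : ℕ} {c : List Lit} (h : Sound f col tbl n c) :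
    MaskHolds f col tbl n (checkedMask n c) := by
  have e : ∀ l c, checkedMask n (l :: c) =
      if l.atom.ok n = true then Nat.lor (l.mask n) (checkedMask n c) else trueMask :=
    fun l c => sel_eq _ _ _
  by_cases hc : ∀ l ∈ c, l.atom.inRange n = true
  · obtain ⟨l, hl, hh⟩ := h hc
    clear h hc
    induction c with
    | nil => simp at hl
    | cons l' c ih =>
      rw [e]
      split_ifs with hok
      · rcases List.mem_cons.1 hl with rfl | hl
        · exact .lor (.inl (Lit.maskHolds hok hh))
        · exact .lor (.inr (ih hl))
      · exact maskHolds_trueMask n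
  · clear h
    induction c with
    | nil => simp at hc
    | cons l c ih =>
      rw [e]
      split_ifs with hok
      · refine .lor (.inr (ih fun h => hc fun l' hl' => ?_))
        rcases List.mem_cons.1 hl' with rfl | hl'
        · unfold Atom.ok at hok
          rw [sel_eq] at hok
          split_ifs at hok with h
          · exact h
        · exact h _ hl'
      · exact maskHolds_trueMask n

end Semantics
end FourBlocked

namespace FourBlocked
section Semantics
variable {f : ℕ → ℝ × ℝ} {col : ℕ → ℕ} {tbl : List (ℕ × ℕ × ℕ × ℕ)} {n : ℕ} {maxc : ℕ → ℕ}

theorem clauseHolds_trivialClause : ClauseHolds f col tbl trivialClause := by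
  by_cases h : col 0 = 0
  · exact ⟨.yes (.C 0 0), by simp [trivialClause], h⟩
  · exact ⟨.no (.C 0 0), by simp [trivialClause], h⟩

theorem sound_trivialClause : Sound f col tbl n trivialClause :=
  fun _ => clauseHolds_trivialClause

theorem sound_sel {b : Bool} {c d : List Lit} (hc : b = true → Sound f col tbl n c)
    (hd : ¬ b = true → Sound f col tbl n d) : Sound f col tbl n (sel b c d) := by
  rw [sel_eq]
  split_ifs with h
  exacts [hc h, hd h]

theorem sound_guarded {b : Bool} {c : List Lit} (h : b = true → Sound f col tbl n c) :
    Sound f col tbl n (guarded b c) :=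
  sound_sel h fun _ => sound_trivialClause

theorem sound_case4 {k : ℕ} {a b c d : List Lit} (ha : Sound f col tbl n a)
    (hb : Sound f col tbl n b) (hc : Sound f col tbl n c) (hd : Sound f col tbl n d) :
    Sound f col tbl n (case4 k a b c d) :=
  sound_sel (fun _ => sound_sel (fun _ => ha) fun _ => hb)
    fun _ => sound_sel (fun _ => hc) fun _ => hd

theorem clauseHolds_nil : ¬ ClauseHolds f col tbl [] := by simp [ClauseHolds]

theorem clauseHolds_yes {a : Atom} {c : List Lit} :
    ClauseHolds f col tbl (.yes a :: c) ↔ (¬ a.Holds f col tbl → ClauseHolds f col tbl c) := by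
  simp only [ClauseHolds, List.mem_cons, exists_eq_or_imp, Lit.Holds]
  tauto

theorem clauseHolds_no {a : Atom} {c : List Lit} :
    ClauseHolds f col tbl (.no a :: c) ↔ (a.Holds f col tbl → ClauseHolds f col tbl c) := by
  simp only [ClauseHolds, List.mem_cons, exists_eq_or_imp, Lit.Holds]
  tauto

theorem mem_rangeLits {x y z q m : ℕ} (l : ℕ → Lit) (hq : q < m) (hx : q ≠ x) (hy : q ≠ y)
    (hz : q ≠ z) : l q ∈ rangeLits x y z l m := by
  induction m with
  | zero => omega
  | succ m ih =>
    change l q ∈ sel (Nat.beq m x) (rangeLits x y z l m) (sel (Nat.beq m y) (rangeLits x y z l m)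
      (sel (Nat.beq m z) (rangeLits x y z l m) (l m :: rangeLits x y z l m)))
    simp only [sel_eq, Nat.beq_eq]
    rcases Nat.lt_succ_iff_lt_or_eq.1 hq with h | rfl
    · split_ifs <;> simp [ih h]
    · simp [hx, hy, hz]

theorem distinct3_iff {x y z : ℕ} : distinct3 x y z = true ↔ x ≠ y ∧ x ≠ z ∧ y ≠ z := by
  unfold distinct3
  simp only [sel_eq, Nat.beq_eq]
  split_ifs <;> simp_all [← Bool.not_eq_true]

theorem not_beq_iff {x y : ℕ} : (!Nat.beq x y) = true ↔ x ≠ y := by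
  simp [← Bool.not_eq_true]

theorem orient_self_right (a b : ℝ × ℝ) : orient a b b = 0 := by unfold orient; ring
theorem orient_self_outer (a b : ℝ × ℝ) : orient a b a = 0 := by unfold orient; ring
theorem orient_self_left (a b : ℝ × ℝ) : orient a a b = 0 := by unfold orient; ring

/-- Three points on a line, with their betweenness relation. -/
theorem exists_btw_of_orient_eq_zero {a b c : ℝ × ℝ} (h : orient a b c = 0) (hab : a ≠ b)
    (hac : a ≠ c) (hbc : b ≠ c) : Btw a b c ∨ Btw b c a ∨ Btw c a b := by
  have hpos : ∀ u v : ℝ × ℝ, u ≠ v → 0 < (u.1 - v.1) ^ 2 + (u.2 - v.2) ^ 2 := by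
    intro u v huv
    by_contra hn
    have h1 : u.1 - v.1 = 0 := by nlinarith [sq_nonneg (u.1 - v.1), sq_nonneg (u.2 - v.2)]
    have h2 : u.2 - v.2 = 0 := by nlinarith [sq_nonneg (u.1 - v.1), sq_nonneg (u.2 - v.2)]
    exact huv (Prod.ext (by linarith) (by linarith))
  have h1 := hpos a b hab
  have h2 := hpos a c hac
  have h3 := hpos b c hbc
  by_contra hcon
  simp only [not_or, Btw, not_and, not_lt] at hcon
  obtain ⟨k1, k2, k3⟩ := hcon
  have k1 := k1 h
  have k2 := k2 (by rw [orient_rot, h])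
  have k3 := k3 (by rw [← orient_rot, h])
  obtain ⟨a1, a2⟩ := a
  obtain ⟨b1, b2⟩ := b
  obtain ⟨c1, c2⟩ := c
  simp only [orient] at *
  set p := (a1 - b1) ^ 2 + (a2 - b2) ^ 2
  set q := (a1 - c1) ^ 2 + (a2 - c2) ^ 2
  obtain ⟨r, hr⟩ : ∃ r, r = (b1 - a1) * (c1 - a1) + (b2 - a2) * (c2 - a2) := ⟨_, rfl⟩
  have hrp : r ≤ p := by simp only [p]; linarith
  have hrq : r ≤ q := by simp only [q]; linarith
  have hr0 : 0 ≤ r := by linarith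
  have hpq : r ^ 2 = p * q := by
    have : r ^ 2 = p * q - ((b1 - a1) * (c2 - a2) - (b2 - a2) * (c1 - a1)) ^ 2 := by
      rw [hr]; ring
    rw [this, h]; ring
  have hs : p + q - 2 * r = (b1 - c1) ^ 2 + (b2 - c2) ^ 2 := by rw [hr]; ring
  have hr1 : 0 < r := by
    refine hr0.lt_of_ne fun h0 => ?_
    rw [← h0] at hpq
    nlinarith [mul_pos h1 h2]
  have hqr : q ≤ r := le_of_mul_le_mul_left (by nlinarith) hr1
  have hpr : p ≤ r := le_of_mul_le_mul_left (by nlinarith) hr1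
  linarith

theorem product_nonneg_of_not_weakLits {o a b c d e g : ℕ} {r : List Lit}
    (h : ¬ ClauseHolds f col tbl (weakLits o a b c d e g r)) :
    0 ≤ orient (f a) (f b) (f c) * orient (f d) (f e) (f g) ∧ ¬ ClauseHolds f col tbl r := by
  unfold weakLits at h
  simp only [sel_eq] at h
  split_ifs at h <;> simp only [clauseHolds_yes, Atom.Holds, Classical.not_imp, not_lt] at h
  · obtain ⟨h1, h2, h⟩ := h
    rw [orient_swap] at h1 h2
    exact ⟨mul_nonneg (by linarith) (by linarith), h⟩
  · exact ⟨mul_nonneg_of_nonpos_of_nonpos h.1 h.2.1, h.2.2⟩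
  · obtain ⟨h1, h2, h⟩ := h
    rw [orient_swap] at h2
    rw [le_antisymm h1 (by linarith)]
    exact ⟨by simp, h⟩
  · obtain ⟨h1, h2, h⟩ := h
    rw [orient_swap] at h2
    rw [le_antisymm h1 (by linarith)]
    exact ⟨by simp, h⟩

theorem sound_gpClause (a b c d e s o : ℕ) : Sound f col tbl n (gpClause a b c d e s o) := by
  intro _
  by_contra hcon
  unfold gpClause signAtom at hcon
  simp only [clauseHolds_no, Classical.not_imp, sel_eq] at hcon
  obtain ⟨h1, h2, h⟩ := hcon
  obtain ⟨h3, h⟩ := product_nonneg_of_not_weakLits h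
  obtain ⟨h4, -⟩ := product_nonneg_of_not_weakLits h
  have hp : 0 < orient (f a) (f b) (f c) * orient (f a) (f d) (f e) := by
    split_ifs at h1 h2
    · exact mul_pos h1 h2
    · simp only [Atom.Holds] at h1 h2
      rw [orient_swap] at h1 h2
      exact mul_pos_of_neg_of_neg (by linarith) (by linarith)
  linarith [orient_grassmann (f a) (f b) (f c) (f d) (f e)]

theorem btw_iff_mem_openSegment {p q r : ℝ × ℝ} : Btw p q r ↔ p ≠ r ∧ q ∈ openSegment ℝ p r := by
  obtain ⟨p1, p2⟩ := p
  obtain ⟨q1, q2⟩ := q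
  obtain ⟨r1, r2⟩ := r
  simp only [Btw, orient, openSegment, Set.mem_ofPred_eq, Prod.smul_mk, Prod.mk_add_mk, smul_eq_mul,
    Prod.mk.injEq, ne_eq]
  constructor
  · rintro ⟨h0, hd⟩
    have hw : 0 < (q1 - p1) * (r1 - p1) + (q2 - p2) * (r2 - p2) := by
      nlinarith [sq_nonneg (q1 - p1), sq_nonneg (q2 - p2)]
    have hv : 0 < (r1 - q1) * (r1 - p1) + (r2 - q2) * (r2 - p2) := by
      nlinarith [sq_nonneg (r1 - q1), sq_nonneg (r2 - q2)]
    have hdd : 0 < (r1 - p1) ^ 2 + (r2 - p2) ^ 2 := by nlinarith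
    refine ⟨?_, ((r1 - q1) * (r1 - p1) + (r2 - q2) * (r2 - p2)) / ((r1 - p1) ^ 2 + (r2 - p2) ^ 2),
      ((q1 - p1) * (r1 - p1) + (q2 - p2) * (r2 - p2)) / ((r1 - p1) ^ 2 + (r2 - p2) ^ 2),
      div_pos hv hdd, div_pos hw hdd, ?_, ?_, ?_⟩
    · rintro ⟨rfl, rfl⟩
      simp at hdd
    · field_simp
      ring
    · field_simp
      linear_combination -(r2 - p2) * h0
    · field_simp
      linear_combination (r1 - p1) * h0
  · rintro ⟨hne, a, b, ha, hb, hab, rfl, rfl⟩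
    obtain rfl : a = 1 - b := by linarith
    refine ⟨by ring, ?_⟩
    have : 0 < (1 - b) * b * ((r1 - p1) ^ 2 + (r2 - p2) ^ 2) := by
      refine mul_pos (mul_pos ha hb) ?_
      by_contra hn
      exact hne ⟨by nlinarith [sq_nonneg (r1 - p1), sq_nonneg (r2 - p2)],
        by nlinarith [sq_nonneg (r1 - p1), sq_nonneg (r2 - p2)]⟩
    linarith

theorem Btw.exists_orient {p q r : ℝ × ℝ} (h : Btw p q r) : ∃ a b : ℝ, 0 < a ∧ 0 < b ∧ a + b = 1 ∧
    ∀ x, orient x p q = b * orient x p r ∧ orient x q r = a * orient x p r := by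
  obtain ⟨-, a, b, ha, hb, hab, rfl⟩ := btw_iff_mem_openSegment.1 h
  refine ⟨a, b, ha, hb, hab, fun x => ?_⟩
  obtain rfl : a = 1 - b := by linarith
  simp only [orient, Prod.smul_fst, Prod.smul_snd, Prod.fst_add, Prod.snd_add, smul_eq_mul]
  constructor <;> ring

theorem Btw.orient_pos_iff {p q r : ℝ × ℝ} (h : Btw p q r) (x : ℝ × ℝ) :
    (0 < orient x p q ↔ 0 < orient x p r) ∧ (0 < orient x q r ↔ 0 < orient x p r) := by
  obtain ⟨a, b, ha, hb, -, hx⟩ := h.exists_orient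
  rw [(hx x).1, (hx x).2, mul_pos_iff_of_pos_left ha, mul_pos_iff_of_pos_left hb]
  exact ⟨Iff.rfl, Iff.rfl⟩

section Rules
variable (hC : Config n f col maxc)
include hC

theorem sound_sides (p q r x o : ℕ) :
    Sound f col tbl n (.no (.B p q r) :: case4 o [.no (.P x p q), .yes (.P x q r)]
      [.no (.P x q r), .yes (.P x p r)] [.no (.P x p r), .yes (.P x p q)]
      (guarded (sel (Nat.beq x q) false (distinct3 x p r)) [.yes (.P x p q),
        .yes (.P x q p)])) := by
  have key : ∀ c, (p < n → q < n → r < n → (Atom.B p q r).Holds f col tbl → Sound f col tbl n c) →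
      Sound f col tbl n (.no (.B p q r) :: c) := by
    intro c hc hr
    rw [clauseHolds_no]
    obtain ⟨h1, h2, h3⟩ := Atom.inRange_B.1 (hr _ List.mem_cons_self)
    exact fun h => hc h1 h2 h3 h fun l hl => hr l (List.mem_cons_of_mem _ hl)
  refine key _ fun hp hq hr h => ?_
  have h1 := h.orient_pos_iff (f x)
  refine sound_case4 (fun _ => ?_) (fun _ => ?_) (fun _ => ?_) (sound_guarded fun hg hR => ?_)
  iterate 3
    simp only [clauseHolds_no, clauseHolds_yes, clauseHolds_nil, Atom.Holds]
    tauto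
  have hx : x < n := (Atom.inRange_P.1 (hR _ List.mem_cons_self)).1
  simp only [clauseHolds_yes, clauseHolds_nil, Atom.Holds]
  rw [sel_eq] at hg
  split_ifs at hg with hxq
  rw [Nat.beq_eq] at hxq
  rw [distinct3_iff] at hg
  have := hC.off_line p hp q hq r hr x hx h hg.1 hxq hg.2.1
  rw [orient_swap (f x) (f p) (f q)]
  intro h2 h3
  exact this (le_antisymm (by linarith) (by linarith))

theorem sound_count (c a1 a2 a3 a4 : ℕ) :
    Sound f col tbl n (guarded (Nat.blt (maxc c) [a1, a2, a3, a4].dedup.length)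
      [.no (.C a1 c), .no (.C a2 c), .no (.C a3 c), .no (.C a4 c)]) := by
  refine sound_guarded fun hg hR => ?_
  rw [blt_iff] at hg
  simp only [clauseHolds_no, clauseHolds_nil, Atom.Holds]
  intro h1 h2 h3 h4
  simp only [List.mem_cons, List.not_mem_nil, or_false, forall_eq_or_imp, forall_eq, Lit.atom,
    Atom.inRange_C] at hR
  have := hC.count c hR.1.2 [a1, a2, a3, a4].toFinset (by
    intro i hi
    simp only [List.mem_toFinset, List.mem_cons, List.not_mem_nil, or_false] at hi
    rcases hi with rfl | rfl | rfl | rfl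
    exacts [⟨hR.1.1, h1⟩, ⟨hR.2.1.1, h2⟩, ⟨hR.2.2.1.1, h3⟩, ⟨hR.2.2.2.1, h4⟩])
  rw [List.card_toFinset] at this
  omega

theorem sound_exists_btw (p r c : ℕ) :
    Sound f col tbl n (guarded (!Nat.beq p r) (.no (.C p c) :: .no (.C r c) ::
      rangeLits p r p (fun q => .yes (.B p q r)) n)) := by
  refine sound_guarded fun hg hR => ?_
  have hpr : p ≠ r := not_beq_iff.1 hg
  have h1 := (Atom.inRange_C.1 (hR (.no (.C p c)) (by simp))).1
  have h2 := (Atom.inRange_C.1 (hR (.no (.C r c)) (by simp))).1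
  rw [clauseHolds_no, clauseHolds_no]
  intro hp hr
  obtain ⟨q, hq, hb⟩ := hC.exists_btw p h1 r h2 hpr (hp.trans hr.symm)
  refine ⟨.yes (.B p q r), mem_rangeLits _ hq ?_ ?_ ?_, hb⟩
  all_goals
    rintro rfl
  · exact hC.btw_ne q h1 q h1 r h2 hb rfl
  · exact hC.btw_ne p h1 q h2 q h2 hb (hp.trans hr.symm)
  · exact hC.btw_ne q h1 q h1 r h2 hb rfl

theorem sound_not_collinear (p q r : ℕ) :
    Sound f col tbl n (guarded (distinct3 p q r) [.yes (.P p q r), .yes (.P p r q),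
      .yes (.B p q r), .yes (.B q r p), .yes (.B r p q)]) := by
  refine sound_guarded fun hg hR => ?_
  obtain ⟨hpq, hpr, hqr⟩ := distinct3_iff.1 hg
  obtain ⟨hp, hq, hr⟩ := Atom.inRange_P.1 (hR (.yes (.P p q r)) (by simp))
  simp only [clauseHolds_yes, clauseHolds_nil, Atom.Holds]
  rw [orient_swap (f p) (f q) (f r)]
  intro h1 h2 h3 h4 h5
  have := exists_btw_of_orient_eq_zero (le_antisymm (not_lt.1 h1) (by linarith))
    (fun h => hpq (hC.inj _ hp _ hq h)) (fun h => hpr (hC.inj _ hp _ hr h))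
    (fun h => hqr (hC.inj _ hq _ hr h))
  tauto

theorem sound_hull (k c p q r d : ℕ) (ht : tbl.getD k (0, 0, 0, 0) = (p, q, r, d)) :
    Sound f col tbl n (guarded (sel (Nat.blt d 4) (sel (Nat.beq c d) false (distinct3 p q r)) false)
      (.no (.C p c) :: .no (.C q c) :: .no (.C r c) ::
        rangeLits p q r (fun x => .yes (.I k x)) n)) := by
  refine sound_guarded fun hg hR => ?_
  rw [sel_eq, sel_eq] at hg
  split_ifs at hg with hd hcd
  rw [blt_iff] at hd
  rw [Nat.beq_eq] at hcd
  obtain ⟨hpq, hpr, hqr⟩ := distinct3_iff.1 hg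
  have hp := (Atom.inRange_C.1 (hR (.no (.C p c)) (by simp))).1
  have hq := (Atom.inRange_C.1 (hR (.no (.C q c)) (by simp))).1
  have hr := (Atom.inRange_C.1 (hR (.no (.C r c)) (by simp))).1
  simp only [clauseHolds_no, Atom.Holds]
  intro h1 h2 h3
  obtain ⟨x, hx, hxd, ht'⟩ := hC.hull p hp q hq r hr hpq hpr hqr (by omega) (by omega) d hd
  refine ⟨.yes (.I k x), mem_rangeLits _ hx ?_ ?_ ?_, ?_⟩
  iterate 3
    rintro rfl
    omega
  simp only [Lit.Holds, Atom.Holds, ht]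
  exact ⟨hxd, ht'⟩

omit hC in
theorem sound_mem_hull (k x o p q r d : ℕ) (ht : tbl.getD k (0, 0, 0, 0) = (p, q, r, d)) :
    Sound f col tbl n (.no (.I k x) :: sel (Nat.beq o 0) [.yes (.C x d)] (hullLits o p q r x)) := by
  intro _
  rw [clauseHolds_no]
  simp only [Atom.Holds, ht]
  rintro ⟨h1, h2, h3⟩
  unfold hullLits
  simp only [sel_eq]
  split_ifs <;> simp only [clauseHolds_no, clauseHolds_yes, clauseHolds_nil, Atom.Holds] <;> tauto

end Rules

end Semantics

theorem sound_ruleClause {S : Setup} {f : ℕ → ℝ × ℝ} {col : ℕ → ℕ} (hC : Config S.n f col S.maxc)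
    (hS : ∀ c ∈ S.hyps, ClauseHolds f col S.tbl c) (k x0 x1 x2 x3 x4 x5 x6 : ℕ) :
    Sound f col S.tbl S.n (ruleClause S k x0 x1 x2 x3 x4 x5 x6) := by
  have basic : ∀ {p q r : ℕ} {c : List Lit}, (p < S.n → q < S.n → r < S.n → Btw (f p) (f q) (f r) →
      ClauseHolds f col S.tbl c) → Sound f col S.tbl S.n (.no (.B p q r) :: c) := by
    intro p q r c h hR
    obtain ⟨hp, hq, hr⟩ := Atom.inRange_B.1 (hR _ List.mem_cons_self)
    exact clauseHolds_no.2 (h hp hq hr)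
  refine sound_sel (fun _ => sound_sel (fun _ => ?_) fun _ => ?_)
    fun _ => sound_sel (fun _ => ?_) fun _ => ?_
  · refine sound_case4 (fun _ => ?_) (fun hR => ?_) (sound_guarded fun hg _ => ?_)
      (sound_count hC _ _ _ _ _)
    · rw [List.getD_eq_getElem?_getD]
      rcases h : S.hyps[Nat.add x0 (Nat.mul 16 x1)]? with _ | c
      · simpa [h] using clauseHolds_trivialClause
      · simpa [h] using hS _ (List.mem_of_getElem? h)
    · have := hC.col_lt x0 (Atom.inRange_C.1 (hR (.yes (.C x0 0)) (by simp))).1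
      simp only [clauseHolds_yes, clauseHolds_nil, Atom.Holds]
      omega
    · have := not_beq_iff.1 hg
      simp only [clauseHolds_no, clauseHolds_nil, Atom.Holds]
      omega
  · refine sound_case4 (basic fun hp hq hr h => ?_) (basic fun hp hq hr h => ?_)
      (basic fun hp hq hr h => ?_) (basic fun hp hq hr h => ?_)
    · have := hC.btw_eq _ hp _ hq _ hr h
      simp only [clauseHolds_yes, clauseHolds_no, clauseHolds_nil, Atom.Holds]
      omega
    · have := hC.btw_ne _ hp _ hq _ hr h
      simp only [clauseHolds_no, clauseHolds_nil, Atom.Holds]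
      omega
    · simp only [clauseHolds_no, clauseHolds_nil, Atom.Holds, h.1, lt_irrefl, false_imp_iff]
    · simp only [clauseHolds_no, clauseHolds_nil, Atom.Holds]
      intro h'
      have h1 := h.2
      have h2 := h'.2
      nlinarith [sq_nonneg ((f x0).1 - (f x1).1), sq_nonneg ((f x0).2 - (f x1).2)]
  · refine sound_case4 (sound_guarded fun hg hR => ?_) (sound_exists_btw hC _ _ _)
      (fun _ => ?_) (sound_not_collinear hC _ _ _)
    · have hx2 := (Atom.inRange_B.1 (hR (.no (.B x0 x2 x3)) (by simp))).2.1
      refine basic (fun hp hq hr h => ?_) hR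
      have := hC.btw_unique _ hp _ hq _ hx2 _ hr h
      simp only [clauseHolds_no, clauseHolds_nil, Atom.Holds]
      exact fun h' => not_beq_iff.1 hg (this h')
    · simp only [clauseHolds_no, clauseHolds_nil, Atom.Holds]
      rw [orient_swap (f x0) (f x1) (f x2)]
      intro h1 h2
      linarith
  · exact sound_case4 (sound_sides hC _ _ _ _ _) (sound_hull hC _ _ _ _ _ _ rfl)
      (sound_mem_hull _ _ _ _ _ _ _ rfl) (sound_gpClause _ _ _ _ _ _ _)

theorem verify_sound {S : Setup} {f : ℕ → ℝ × ℝ} {col : ℕ → ℕ} (hC : Config S.n f col S.maxc)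
    (hS : ∀ c ∈ S.hyps, ClauseHolds f col S.tbl c) (us as ls : List ℕ) :
    verify S us as ls = false := by
  refine verify_eq_false (f := f) (col := col) (tbl := S.tbl) (fun t => ?_) us as ls
  unfold tagMask digit
  simp only [force_eq]
  exact maskHolds_checkedMask (sound_ruleClause hC hS _ _ _ _ _ _ _ _)

end FourBlocked

namespace FourBlocked

/-- The colouring `c` of the finite set `P` gives the same colour exactly to the blocked pairs. -/
def Blk (P : Finset (ℝ × ℝ)) (c : ℝ × ℝ → Fin 4) : Prop :=
  ∀ v ∈ P, ∀ w ∈ P, v ≠ w → (c v = c w ↔ ∃ x ∈ P, Btw v x w)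

theorem Btw.ne {p q r : ℝ × ℝ} (h : Btw p q r) : p ≠ r := (btw_iff_mem_openSegment.1 h).1

theorem Btw.ne_left {p q r : ℝ × ℝ} (h : Btw p q r) : q ≠ p := by
  rintro rfl
  simpa using h.2

theorem Btw.ne_right {p q r : ℝ × ℝ} (h : Btw p q r) : q ≠ r := h.symm.ne_left

theorem Btw.trans_left {x q q' z : ℝ × ℝ} (h : Btw x q q') (h' : Btw x q' z) :
    Btw x q z ∧ Btw q q' z := by
  obtain ⟨hne, a, b, ha, hb, hab, rfl⟩ := btw_iff_mem_openSegment.1 h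
  obtain ⟨hne', a', b', ha', hb', hab', rfl⟩ := btw_iff_mem_openSegment.1 h'
  have hxz := h'.ne
  obtain rfl : a = 1 - b := by linarith
  obtain rfl : a' = 1 - b' := by linarith
  have hbb : b * b' < 1 := by nlinarith
  have h1 : Btw x ((1 - b) • x + b • ((1 - b') • x + b' • z)) z :=
    btw_iff_mem_openSegment.2 ⟨hxz, 1 - b * b', b * b', by linarith, by positivity, by ring, by
      ext <;> simp <;> ring⟩
  obtain ⟨D, hD⟩ : ∃ D, D = 1 - b * b' := ⟨_, rfl⟩
  have hD0 : 0 < D := by linarith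
  refine ⟨h1, btw_iff_mem_openSegment.2 ⟨h1.ne_right, (1 - b') / D, b' * (1 - b) / D,
    div_pos ha' hD0,
    div_pos (by positivity) hD0, ?_, ?_⟩⟩
  · rw [← add_div, div_eq_one_iff_eq hD0.ne', hD]
    ring
  · ext <;> simp <;> field_simp <;> rw [hD] <;> ring

/-- Two points of an open segment are ordered. -/
theorem Btw.linear {x q q' z : ℝ × ℝ} (h : Btw x q z) (h' : Btw x q' z) (hne : q ≠ q') :
    Btw x q q' ∨ Btw x q' q := by
  obtain ⟨hxz, a, b, ha, hb, hab, rfl⟩ := btw_iff_mem_openSegment.1 h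
  obtain ⟨-, a', b', ha', hb', hab', rfl⟩ := btw_iff_mem_openSegment.1 h'
  have hbb : b ≠ b' := by
    rintro rfl
    obtain rfl : a = a' := by linarith
    exact hne rfl
  obtain rfl : a = 1 - b := by linarith
  obtain rfl : a' = 1 - b' := by linarith
  rcases lt_or_gt_of_ne hbb with hlt | hlt
  · left
    refine btw_iff_mem_openSegment.2 ⟨h'.ne_left.symm, 1 - b / b', b / b', ?_, by positivity,
      by ring, ?_⟩
    · rw [sub_pos, div_lt_one hb']; exact hlt
    · ext <;> simp <;> field_simp <;> ring
  · right
    refine btw_iff_mem_openSegment.2 ⟨h.ne_left.symm, 1 - b' / b, b' / b, ?_, by positivity,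
      by ring, ?_⟩
    · rw [sub_pos, div_lt_one hb]; exact hlt
    · ext <;> simp <;> field_simp <;> ring

theorem Btw.not_btw {p q r : ℝ × ℝ} (h : Btw p q r) : ¬ Btw p r q := by
  intro h'
  have h1 := h.2
  have h2 := h'.2
  nlinarith [sq_nonneg (r.1 - q.1), sq_nonneg (r.2 - q.2)]

section Blk
variable {P : Finset (ℝ × ℝ)} {c : ℝ × ℝ → Fin 4} (h : Blk P c)
include h

/-- There is a point of `P` between `x` and `z` which sees `x`. -/
theorem Blk.exists_nearest {x y z : ℝ × ℝ} (hx : x ∈ P) (hy : y ∈ P)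
    (hb : Btw x y z) : ∃ y' ∈ P, Btw x y' z ∧ c x ≠ c y' ∧ (y' = y ∨ Btw x y' y) := by
  classical
  induction hn : (P.filter fun w => Btw x w y).card using
    Nat.strong_induction_on generalizing y with
  | _ n ih =>
    by_cases hc : c x = c y
    · obtain ⟨w, hw, hwb⟩ := (h x hx y hy hb.ne_left.symm).1 hc
      obtain ⟨y', h1, h2, h3, h4⟩ := ih _ (by
        rw [← hn]
        refine Finset.card_lt_card ?_
        rw [Finset.ssubset_iff_of_subset]
        · exact ⟨w, by simp [hw, hwb], by simpa using fun _ (h : Btw x w w) => h.ne_right rfl⟩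
        · intro u hu
          rw [Finset.mem_filter] at hu ⊢
          exact ⟨hu.1, (hu.2.trans_left hwb).1⟩) hw (hwb.trans_left hb).1 rfl
      refine ⟨y', h1, h2, h3, .inr ?_⟩
      rcases h4 with rfl | h4
      exacts [hwb, (h4.trans_left hwb).1]
    · exact ⟨y, hy, hb, hc, .inl rfl⟩

theorem Blk.btw_eq {x y z : ℝ × ℝ} (hx : x ∈ P) (hy : y ∈ P) (hz : z ∈ P) (hb : Btw x y z) :
    c x = c z :=
  (h x hx z hz hb.ne).2 ⟨y, hy, hb⟩

theorem Blk.btw_ne {x y z : ℝ × ℝ} (hx : x ∈ P) (hy : y ∈ P) (hz : z ∈ P) (hb : Btw x y z) :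
    c x ≠ c y := by
  obtain ⟨y', hy', hb', hc', hyy⟩ := h.exists_nearest hx hy hb
  rcases hyy with rfl | hyy
  · exact hc'
  · exact absurd ((h.btw_eq hx hy hz hb).trans (h.btw_eq hy' hy hz (hyy.trans_left hb).2).symm) hc'

theorem Blk.btw_unique {x y y' z : ℝ × ℝ} (hx : x ∈ P) (hy : y ∈ P) (hy' : y' ∈ P) (hz : z ∈ P)
    (hb : Btw x y z) (hb' : Btw x y' z) : y = y' := by
  by_contra hne
  rcases hb.linear hb' hne with h1 | h1
  · exact h.btw_ne hx hy' hz hb' (h.btw_eq hx hy hy' h1)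
  · exact h.btw_ne hx hy hz hb (h.btw_eq hx hy' hy h1)

theorem Blk.orient_ne_zero {x y z : ℝ × ℝ} (hx : x ∈ P) (hy : y ∈ P) (hz : z ∈ P) (hxy : x ≠ y)
    (hxz : x ≠ z) (hyz : y ≠ z) (hcy : c x = c y) (hcz : c x = c z) : orient x y z ≠ 0 := by
  intro ho
  rcases exists_btw_of_orient_eq_zero ho hxy hxz hyz with h1 | h1 | h1
  · exact h.btw_ne hx hy hz h1 hcy
  · exact h.btw_ne hy hz hx h1 (hcy.symm.trans hcz)
  · exact h.btw_ne hz hx hy h1 hcz.symm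

theorem Blk.off_line {p q r x : ℝ × ℝ} (hp : p ∈ P) (hq : q ∈ P) (hr : r ∈ P) (hx : x ∈ P)
    (hb : Btw p q r) (hxp : x ≠ p) (hxq : x ≠ q) (hxr : x ≠ r) : orient x p q ≠ 0 := by
  intro ho
  obtain ⟨a, b, -, hb0, -, hab⟩ := hb.exists_orient
  have hxpr : orient x p r = 0 := by
    have := (hab x).1
    rw [ho] at this
    exact (mul_eq_zero.1 this.symm).resolve_left hb0.ne'
  have hpr := h.btw_eq hp hq hr hb
  have hpq := h.btw_ne hp hq hr hb
  rcases exists_btw_of_orient_eq_zero ho hxp hxq hb.ne_left.symm with h1 | h1 | h1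
  · rcases exists_btw_of_orient_eq_zero hxpr hxp hxr hb.ne with h2 | h2 | h2
    · exact h.btw_ne hx hp hq h1 ((h.btw_eq hx hp hr h2).trans hpr.symm)
    · exact h1.not_btw (hb.trans_left h2).1.symm
    · exact hxq (h.btw_unique hp hx hq hr h2.symm hb)
  · exact h.orient_ne_zero hx hp hr hxp hxr hb.ne (h.btw_eq hp hq hx h1).symm
      ((h.btw_eq hp hq hx h1).symm.trans hpr) hxpr
  · exact hpq (h.btw_eq hq hx hp h1).symm

end Blk
end FourBlocked

namespace FourBlocked

/-- The closed triangle with vertices `p`, `q`, `r`. -/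
def tri (p q r : ℝ × ℝ) : Set (ℝ × ℝ) := convexHull ℝ {p, q, r}

theorem tri_rot (p q r : ℝ × ℝ) : tri q r p = tri p q r := by
  unfold tri
  congr 1
  ext; simp; tauto

theorem left_mem_tri (p q r : ℝ × ℝ) : p ∈ tri p q r := subset_convexHull ℝ _ (by simp)

theorem mid_mem_tri (p q r : ℝ × ℝ) : q ∈ tri p q r := subset_convexHull ℝ _ (by simp)

theorem right_mem_tri (p q r : ℝ × ℝ) : r ∈ tri p q r := subset_convexHull ℝ _ (by simp)

theorem Btw.mem_convex {K : Set (ℝ × ℝ)} (hK : Convex ℝ K) {p q r : ℝ × ℝ} (h : Btw p q r)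
    (hp : p ∈ K) (hr : r ∈ K) : q ∈ K :=
  hK.openSegment_subset hp hr (btw_iff_mem_openSegment.1 h).2

theorem convex_tri (p q r : ℝ × ℝ) : Convex ℝ (tri p q r) := convex_convexHull ℝ _

theorem tri_subset {K : Set (ℝ × ℝ)} (hK : Convex ℝ K) {p q r : ℝ × ℝ} (hp : p ∈ K) (hq : q ∈ K)
    (hr : r ∈ K) : tri p q r ⊆ K := by
  refine convexHull_min ?_ hK
  simp [Set.insert_subset_iff, hp, hq, hr]

theorem convex_orient_le (p q : ℝ × ℝ) (s t : ℝ) : Convex ℝ {x | orient p q x * s ≤ t} := by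
  intro x hx y hy a b ha hb hab
  simp only [Set.mem_ofPred_eq, orient, Prod.fst_add, Prod.snd_add, Prod.smul_fst, Prod.smul_snd,
    smul_eq_mul] at *
  obtain rfl : a = 1 - b := by linarith
  nlinarith [mul_le_mul_of_nonneg_left hx ha, mul_le_mul_of_nonneg_left hy hb]

theorem convex_orient_lt (p q : ℝ × ℝ) (s t : ℝ) : Convex ℝ {x | orient p q x * s < t} := by
  intro x hx y hy a b ha hb hab
  simp only [Set.mem_ofPred_eq, orient, Prod.fst_add, Prod.snd_add, Prod.smul_fst, Prod.smul_snd,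
    smul_eq_mul] at *
  obtain rfl : a = 1 - b := by linarith
  rcases hb.eq_or_lt with rfl | hb
  · simpa using hx
  · nlinarith [mul_le_mul_of_nonneg_left hx.le ha, mul_lt_mul_of_pos_left hy hb]

theorem orient_nonneg_of_mem_tri {p q r x : ℝ × ℝ} (h : 0 < orient p q r) (hx : x ∈ tri p q r) :
    0 ≤ orient p q x := by
  have : x ∈ {x | orient p q x * (-1) ≤ 0} := by
    refine tri_subset (convex_orient_le _ _ _ _) ?_ ?_ ?_ hx <;>
      simp [orient_self_outer, orient_self_right, h.le]
  simpa using this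

theorem inTri_of_mem_tri {p q r x : ℝ × ℝ} (hx : x ∈ tri p q r) : InTri p q r x := by
  have key : ∀ {p q r}, x ∈ tri p q r → 0 < orient p q r → ¬ 0 < orient q p x := by
    intro p q r hx h
    have := orient_nonneg_of_mem_tri h hx
    have : orient q p x = -orient p q x := by unfold orient; ring
    linarith
  have rot : ∀ {p q r}, x ∈ tri p q r → 0 < orient p q r →
      ¬ 0 < orient q p x ∧ ¬ 0 < orient r q x ∧ ¬ 0 < orient p r x := by
    intro p q r hx h
    have h1 : 0 < orient q r p := by rwa [orient_rot]
    have h2 : 0 < orient r p q := by rwa [orient_rot]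
    have hx1 : x ∈ tri q r p := by rwa [tri_rot]
    have hx2 : x ∈ tri r p q := by rwa [tri_rot]
    exact ⟨key hx h, key hx1 h1, key hx2 h2⟩
  have h2 : x ∈ tri p r q := by
    rwa [tri, Set.pair_comm]
  constructor
  · exact rot hx
  · intro h
    obtain ⟨a, b, c⟩ := rot h2 h
    exact ⟨a, b, c⟩

theorem eq_of_mem_tri {p q r x : ℝ × ℝ} (h : orient q r p ≠ 0) (hx : x ∈ tri p q r) :
    x = p ∨ orient q r x * orient q r p < orient q r p * orient q r p := by
  have : x ∈ ({p} : Set (ℝ × ℝ)) ∪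
      {x | orient q r x * orient q r p < orient q r p * orient q r p} := by
    refine tri_subset ?_ (.inl rfl) ?_ ?_ hx
    · have hp := mul_self_pos.2 h
      intro y hy z hz a b ha hb hab
      obtain rfl : a = 1 - b := by linarith
      have e : orient q r ((1 - b) • y + b • z) = (1 - b) * orient q r y + b * orient q r z := by
        unfold orient
        simp
        ring
      rcases ha.eq_or_lt with ha | ha
      · obtain rfl : b = 1 := by linarith
        simpa using hz
      rcases hb.eq_or_lt with rfl | hb
      · simpa using hy
      rcases hy with rfl | hy <;> rcases hz with rfl | hz
      · left
        simp [← add_smul]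
      all_goals
        right
        simp only [Set.mem_ofPred_eq, e] at *
        nlinarith
    all_goals
      right
      simpa [orient_self_outer, orient_self_right] using h
  simpa using this

/-- A vertex of a triangle is not in the hull of other points of the triangle. -/
theorem left_notMem_tri {p q r x y z : ℝ × ℝ} (h : orient p q r ≠ 0) (hx : x ∈ tri p q r)
    (hy : y ∈ tri p q r) (hz : z ∈ tri p q r) (hxp : x ≠ p) (hyp : y ≠ p) (hzp : z ≠ p) :
    p ∉ tri x y z := by
  have h' : orient q r p ≠ 0 := by rwa [orient_rot]
  intro hp
  have := tri_subset (convex_orient_lt q r (orient q r p) (orient q r p * orient q r p))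
    ((eq_of_mem_tri h' hx).resolve_left hxp) ((eq_of_mem_tri h' hy).resolve_left hyp)
    ((eq_of_mem_tri h' hz).resolve_left hzp) hp
  simp at this

end FourBlocked

namespace FourBlocked

theorem Btw.exists_orient_eq {x w y : ℝ × ℝ} (h : Btw x w y) : ∃ u v : ℝ, 0 < u ∧ 0 < v ∧
    ∀ a b, orient a b w = u * orient a b x + v * orient a b y := by
  obtain ⟨-, u, v, hu, hv, huv, rfl⟩ := btw_iff_mem_openSegment.1 h
  refine ⟨u, v, hu, hv, fun a b => ?_⟩
  obtain rfl : u = 1 - v := by linarith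
  unfold orient
  simp
  ring

theorem Btw.orient_mul_pos {x w y a b : ℝ × ℝ} {s : ℝ} (h : Btw x w y)
    (hx : 0 ≤ orient a b x * s) (hy : 0 < orient a b y * s) : 0 < orient a b w * s := by
  obtain ⟨u, v, hu, hv, huv⟩ := h.exists_orient_eq
  have : orient a b w * s = u * (orient a b x * s) + v * (orient a b y * s) := by
    rw [huv]
    ring
  rw [this]
  positivity

theorem Btw.orient_eq_zero {x w y : ℝ × ℝ} (h : Btw x w y) : orient x y w = 0 := by
  obtain ⟨u, v, hu, hv, huv⟩ := h.exists_orient_eq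
  rw [huv]
  simp [orient_self_right, orient_self_outer]

theorem Btw.mem_tri {p q r x y z : ℝ × ℝ} (h : Btw x y z) (hx : x ∈ tri p q r)
    (hz : z ∈ tri p q r) : y ∈ tri p q r :=
  h.mem_convex (convex_tri p q r) hx hz

theorem left_not_btw {p q r x y z : ℝ × ℝ} (h : orient p q r ≠ 0) (hx : x ∈ tri p q r)
    (hz : z ∈ tri p q r) (hxp : x ≠ p) (hzp : z ≠ p) (hb : Btw x y z) : y ≠ p := by
  rintro rfl
  exact left_notMem_tri h hx hz hz hxp hzp hzp (hb.mem_tri (left_mem_tri _ _ _) (mid_mem_tri _ _ _))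

variable {P : Finset (ℝ × ℝ)} {c : ℝ × ℝ → Fin 4}

/-- Points of the three sides of a triangle, two of them of the same colour. -/
theorem Blk.exists_color_aux (h : Blk P c) {p q r x y z : ℝ × ℝ} (hp : p ∈ P) (hq : q ∈ P)
    (hr : r ∈ P) (hpq : p ≠ q) (hpr : p ≠ r) (hqr : q ≠ r) (hcq : c p = c q) (hcr : c p = c r)
    (hx : x ∈ P) (hy : y ∈ P) (hz : z ∈ P) (hbx : Btw p x q) (hby : Btw q y r) (hbz : Btw p z r)
    (hxy : c x = c y)
    (IH : ∀ p' ∈ P, ∀ q' ∈ P, ∀ r' ∈ P, p' ≠ q' → p' ≠ r' → q' ≠ r' → c p' = c q' → c p' = c r' →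
      p' ∈ tri p q r → q' ∈ tri p q r → r' ∈ tri p q r →
      (p ∉ tri p' q' r' ∨ r ∉ tri p' q' r') → ∀ d, ∃ x ∈ P, x ∈ tri p q r ∧ c x = d) :
    ∀ d, ∃ x ∈ P, x ∈ tri p q r ∧ c x = d := by
  have ho : orient p q r ≠ 0 := h.orient_ne_zero hp hq hr hpq hpr hqr hcq hcr
  have ho1 : orient q r p ≠ 0 := by rwa [orient_rot]
  have ho2 : orient r p q ≠ 0 := by rwa [orient_rot]
  have tp := left_mem_tri p q r
  have tq := mid_mem_tri p q r
  have tr := right_mem_tri p q r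
  have tx := hbx.mem_tri tp tq
  have ty := hby.mem_tri tq tr
  have tz := hbz.mem_tri tp tr
  have e1 : tri q r p = tri p q r := tri_rot ..
  have e2 : tri r p q = tri p q r := by rw [tri_rot, tri_rot]
  have cx := h.btw_ne hp hx hq hbx
  have cy := h.btw_ne hq hy hr hby
  have cz := h.btw_ne hp hz hr hbz
  rw [← hcq] at cy
  have ne : ∀ {u v}, c u ≠ c v → v ≠ u := fun h h' => h (by rw [h'])
  have notp : ∀ {a b w}, a ∈ tri p q r → b ∈ tri p q r → a ≠ p → b ≠ p → Btw a w b → w ≠ p :=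
    fun ha hb => left_not_btw ho ha hb
  have notq : ∀ {a b w}, a ∈ tri p q r → b ∈ tri p q r → a ≠ q → b ≠ q → Btw a w b → w ≠ q :=
    fun ha hb => left_not_btw ho1 (by rwa [e1]) (by rwa [e1])
  have notr : ∀ {a b w}, a ∈ tri p q r → b ∈ tri p q r → a ≠ r → b ≠ r → Btw a w b → w ≠ r :=
    fun ha hb => left_not_btw ho2 (by rwa [e2]) (by rwa [e2])
  have omitp : ∀ {a b w}, a ∈ tri p q r → b ∈ tri p q r → w ∈ tri p q r → a ≠ p → b ≠ p → w ≠ p →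
      p ∉ tri a b w := fun ha hb => left_notMem_tri ho ha hb
  have omitr : ∀ {a b w}, a ∈ tri p q r → b ∈ tri p q r → w ∈ tri p q r → a ≠ r → b ≠ r → w ≠ r →
      r ∉ tri a b w := fun ha hb hw => left_notMem_tri ho2 (by rwa [e2]) (by rwa [e2]) (by rwa [e2])
  have e3 := orient_swap p q r
  have e4 := orient_rot p q r
  have sq := mul_self_pos.2 ho
  have xr : 0 < orient p r x * orient p r q :=
    hbx.orient_mul_pos (by simp [orient_self_outer]) (by simpa [e3] using ho)
  have yr : 0 < orient p r y * orient p r q :=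
    hby.symm.orient_mul_pos (by simp [orient_self_right]) (by simpa [e3] using ho)
  have wr : ∀ {w}, Btw x w y → 0 < orient p r w * orient p r q :=
    fun h => h.orient_mul_pos xr.le yr
  have yq : 0 < orient p q y * orient p q r :=
    hby.orient_mul_pos (by simp [orient_self_right]) (by simpa using ho)
  have zq : 0 < orient p q z * orient p q r :=
    hbz.orient_mul_pos (by simp [orient_self_outer]) (by simpa using ho)
  have wq : ∀ {w}, Btw x w y → 0 < orient p q w * orient p q r :=
    fun h => h.orient_mul_pos (by simp [hbx.orient_eq_zero]) yq
  have xq : 0 < orient q r x * orient q r p :=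
    hbx.symm.orient_mul_pos (by simp [orient_self_outer]) (by simpa using ho1)
  have zp : 0 < orient q r z * orient q r p :=
    hbz.symm.orient_mul_pos (by simp [orient_self_right]) (by simpa using ho1)
  have wp : ∀ {w}, Btw x w y → 0 < orient q r w * orient q r p :=
    fun h => h.symm.orient_mul_pos (by simp [hby.orient_eq_zero]) xq
  have x0 := hbx.orient_eq_zero
  have y0 := hby.orient_eq_zero
  have z0 := hbz.orient_eq_zero
  have hxy' : x ≠ y := by
    rintro rfl
    simp [x0] at yq
  have four : ∀ {a b u v}, a ∈ P → b ∈ P → u ∈ P → v ∈ P → a ∈ tri p q r → b ∈ tri p q r →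
      u ∈ tri p q r → v ∈ tri p q r → c a ≠ c b → c a ≠ c u → c a ≠ c v → c b ≠ c u → c b ≠ c v →
      c u ≠ c v → ∀ d, ∃ x ∈ P, x ∈ tri p q r ∧ c x = d := by
    intro a b u v ha hb hu hv ta tb tu tv h1 h2 h3 h4 h5 h6 d
    have key : ∀ i j k l d : Fin 4, i ≠ j → i ≠ k → i ≠ l → j ≠ k → j ≠ l → k ≠ l →
      i = d ∨ j = d ∨ k = d ∨ l = d := by decide
    rcases key _ _ _ _ d h1 h2 h3 h4 h5 h6 with h | h | h | h
    exacts [⟨a, ha, ta, h⟩, ⟨b, hb, tb, h⟩, ⟨u, hu, tu, h⟩, ⟨v, hv, tv, h⟩]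
  obtain ⟨w, hw, hbw⟩ := (h x hx y hy hxy').1 hxy
  have tw := hbw.mem_tri tx ty
  have cw := h.btw_ne hx hw hy hbw
  have xp : x ≠ p := hbx.ne_left
  have xq' : x ≠ q := hbx.ne_right
  have yq' : y ≠ q := hby.ne_left
  have yr' : y ≠ r := hby.ne_right
  have yp : y ≠ p := ne (hxy ▸ cx)
  have xr' : x ≠ r := ne (hcr ▸ cx)
  have zq' : z ≠ q := ne (hcq ▸ cz)
  have zp' : z ≠ p := hbz.ne_left
  have zr' : z ≠ r := hbz.ne_right
  have wp' := notp tx ty xp yp hbw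
  have wq' := notq tx ty xq' yq' hbw
  have wr' := notr tx ty xr' yr' hbw
  by_cases h1 : c p = c w
  · exact IH w hw p hp q hq wp' wq' hpq h1.symm (h1.symm.trans hcq) tw tp tq
      (.inr (omitr tw tp tq wr' hpr hqr))
  by_cases h2 : c z = c x
  · refine IH x hx y hy z hz hxy' ?_ ?_ hxy h2.symm tx ty tz (.inl (omitp tx ty tz xp yp zp'))
    · rintro rfl
      simp [x0] at zq
    · rintro rfl
      simp [y0] at zp
  by_cases h3 : c z = c w
  · have hzw : z ≠ w := by
      rintro rfl
      simpa [z0] using wr hbw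
    obtain ⟨u, hu, hbu⟩ := (h z hz w hw hzw).1 h3
    have tu := hbu.mem_tri tz tw
    have cu := h.btw_ne hz hu hw hbu
    have up := notp tz tw zp' wp' hbu
    have uq := notq tz tw zq' wq' hbu
    have ur := notr tz tw zr' wr' hbu
    by_cases h4 : c p = c u
    · exact IH u hu p hp q hq up uq hpq h4.symm (h4.symm.trans hcq) tu tp tq
        (.inr (omitr tu tp tq ur hpr hqr))
    by_cases h5 : c x = c u
    · refine IH x hx y hy u hu hxy' ?_ ?_ hxy h5 tx ty tu (.inl (omitp tx ty tu xp yp up))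
      · rintro rfl
        simpa [x0] using hbu.orient_mul_pos zq.le (wq hbw)
      · rintro rfl
        simpa [y0] using hbu.orient_mul_pos zp.le (wp hbw)
    exact four hp hx hw hu tp tx tw tu cx h1 h4 cw h5 (h3 ▸ cu)
  · exact four hp hx hw hz tp tx tw tz cx h1 cz cw (Ne.symm h2) (Ne.symm h3)

/-- A monochromatic triangle contains points of all four colours. -/
theorem Blk.exists_color (h : Blk P c) {p q r : ℝ × ℝ} (hp : p ∈ P) (hq : q ∈ P)
    (hr : r ∈ P) (hpq : p ≠ q) (hpr : p ≠ r) (hqr : q ≠ r) (hcq : c p = c q) (hcr : c p = c r)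
    (d : Fin 4) : ∃ x ∈ P, x ∈ tri p q r ∧ c x = d := by
  classical
  induction hn : (P.filter fun w => w ∈ tri p q r).card using Nat.strong_induction_on
    generalizing p q r d with
  | _ n ih =>
  obtain ⟨x, hx, hbx⟩ := (h p hp q hq hpq).1 hcq
  obtain ⟨y, hy, hby⟩ := (h q hq r hr hqr).1 (hcq.symm.trans hcr)
  obtain ⟨z, hz, hbz⟩ := (h p hp r hr hpr).1 hcr
  have tp := left_mem_tri p q r
  have tq := mid_mem_tri p q r
  have tr := right_mem_tri p q r
  have IH : ∀ p' ∈ P, ∀ q' ∈ P, ∀ r' ∈ P, p' ≠ q' → p' ≠ r' → q' ≠ r' → c p' = c q' →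
      c p' = c r' → p' ∈ tri p q r → q' ∈ tri p q r → r' ∈ tri p q r →
      (∃ v ∈ P, v ∈ tri p q r ∧ v ∉ tri p' q' r') → ∀ d, ∃ x ∈ P, x ∈ tri p q r ∧ c x = d := by
    intro p' hp' q' hq' r' hr' h1 h2 h3 h4 h5 t1 t2 t3 ⟨v, hv, hv1, hv2⟩ d
    have hsub := tri_subset (convex_tri p q r) t1 t2 t3
    obtain ⟨x, hx, hx1, hx2⟩ := ih _ (by
      rw [← hn]
      refine Finset.card_lt_card ?_
      rw [Finset.ssubset_iff_of_subset]
      · exact ⟨v, by simp [hv, hv1], by simp [hv2]⟩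
      · intro u hu
        rw [Finset.mem_filter] at hu ⊢
        exact ⟨hu.1, hsub hu.2⟩) hp' hq' hr' h1 h2 h3 h4 h5 d rfl
    exact ⟨x, hx, hsub hx1, hx2⟩
  have e1 : tri q r p = tri p q r := tri_rot _ _ _
  have e2 : tri r p q = tri p q r := by rw [tri_rot, tri_rot]
  by_cases h1 : c x = c y
  · refine h.exists_color_aux hp hq hr hpq hpr hqr hcq hcr hx hy hz hbx hby hbz h1 ?_ d
    intro p' hp' q' hq' r' hr' k1 k2 k3 k4 k5 k6 k7 k8 k9
    refine IH p' hp' q' hq' r' hr' k1 k2 k3 k4 k5 k6 k7 k8 ?_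
    rcases k9 with k9 | k9
    exacts [⟨p, hp, tp, k9⟩, ⟨r, hr, tr, k9⟩]
  by_cases h2 : c y = c z
  · have := h.exists_color_aux hq hr hp hqr hpq.symm hpr.symm (hcq.symm.trans hcr) hcq.symm hy hz hx
      hby hbz.symm hbx.symm h2 ?_ d
    · rwa [e1] at this
    rw [e1]
    intro p' hp' q' hq' r' hr' k1 k2 k3 k4 k5 k6 k7 k8 k9
    refine IH p' hp' q' hq' r' hr' k1 k2 k3 k4 k5 k6 k7 k8 ?_
    rcases k9 with k9 | k9
    exacts [⟨q, hq, tq, k9⟩, ⟨p, hp, tp, k9⟩]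
  by_cases h3 : c z = c x
  · have := h.exists_color_aux hr hp hq hpr.symm hqr.symm hpq hcr.symm (hcr.symm.trans hcq) hz hx hy
      hbz.symm hbx hby.symm h3 ?_ d
    · rwa [e2] at this
    rw [e2]
    intro p' hp' q' hq' r' hr' k1 k2 k3 k4 k5 k6 k7 k8 k9
    refine IH p' hp' q' hq' r' hr' k1 k2 k3 k4 k5 k6 k7 k8 ?_
    rcases k9 with k9 | k9
    exacts [⟨r, hr, tr, k9⟩, ⟨q, hq, tq, k9⟩]
  have key : ∀ i j k l d : Fin 4, i ≠ j → i ≠ k → i ≠ l → j ≠ k → j ≠ l → k ≠ l →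
      i = d ∨ j = d ∨ k = d ∨ l = d := by decide
  have cy := h.btw_ne hq hy hr hby
  rw [← hcq] at cy
  rcases key _ _ _ _ d (h.btw_ne hp hx hq hbx) cy (h.btw_ne hp hz hr hbz) h1 (Ne.symm h3) h2
    with h | h | h | h
  exacts [⟨p, hp, tp, h⟩, ⟨x, hx, hbx.mem_tri tp tq, h⟩, ⟨y, hy, hby.mem_tri tq tr, h⟩,
    ⟨z, hz, hbz.mem_tri tp tr, h⟩]

end FourBlocked

namespace FourBlocked
variable {P : Finset (ℝ × ℝ)} {c : ℝ × ℝ → Fin 4}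

/-- The number of points of colour `d`. -/
def cnt (P : Finset (ℝ × ℝ)) (c : ℝ × ℝ → Fin 4) (d : Fin 4) : ℕ := (P.filter (c · = d)).card

theorem Blk.config (h : Blk P c) {L : List (ℝ × ℝ)} (hL : L.Nodup) (hLP : ∀ x, x ∈ L ↔ x ∈ P)
    (maxc : ℕ → ℕ) (hmax : ∀ d : Fin 4, cnt P c d ≤ maxc d) :
    Config L.length (L.getD · 0) (fun i => (c (L.getD i 0)).val) maxc := by
  have mem : ∀ {i}, i < L.length → L.getD i 0 ∈ P := by
    intro i hi
    rw [← hLP, List.getD_eq_getElem _ _ hi]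
    exact List.getElem_mem hi
  have inj : ∀ i < L.length, ∀ j < L.length, L.getD i 0 = L.getD j 0 → i = j := by
    intro i hi j hj hij
    rw [List.getD_eq_getElem _ _ hi, List.getD_eq_getElem _ _ hj] at hij
    exact (hL.getElem_inj_iff).1 hij
  have sur : ∀ {x}, x ∈ P → ∃ i < L.length, L.getD i 0 = x := by
    intro x hx
    obtain ⟨i, hi, rfl⟩ := List.getElem_of_mem ((hLP x).2 hx)
    exact ⟨i, hi, List.getD_eq_getElem _ _ hi⟩
  refine ⟨fun i _ => (c _).2, ?_, inj, ?_, ?_, ?_, ?_, ?_, ?_⟩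
  · intro d hd T hT
    refine le_trans ?_ (hmax ⟨d, hd⟩)
    refine Finset.card_le_card_of_injOn (L.getD · 0) ?_ ?_
    · intro i hi
      have := hT i hi
      simp only [Finset.coe_filter, Set.mem_ofPred_eq]
      exact ⟨mem this.1, Fin.ext this.2⟩
    · intro i hi j hj
      exact inj i (hT i hi).1 j (hT j hj).1
  · intro p hp q hq r hr hb
    exact congrArg _ (h.btw_eq (mem hp) (mem hq) (mem hr) hb)
  · intro p hp q hq r hr hb he
    exact h.btw_ne (mem hp) (mem hq) (mem hr) hb (Fin.ext he)
  · intro p hp q hq q' hq' r hr hb hb'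
    exact inj q hq q' hq' (h.btw_unique (mem hp) (mem hq) (mem hq') (mem hr) hb hb')
  · intro p hp r hr hpr he
    obtain ⟨x, hx, hb⟩ := (h _ (mem hp) _ (mem hr) fun e => hpr (inj p hp r hr e)).1 (Fin.ext he)
    obtain ⟨i, hi, rfl⟩ := sur hx
    exact ⟨i, hi, hb⟩
  · intro p hp q hq r hr x hx hb h1 h2 h3
    exact h.off_line (mem hp) (mem hq) (mem hr) (mem hx) hb (fun e => h1 (inj _ hx _ hp e))
      (fun e => h2 (inj _ hx _ hq e)) fun e => h3 (inj _ hx _ hr e)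
  · intro p hp q hq r hr h1 h2 h3 h4 h5 d hd
    obtain ⟨x, hx, ht, hc⟩ := h.exists_color (mem hp) (mem hq) (mem hr)
      (fun e => h1 (inj _ hp _ hq e)) (fun e => h2 (inj _ hp _ hr e))
      (fun e => h3 (inj _ hq _ hr e)) (Fin.ext h4) (Fin.ext (h4.trans h5)) ⟨d, hd⟩
    obtain ⟨i, hi, rfl⟩ := sur hx
    exact ⟨i, hi, congrArg Fin.val hc, inTri_of_mem_tri ht⟩

/-- There is a refutation of the clauses `hyps`, for `n` points and bounds `m` on the sizes of the
colour classes. -/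
def Refuted (n : ℕ) (m : List ℕ) (hyps : List (List Lit)) : Prop :=
  ∃ tbl us as ls, verify ⟨n, fun d => m.getD d 0, hyps, tbl⟩ us as ls = true

theorem Blk.not_refuted (h : Blk P c) {L : List (ℝ × ℝ)} (hL : L.Nodup) (hLP : ∀ x, x ∈ L ↔ x ∈ P)
    {m : List ℕ} {hyps : List (List Lit)} (hmax : ∀ d : Fin 4, cnt P c d ≤ m.getD d 0)
    (hS : ∀ tbl, ∀ cl ∈ hyps, ClauseHolds (L.getD · 0) (fun i => (c (L.getD i 0)).val) tbl cl) :
    ¬ Refuted L.length m hyps := by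
  rintro ⟨tbl, us, as, ls, hv⟩
  have := verify_sound (S := ⟨L.length, fun d => m.getD d 0, hyps, tbl⟩) (h.config hL hLP _ hmax)
    (hS tbl) us as ls
  exact Bool.noConfusion (hv.symm.trans this)

/-- Extends a list of points of `P` by the other points, sorted by colour. -/
theorem exists_extension (c : ℝ × ℝ → Fin 4) {pre : List (ℝ × ℝ)} (hnd : pre.Nodup)
    (hpre : ∀ x ∈ pre, x ∈ P) :
    ∃ rest : List (ℝ × ℝ), (pre ++ rest).Nodup ∧ (∀ x, x ∈ pre ++ rest ↔ x ∈ P) ∧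
      (pre ++ rest).length = P.card ∧ rest.Pairwise (fun x y => c x ≤ c y) := by
  classical
  let l := (P \ pre.toFinset).toList
  have : Std.Total fun x y => c x ≤ c y := ⟨fun x y => le_total _ _⟩
  have : IsTrans _ fun x y => c x ≤ c y := ⟨fun x y z => le_trans⟩
  have hmem : ∀ x, x ∈ pre ++ l.insertionSort (fun x y => c x ≤ c y) ↔ x ∈ P := by
    intro x
    simp only [List.mem_append, List.mem_insertionSort, l, Finset.mem_toList, Finset.mem_sdiff,
      List.mem_toFinset]
    have := hpre x
    tauto
  have hnd' : (pre ++ l.insertionSort (fun x y => c x ≤ c y)).Nodup := by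
    rw [List.nodup_append]
    refine ⟨hnd, (List.perm_insertionSort _ _).nodup_iff.2 (Finset.nodup_toList _), ?_⟩
    intro x hx y hy
    simp only [List.mem_insertionSort, l, Finset.mem_toList, Finset.mem_sdiff,
      List.mem_toFinset] at hy
    rintro rfl
    exact hy.2 hx
  refine ⟨_, hnd', hmem, ?_, List.pairwise_insertionSort _ _⟩
  rw [← List.toFinset_card_of_nodup hnd']
  congr 1
  ext x
  rw [List.mem_toFinset, hmem]

end FourBlocked

namespace FourBlocked
open Lit (yes no)

/-- Exactly the first `m` of `n` points have colour `0`. -/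
def colHyps (m n : ℕ) : List (List Lit) :=
  (List.range m).map (fun i => [yes (.C i 0)]) ++
    (List.range' m (n - m)).map fun i => [no (.C i 0)]

def btwHyps (l : List (ℕ × ℕ × ℕ)) : List (List Lit) := l.map fun t => [yes (.B t.1 t.2.1 t.2.2)]

def posHyps (l : List (ℕ × ℕ × ℕ)) : List (List Lit) := l.map fun t => [yes (.P t.1 t.2.1 t.2.2)]

def eqHyps (l : List (ℕ × ℕ)) : List (List Lit) := l.map fun t => [yes (.C t.1 t.2)]

/-- The colours of the given pairs of points with colours other than `0` are ordered. -/
def leHyps (l : List (ℕ × ℕ)) : List (List Lit) :=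
  l.flatMap fun t => [[no (.C t.1 2), no (.C t.2 1)], [no (.C t.1 3), no (.C t.2 1)],
    [no (.C t.1 3), no (.C t.2 2)]]

/-- The points from `4` on lie in the triangle `1`, `2`, `3`. -/
def insideHyps (n : ℕ) : List (List Lit) :=
  (List.range' 4 (n - 4)).flatMap fun x => [[no (.P 2 1 x)], [no (.P 3 2 x)], [no (.P 1 3 x)]]

/-- A point in a triangle. -/
def nonconvexHyps (n : ℕ) : List (List Lit) :=
  colHyps 4 n ++ btwHyps [(0, 4, 1), (0, 5, 2), (0, 6, 3), (2, 7, 3), (1, 8, 3), (1, 9, 2)] ++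
    posHyps [(1, 2, 3), (0, 1, 2), (0, 2, 3), (0, 3, 1)]

/-- Four points in convex position, with `s` blocking a diagonal. -/
def convexHyps (n s : ℕ) : List (List Lit) :=
  colHyps 4 n ++ btwHyps [(0, 4, 1), (1, 5, 2), (2, 6, 3), (0, 7, 3), (0, 8, 2), (1, s, 3)] ++
    posHyps [(0, 1, 2), (0, 1, 3), (0, 2, 3), (1, 2, 3)]

def fiveHyps (n : ℕ) : List (List Lit) :=
  colHyps 5 n ++ btwHyps [(0, 5, 1), (0, 6, 2), (0, 7, 3), (0, 8, 4)] ++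
    posHyps [(0, 1, 2), (0, 1, 3), (0, 1, 4), (0, 2, 3), (0, 2, 4), (0, 3, 4)]

def threeHyps (l : List (ℕ × ℕ)) : List (List Lit) :=
  eqHyps l ++ btwHyps [(0, 3, 1), (1, 4, 2), (0, 5, 2)] ++ posHyps [(0, 1, 2)]

/-- One of the segments `pq`, `pr`, `qr` is blocked by one of the points of `l`. -/
def blockerClause (p q r : ℕ) (l : List ℕ) : List Lit :=
  l.map (fun x => yes (.B p x q)) ++ l.map (fun x => yes (.B p x r)) ++
    l.map (fun x => yes (.B q x r))

def rainbowHyps : List (List Lit) :=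
  [blockerClause 3 6 7 [0, 1, 2], blockerClause 3 6 7 [4, 8, 9], blockerClause 3 6 7 [5],
    blockerClause 4 8 9 [0, 1, 2], blockerClause 4 8 9 [3, 6, 7], blockerClause 4 8 9 [5]]

end FourBlocked

namespace FourBlocked
set_option maxRecDepth 100000
set_option maxHeartbeats 1000000
theorem refuted_five_ten : Refuted 10 [9, 9, 9, 9] (fiveHyps 10) :=
  ⟨[],
    [12891104493389159340525816467552728365256203092741682530001949847435363544821014788361324980485512578875778515024381751511177887380175188150654071391041665121448285308887786331973886243140358351603354568451227648,
    5475982337712961130084580300521405916062251678342658118],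
    [2111788],
    [0],
    by decide +kernel⟩

theorem refuted_five_eleven : Refuted 11 [9, 9, 9, 9] (fiveHyps 11) :=
  ⟨[],
    [21274875662840409290373141081848640951592619001201474031351520955958431990361592210067848398593227241272046271015070792618489116985027746305983386611174073499862269133726627138476969907769950928896,
    5197993274186071301496360979413152127466902604057602315931023033114655246691574616316830438364559537588899740573709097339940214297038913349256840276434231965406994757173195641697476892783759639398372676470712787618953943926796],
    [15613768579767575873698216453926441495240209411811479485338664666939412745610979173418387241294005438962858754174940520603168568300548272556819957127098782487026281707481622],
    [184485462038863503874, 424311161490963271170, 13526198844094978,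
    1370313988232719003602512661321785688070119978497, 201804289, 151038209, 137875525121,
    1374796621313, 369326593, 21074177, 268467457, 11541504],
    by decide +kernel⟩

theorem refuted_three_112 : Refuted 10 [9, 9, 9, 9] (threeHyps [(0, 0), (1, 0), (2, 0), (3, 1),
    (4, 1), (5, 2), (6, 1), (7, 2), (8, 2), (9, 3)]) :=
  ⟨[(0, 1, 2, 3), (3, 4, 6, 0), (3, 4, 6, 3), (5, 7, 8, 1), (5, 7, 8, 3)],
    [763317957446414921118096332908780897466971330814768556530391958004759661639543957378820206951554122692575307960846118211013044535176982014721723261822834213009053577763684352,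
    16457095198503904719575688953451599706846344822359743790642482755395285828005216822626152683255805696716394744776045650509798259209950124492515305508130140000575575397203034305870960986848197887918965517929137570604693816762248556811016,
    489630871908462151238757975671979292713309663894159402514273930614522528295948617959791431286696663537146783963785761406404807938862650039435320103773247752806826768925042880265968078354998067730598881778204050758266619086831137336959451802637669360300990730,
    439311266604055019990779080345830436278860062578160577448661870187796490312953943071267817985273858402404869939642276318253957854804500670289183888193479492232299859586347923828681424758913565626646820936341196044170066639783521814448542369034088397017695920206,
    226057830909649238360089971729436],
    [13879095863169009494261203918280118871514560486926571486568562836902485719789533853586160769458306876935970279531297819122677708954447534962817786382575673156903510539990201192714902397198236800202165649546103572616413168018835642127460728014385122702819423435678567895789315047404906857457724,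
    187785510078878808898102940434559689745387790358364078689223009189818966012844954710669295529878100749593833668302376222036219237182370361793663140157957579396116120453276658229445911322913215939780112451275541864083519130552495395461435699515833203713261717114937696139596,
    78631771427050606957000980341106778657619565946514097108184881078490138644372296940335948730130267212612150494132253985227949177036515262320746957314035644613465836664279394473754099560786474325962813431284813622092576291903373615743570730005070251597226809136482456357179471,
    1697262059328904525397039730414969126305324770814109818651613544143959919188101221856979273960937489701027392880715456593213573621699969738947492530670902721428245765022307545916431459548568911138605019636672579587769978163143985506884146371249061723726330177131486838814,
    578245627527337827476801377950246517854031210840825385028950417075289875470376840454663992841743981670855818465029277946745503723848437357672911362057737311130898904982251324],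
    [11235874288105314977973117536594196764163001784836,
    132590754940919101074447541346539165649022293300325418057708487765976904196,
    136297710761033642550127168422499198557444, 44567504315172142432152721922,
    175459396848714863548823851903582863876, 14975631964806927392764573647108,
    49617905791904065161615875, 310936421467019778, 178391553125491281408658300419,
    373026123617521383625836961982393063937592925254804158901560178421341298416485610779138,
    20671308123489819988483, 5368150788485013068928514,
    5810819384891378846824061584712241148450236831155718137545006741042623905777844454708015980137689857,
    815331854898311682, 693584308556077570, 12440330495175579066200723134724,
    5574662802079562619811303938, 607597671102755643288515065407891973,
    11135550591307591677605530272421765635, 24273839135090838367664267205252990857879327234,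
    170053745432326234774491593785056793343650051,
    172631226947524645329938606387151951272195661652497660170904405857761844802149637174548556154873347943068949829630767833734023779260748824126123646800560792542735136084709989386661401012702552594488207889177571993434670711672069636026189665567613306996684570516303668867886421064864026293837404771747486448849155,
    497227484166556559646368083706023004342813386713899525071906205478819458666997872966930603007168137421592265853215014275403442066460965724674,
    131116496636320768682195405094218399247237381723004858282757097644498068432947179605666088716908653351028059194593997987944499089318437216246411524,
    164726404986472112838773707031808857497968355096257431251824018301807118533502002098218941768665724940318127598775814034448807365021955,
    2786287068339933413890,
    35794354190299923471971523544703218392240242670598282814304847385837280356576986611745818751732100982589370268997381553598783568276589469446930536447454468376056268026133120770,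
    86853478047390327003739959629520652105957265694497988720771037481847220717428591384154180388394780557744531500899363311414350198936198851632347104537378840130117408552303546727102343012977952002,
    2685591481675397976440736212421369987652418698034571843531407209685456775026487834239211477244080989104696663207476091938704519047246779454435945483470762487090012686321051027924393693953,
    337966815324411394,
    9106873077870849733377419342411678500685107115454336758741025035083373246439318607386910658624653979548109495684692796434831570440924400227375934509492914913856830693065259171157853645387067517552669716994,
    535741636375946075061743236600876018492184706273975964925848295826922655822081, 2030397697,
    880687501056],
    by decide +kernel⟩

theorem refuted_three_113 : Refuted 10 [9, 9, 9, 9] (threeHyps [(0, 0), (1, 0), (2, 0), (3, 1),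
    (4, 1), (5, 3), (6, 1), (7, 2), (8, 2), (9, 2)]) :=
  ⟨[(3, 4, 6, 0), (3, 4, 6, 3), (7, 8, 9, 1), (7, 8, 9, 3)],
    [763317957446400861797963458541003060940950412150166050687227411385949713885970669041379687165524238194256502812199337091695545637105809203091771925022587510532716305575903232,
    3806032765157705704409326618843974898405933667266880877862274061098915193952828860046935130763311509571259341519936737238450568237353116573591787063708602261255629040607844969897264125822752301945119174867229699367481480287625256114337540,
    36740147926782650658996125283461020203357279083788662320497130030342377857957531271987147113762057387645735735065115167578123630940799622684741895452542935347076804903971943142493391068122196782914454955094402737632077049148419800261826882546386824483732,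
    298685157414181710010670030267715641465392788239905609099487234698123966841672212160396884953096951794784379095199078955154470883253749181155789929264122774532484385504649865630830960818345549019787637498199131665385143715137407575252128329249048577291590506692700280979518,
    4640504450124046431],
    [95408422098907604852230439265256194958470311692078278984010548297830419859169430023110580016476571460637417476116864924673810858066256892885436613839915600193133758470977122573405860160578600133847775309615721268163439860756161303653645882204204131062267271017081054716966703053877510556,
    22974240202482867450617953645705679627994387552707146139859618619552122319803727178365565809163223865627823140322590843256665542646584652843951311912809989670428236545043561414103869367108929436962114364560873883353512284204417497363743495529042838277808968560837924651441886086,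
    2583265833860937611336465385067125265707612744947370048811038795755593648640521919812148729360494657961529100923495052740425026011662647420242490960043010463511218985942178926369603968481884201791560757678238075933805634622922998494877561969720061801733007121430150180403878574412,
    48647257015160886338788407780468991114988922730427494028477895113487169349960213775530324377626236110235462622680020532987744147181892635517627512971333697925292181266522181560978222244269403105446982615998358276109162358131971740208169473581252267423649634723183889530549500613756,
    6128962348330109293849551634592100004535792576083066412804307896069583924499878740917365220502790189955701429626499402484474346117418100361027723172918943628255860253097446096878876759461431430328875812419614763191833958092346686981826729057738951214291458335410488017733340677108230460,
    58366975800046349252056144682651739131928497546252507034639976119658616235438316974905773486594616685487428051076377871169689543686845894575706305410290462204518021335146536474760376236881654934538018562189442966366009532970777744195315418873585939158350482452929207433708350259797364991674732,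
    2360888979980576386637860998878161934679205703954812885295278750159838027244703159618573233096392385326796498051776916755356751722101220543544774118335687613461622972944421603331346617106826388400333579932033658893336963006430178227946479427664903589770967578742972043703523548411839528087686911263612,
    5981422246592573008021998965816503679309585965123723609377982371461497336823786951253435740322304930601273149118203844172919507369856505437277193066255131051474789073096519800017374381125756125685882787105931940215422943931286502406805966731976866022825354956042189266748708869248475182,
    13105935604069074653216232499186396194756646898110281470374988211374456031366200461666175523264991966079378274463046909262838038948347865615022173462342406316030608621689512033516097835387166914207699035104603734664603897566119078864372189952211301813408076506958628006128415289955701635180,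
    14529815052314819910169252670361509265319895377805972891022154462161019620650853436323817409211648884794395962018986562030324138322439813574812270025312713047776582347588119664117910573605629993682544436443838905625592509452223456456863846678690826079542551582063362266389007648572,
    6018439288873677795620507229692331283389519589058020448659111642861916258012747924372117869421648905892217620973436604201389339976137887807023713132502356534761535655694056063869746808652637654654906974014406110205519051307035096947536020607187326577491380566082058861298936853766112095,
    14606439198485780524125257192450796629047213178773469188586767740],
    [32776479263630977010179, 1341547554211756085121831522828262353268621226176547333,
    82962216841876081084931, 435243421766980797506902531, 120724934870963520416259,
    9168941670002529715743988025514499, 3692285392940355918907599185342723,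
    48020323336618693855430217784645359979715443775827612231263951264667067122232030442593693680905,
    945225060592725009442406090062309890,
    36022758512611998806548547530822324689574587853820841837871354820629850915661188545850625744217684864546823017995631346540907905887304195339573765991446894883044130326674453536769891292782360392192766754433183463692354823467570283944365970264856259067249157,
    572919505333807289613884061690367597978464771, 133126840313636389784067,
    15038660464436677493158959173202650323326482703405068689885894473603908621431953995378210932540968608096370697055712640138718168897936961854054928348756509097984024153077225334946981482223762792710,
    18301981169126229200387,
    142799539706705600000799135448997697581230205563996295816762304602892868663600935427611677442104856617390626389065877918979483736837662852127489048508676962532725015853206725477626753270774657338240159401400900466387337767129196581801730708259968765324381218500110751437815416190841250055,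
    3498853638274057561492237221485793435073253114588313687054836883124639420217121592579,
    670736963110711846816130213137484697703828486991024047656621662926216658332348640387376358634584323,
    8878681529998604610928436961540, 10058779785557657168934888640403309772797260292,
    69051989570028101832359329420890339213523908603300812867685541801986900842330765956667092377560696248658560712040133999515635799940280837,
    32493626771661401119644162,
    83836065777134710192458847855348153136965670570702106129176911318588266692302728357322821510039352684688518673662278530332763380370344700827317096744614724939588106292698460189335361609126088911526199454129859079,
    59127561365658726260206752098862561585737280749502387913659467770782568576641640547597428899486603601842969643875734731291158815170254879358006030838160627810471088057168434176714918255158017300745254368106334080729361420529126016502287498205196909346413814274,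
    2098831729436400773129683138229988335994833796514743250968067379164270440535754270663906728245988180206265449577527509510,
    664270689177258756262253384474808914221658776652349015935824875471149847010361508630627007748,
    216985200261651497585510707348000087875063897389693105482538306147713266395904521618979769690630,
    8300053273809605552465319670211233051112938347482168227491265069633752046017068635886083,
    78813717086583923393027,
    24812797327473845859236229795516588976334520936380921864635742972583172443777064472787845920491364907053562979279096880351866896137796165000588789932824790896123706440674944733557606173364322823,
    97698677516639758522587445289291862209027,
    8966681761031244920469496013943041326388176897732586086066605034201928365252237780283176778033051117502790174318452136897235167692887620693974204290007454342545887917968980716269574664,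
    95937284075366050552323,
    27189213182186996950522675302572028235355459102362869796894107353722169386432433849157151889343468972815439622490348729772390848074560326353380204796632395394411308806507876423674078974145032450021384218123938059523,
    76566408107833271964685245966485349077948447253062648041314854313252915047061911499685494248008771090665899587042852487952950718977983754697819104025723885932131751300766606436122102608947700069934949690050471769695637165356427916250787308576957699538791845359235865161546685401103029809335380888303174130179,
    7351657559649333194212027605521430213519863286189123679815706677868952410629,
    2481266359903446273634909871660274410795106144757907458915944805785534965963055006940363025408089168963136716726187429439308261808147111152721577748752145838178409165579313609775490043072886377483279793626640224906779757521417,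
    5275986756992592459113635462138160443909,
    8372438578552186316398471467120878803194178276349423703887260482737645716094208754800789409859733353565050508017535940537629333663996012661218289479881128687291961534812388154642977348676432889876071445953094475457069023925093146157283908288168348411362724328179242028391669980707632606590346302494979,
    57819394507732471618062260116057294927135789170931044340380019610485754070537811123460658238063771107847,
    451658337715878277541438966258984517425327107910548525494448642,
    7711678480154318035885761639954866813454220420774669795954378245091762914308985013297294272556362571147029302872322,
    664282662943730702274720811848797420521412134362631888820522342803877697166643714539082771201,
    263566201323105366429169923, 454291083261506760578722077848118519984355995201442075699304557827,
    57469653440701312317183379735637833874402960731046710615035226732861718475991896014579705298846413643912912959720310003842867254227559476907386069646248383441398143975945017158259482233181443943017922004884192639086186895187567742182788332119409439236,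
    9075037897608649362100035584164275247123509598910085950725, 509642914038773577514691905404418,
    675943928701277050578899154550242654988985184145390388484,
    66118347368509917362376558831405483823916778982205423189587250878609923132393164981801771527007502726400074738044902656394503,
    499421960559939337344270065975616438852507469801469028645182745297096021544135994645625395537603009560606836068992284927437469482784389158518943936027753333383521264873467605716074277908624583434052730214745196657601522761490881576625858889065290924548,
    5036000426097763918765158092374299442891475108182549750898930466484265425579605443166162638914510174436117477637,
    31474284158399557776739213617156926143831948764118551141616869104216889087783460569563398063050289604279740583310846057988,
    666592141853985282,
    1080347620284530638672226113046303048468982279622732035884830552584343786249388872624357393504139581301416470958371678315970985383215101635946020987214758111441577338246735279844663066415697527004752048777716906013258179838533389250067571827356788310232147549470712325,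
    5588638551927584431268294546628138518970410166745860831787164462001498181994017146514257202575055575440190846096651369567842989852639785435883500826884,
    464247887595346174029878531, 182686379222437937103223050407811123692039427,
    333279509200736450298745764832493761179250342494495168364254477854369193988106293870830487901140205970806424263071197181296427393919425509403971463871840522559035481960096951607828378070004529165166055956651112023244286467,
    89186807085337674341334286530858099584624852281510022977769457682859368802455160979661582742074456325,
    2188447800934619669332560384672650545513600391544060139704201904253188082354844001671980131843889404808305144204139209733082470020918132027418697129960532589693132469260223681233966713165306706538599136545288327682,
    32241011035833321810988997976256291713442306,
    2374418903775622372884003960240866175468140503582746178608216126023337242242103724168066987384942265356178396430226770093274239339041053011308359654096747920804728562601443676464619145757388073875468699018627339979856439145192906820075303348739,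
    426771193240042609077680387, 5018043357445735075267105539169962985154538756,
    8058244408132345537586826749976180574834096121909462089756481269708826890524917678610082430750415246168359731277600139940040577053513924033283078879736595451416660981187282181765909434079748045189865081707863969499650,
    73753137988765128662850013265885100120307815122563329, 407345665,
    22637508602738526409112168872482683625358150547020252767916064006984826829346685724004934654561169562114,
    1666821444799422978,
    398679412774853719621780592813230476843243326597933988261358403443592119189404684756636861863750987487186489188372066318180276223067404501801507941949470760858014209432069435577198850,
    51730895819669905068295439585961576027861905748120036977269250,
    28416707363729916345549454651708384196195822149256142680489484326661448987615372789947404618725232467305040265004907395819937793915373987317576517809487473123158167324615788236676245656072879875153327976312385044534919682,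
    1706298949442167494787432673370605142462233365021340162, 344939335558528034954665750419970,
    1158922922039707792941831539325020887312410298806208182065263576963013859377240880325086524223070980197860693103682211774546270443501562810936003719440776963277224193,
    1229534465, 6380147969,
    9632277264603222919589799389467601657462883113401302628112429209976898375911634520957370408387240239705608995262509525449542858665458590999584961058378300072465075956024465292092183497113022772384930457802265374110210,
    919700869914350362079939091832334212199782876265662769836872792074699752336392198296379114937707188366639032677526290693477073007326769649149192399538976312515794599246861798873610136039067070225222594129898380810219428370947,
    654718828611144789034745444501502505054719382862264688885612014524342155043472983579138,
    466034262160731136415708087324898671185782716542508889586591360918920550578943087810336352528899986788866,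
    41441457296428135081430334413057, 6765806081, 1896218881,
    321321282422114974105999783083745376897346137594475298714524531506294968548423997920722087866431300345616720590469313888410875157482428930,
    418612420188364462593, 18700489320705, 131328],
    by decide +kernel⟩

theorem refuted_three_rainbow : Refuted 10 [9, 9, 9, 9] (threeHyps [(0, 0), (1, 0), (2, 0), (3,
    1), (4, 2), (5, 3), (6, 1), (7, 1), (8, 2), (9, 2)] ++ rainbowHyps) :=
  ⟨[(3, 6, 7, 3), (4, 8, 9, 0), (4, 8, 9, 1), (4, 8, 9, 3)],
    [763317957446400861797963458541003060940223384887197497049033382287023296477108981031920455209116396600468630512955176624677801873844239350451373626282364201868233313561411584,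
    820715523959453464087201874692670923672075944240041918495870042319619722551255246968565936362470198720599073618639755460173214152906033184661564743025810208463375046728272506912126311238099118066326727010577096918806811558985257592070,
    17333067516624426602320412982606464490217690963216765805983399457496071782096562611822203344797299598679062781180128718802483183392044338724980610383446493286963768675761263543878801674454218986282141384537226080119540573457960797807091976018332322792573375244,
    583737806307032742026133833017154230109934844704319647034053445125621412737834364135700043340062791559886575527046419414246078944286472335514409124308236],
    [4522542083861789170729886993374849895310014447027967178889653031310868137439207742509559881232273164922828787411904560087366141770890812437277813335116538205423343955493073743156861849568700836532613287327667111699339566077793963757990837487099232864856204284523492263694305485439623021867758579781263917477967,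
    168693514219008035598600244020654247835852503325074322199073064816572094537177049593888373384205245480250135836213735034905991455227288262529126270069567296027451228558326699903794855906127700692774377831797494251320300366230143921077724078902643239813955293215224300159623381087,
    2444085031485620441329766161693745395830043376679991763799586170417132462049867564919766740702280939561790259982391226908579897853032556496150871725586797705605190635139507885432792866713273414235190391518590545627124330973554569403957334776905770361007271641299796646832734284,
    2083549631313972006295637725446767353691396523070723285504539487170667617112861905353338243234996527506274222896068391344991655162827426625367270577226922561218547039691784763563223698127037172701713388973378519363491063461477850947799435647976261777560744063496384081795069674865215,
    279318492782054146642848573296839032848870485431416308935413688638092798995056384899392745392448383937366900093352268820235977469045962930245357951216024420706173358377549930033845208546198054779196626786676488587445063604642949190103356320107426394192502934189037224527,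
    4892712578803060496355193717218749969725155369039051906990977912909300595277054354290214429345074877222491231057602218845211126494761018658758345275603838651718353042805922219423108094527057680833293661177003696029706655319514505401471196742580057475051724317068333919610729668638,
    184606106339401648041645669727834502813526307992847193207227047985672885097631883083918107159061137441107802614389580934811160654190112844128207648191035073856847520819456232525762151898231807230930139602734846442017663145029074202984692385486481923664998653332496483914,
    33210040750743961564693767232227018903962543074199050671670893814712889749295196570784359323198926707837120007403047074606336956261783163930014352559632013891891389659934437996],
    [21549185888691971107331, 13658156882669058,
    1860048344092327228690132588038509056306776078765052348945652003044662821988868,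
    819891550623786498, 7935698242354351001985538, 5720699418261807102568895846231555,
    193203273307814304028278860291, 18780402344047325969994908265988,
    42876330689721628211478961565704059824643, 78827046510848541289987,
    802608558886067835632542210027083580491606511891600645, 45753978995327124688387,
    11185774934083126342000130, 82052722501364516009475, 491203813253157378, 572511161707240188418,
    58199588272896832114225864998156325310982, 54618001015770035128835,
    1191458557922399275994937248806906977013054835983226373, 13008199267360937741827,
    820590833643262307938110129919993018972637494507836933,
    21910048721110933830142320766157659170638193077235681110945285086724,
    499572474323857616703078181259700070806473866068108811153838238564960061240839,
    65540869993861370127875, 200339193468721389932269136145931015970720139671813,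
    218350366943104888900177073994694149,
    7779510607018591644401379591696934444738553475055082810889078791177330505710184136202,
    5793807346048740184778744382430977464378241863106024003547070902430825228371599663251680439667957149542790924144694794,
    18428202708334163874558248356849848078424345456738872230847509871875417333436257923390054509140235,
    52849581513041622028803, 8115510167608727817796505874628979710309890214950967839887330449521155,
    51286927102131920844369879670275127601146631685631236,
    154911626506435948810673938255069150575617019773098717856692501525033577566763841894351515229702,
    16704843514281388689031577651741651284444933203665116956411044848690358875724583399555292567046,
    12812447826411744340420368200754713863260187994838976832672026828452528221026408623799507196240008616107850139233746551805831640364420125202980397318,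
    189172730347919690905808724874384447825168263781986380313700618755319904986600157674711570716174369255792745990247137541,
    196250893003360826372117775746269955194573710685073845422811640371140875192840531796945039557833651184373032893929756970607994007718404357,
    15947063722619855635290626, 508397480089080058514367958102531, 94417334717839285268689408514,
    15012598013789270228842239330676144344205073180191118450373978489515304006551304015805127590528323578412802454711509082628,
    20113948698055867661861283587998825863069939213695256399501718639045530738465319554122349617679838009484511753,
    7407364674226628921787050830105714200333274036643493083338161795785446161367164758366724046406604261484434332415931441092978463289143050,
    2318767888008320348189303408781580388132036120038445816355917732168662312237209085866857438237080995951300461150306587871164264089893759215037739488512921546084462598784755971,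
    208655927487308742281665046461958400479752264885750605667790612923140927069333541063691895282219677357690007389068848459224644424201,
    291372985180991033830673923,
    6352239501312746122939830825894348604196489100709937708050590070872542071205668220744033722417264449011235232264,
    2664185294538051480596606624329225516499733567358378121898727408149478120731319824646,
    963192727913485660784302915419301148163690256722543599445114830131015208498741510928814597,
    26739214944139046201014857232030200716886994383714114819211854266343791240235395544190246865586867105687002319432360898009085014936716315398793987,
    3118373742860246019586,
    5513626043073830109783058168362837217607137972393857316430180376052408661509,
    112316133956197542328080550908762078057285278679207054151413889541,
    193595055934172492063925363101033497902333989177558740683780361450898781778148094691755010029859057154,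
    60510168586743271872003, 5000081017964679585282,
    297538071390404909339935830757623667585532699744619957856197194387051922260783399344198351108,
    55785352145676404227587, 419579394134580746215378378581805150652165379,
    95145416436251981969761677402848012701700357035032814031103938279064725610148505371623346664718571019,
    2540270660254366439123162382062207523702178640651190199716723173918111872932807204171982816641561904429620886091015,
    10910379408809730590726107872793110200870210610115442496938854960045117432074474968836422473453212965535751924097930721158665,
    7577559125218162535319664873186199116259869902585463248438788798076229127440275941963724495524218351860531677192826629632342845748768268861036202137099,
    1013132016967508206430103505754903483868181845006904691919382619121242431274377425414513779132248831459441645321150109217916534576973617572826085770044095154641230068660258165003,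
    758630905970224724528536389966910381752066070761113764982201671922867528404831436651535005414773449775787728388,
    11673681631161648522038384737568842764123586663705360058100331770945533258740517670605677055948115065641961951096627871908203346708755959489795,
    17391652319705421241762382559247190125875263680717381403765908116948214661002776532323890558972175506208707976805273000770924089988303213117163165232615684,
    3257533125892872163557932817518035061115120039074724256663810090493659415496589384389616659074397579638271528407801354731857722864671249928950654270815970707759282685644715478873505288,
    2030927492039149140993609640397216384777735,
    135482542762080889706644286477411063931254404643609817496521523722004171226597742283879431869930063913531452569069480319759145185811806459428396364826950840264742991363,
    2355686205948249852577160125768907405233573594160107981442450193117699040090806810608820738,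
    2917357742221172187883326497654597794737043923286666518415879378999006609100819183872111552779760617885605000476931957880667001793793,
    1783049729, 4786211073, 1208460545, 2756126977, 3393804545, 5071420673, 944136705,
    2443597692513685999824822720732885559608565172746855078752520438183771232458569559441879173632559548940634579561220,
    3156118533150575693153054315664006140454794816271006853871445506780663019408840019089114952418124109405560322,
    274936700094340680590382652258551929235384315309603554719217874144418406360979699963787271642444153307258824394309664288553321256570660505308335468291,
    134546237942489548371674136112651355629914779906,
    15871234531466696722139550450448092086832970855644548757048898429545518457125378,
    2597814545143295074307273710171454735932313608305299138100509398514071727698514796238835390652359175217362349009409,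
    138666241, 2403423489, 4819752193, 5268402433, 608567553, 507775233, 3813016833, 3092082177,
    151361793, 1846097153, 2974610945,
    168538765280286636156353028081581827668103376927783402797698828948994,
    223289954096008926792800372327846299757434095823661422880324080456772274447256983772333302950145866503088207830301146580212566422762474009858,
    76073661877094378367171590563108820608256886214635253178976845060934957313, 21171974656257,
    22683803072001, 1615697409, 4031224065, 2168482561, 2537960705, 5242875421991763802459567361,
    2789236481, 4333575681, 3154472193, 4798312193, 4412898561, 4652300545, 2454158849, 927337729,
    63638089805227521, 3930159361, 1661005057, 3594717441, 4199327233, 16772871601665, 3188058369,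
    1816541441, 7168],
    by decide +kernel⟩

theorem refuted_nonconvex_ten : Refuted 10 [4, 3, 2, 1] (nonconvexHyps 10) :=
  ⟨[(0, 1, 2, 3), (0, 1, 3, 3), (0, 2, 3, 3)],
    [79165744940153382102414776215103366153416367130838249960998975415109691663409336508081275389880699237447765673649287766397841437423207597978107518762804090191753191627473593806422016,
    4923275665732687582762394468882846910263146281390503864651102868796672881456107925428637456061742102291970648397797126531981547021691060320753747504219737291379312474190922051659428944279365630548679703928356895893066069471485572513563724124188602126845987991238470608140,
    825833253037606799765737627168000246326583578984470640744108715867703416053880102325113180783197121456518353448961411571713046314498760765148320566263863581042423210183206556412205493147344830386890978331603223801114083016515061712764317926527927860877243722957411013674],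
    [38549060551431789106739964236457988124343949010621075385757880346209821148506668993507414931630964703387897053198],
    [3714802554633098635581086722, 435604011699284092227296609682016635470594,
    1347014200213224130464368847873, 54543105, 188771073, 1031115138817, 893688777729, 151023361,
    71334913, 512],
    by decide +kernel⟩

theorem refuted_nonconvex_eleven_111 : Refuted 11 [4, 3, 3, 3] (nonconvexHyps 11 ++ eqHyps [(4,
    1), (5, 1), (6, 1)]) :=
  ⟨[],
    [143757279620163628564691660822151586014688077262506794357661799357970453145095742881378342433031804079465934283333770238788626680386330297968615005042083014292903558145752738019112728461312,
    4765323912283037245549621928561593118866031107939493056907736952469856176387225926697027752007469374999923087890432567258906567380920414405342734719729497855706799861219405993365858628209365483571495717247027565098500932049072275845525203169657747546127357145913366294794,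
    16370244617455473899578178775444605375896825508263751630520678302239261642081924443989109331453381491466170907637548],
    [2124380],
    [0],
    by decide +kernel⟩

theorem refuted_nonconvex_eleven_112 : Refuted 11 [4, 3, 3, 3] (nonconvexHyps 11 ++ eqHyps [(4,
    1), (5, 1), (6, 2)]) :=
  ⟨[(0, 1, 3, 3), (0, 2, 3, 3), (7, 8, 10, 1)],
    [23397887829270657792732905238521411042565780086159530080248020959974100962216452569348572619061941195089930090098554883387761625664195914175180649588940862583275520,
    546955197671580177154522582382169622702444111831906084507990136751742344181046412695018016223679470549388520350201736581773819725902429348765763129408652674256996659119288492557848876913932983105928663018670946210801338475294846088782401008862094198276,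
    1590817601930193453922661272284377298065810733449833034684667861697893491652379741202314721452890763730224377728072788051017204839121978489825830403116988976968430311049952806789101570360006933185791992051478888854098327908798386117652804804639773145930902054070312573228,
    3246703160341417184293319093671674071000588623890335230106664309003865280403828317872304705358306706610560415062648947156344002074084457857221152840625273613337778462396083275486427834680991976839337165732650649595922738604339396317549057721886536447080386730096877614,
    56001043428155765133144395270409830094688333751278171184553646688275456210805368127760894775999368582511438103746435040115167541816071767486564092463495563676108914269212885198031829920455634919843663892163920833931751366994238863487572033360781943887643830718532407068220,
    284096476826339174996000755219812586160340085720256524745178407647751026733194982597136760123451064542856842674426998748212587608153465165509129946395096109713635155993789783078928175855522035332439493615831295278785443417690343070647003064720849892697621591539136018335566573183549560400413812814776718434334,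
    11066254699113],
    [1359472672953909148750768207087877403917735800282371047435951604724635809218050185024073309595236035589106331756437903],
    [18906764258059863288065, 55572993, 4222674696249601, 967937, 121662209, 16805633, 88789249,
    38308097, 156134913, 223176193, 168352001, 202260993, 2816],
    by decide +kernel⟩

theorem refuted_nonconvex_eleven_123 : Refuted 11 [4, 3, 3, 3] (nonconvexHyps 11 ++ eqHyps [(4,
    1), (5, 2), (6, 3)]) :=
  ⟨[(0, 1, 2, 3), (0, 1, 3, 2), (0, 2, 3, 1), (5, 8, 10, 3)],
    [133253644667111402644639233459442361759968233621745472430200224839742949783762288269579191279604985141669135657746764748431296004708810173897604497843070875058896896,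
    72607817129991130072748272713459781659815525398230149994414326607357615940940363071263647262668506190223115269315402010175885073578109331949383589792237428775874011983354064160002924818100386486870134287200394421981182052140326,
    28826149578933408173393853640537516757876985163265837372788079997195333140899659717621911180814324034117293095556343234942165913700339142111205649328974969336447335619444322215657151989816527503373951735939501199428639578682279530807435618032978483930976617954137465411060015006626314,
    7145925907054941428045324102486701421229799973333023713280575960137994847609103084228119680896258494015349610303329990991712126260463139775142699703808147407042701016783005054936515140931467385996593046013814803254332060728077701199579889697624689509765295555801385790882191872330068300,
    33078416322894337154041515503354567693386721035385191860336164929330440508815504054672348316217828860121468052680399945711439047980874633878838027974580296853006412635850386134309282315453894897450482871934363611700189340714614141692536623742990,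
    153197595856270140024061709000391258245799819400571870083158461109224547336546166947052840700762613273661239315433812839944025246600761934726084869158600860909905041258799494283223006137670775585093811677242318066858992245287872214053207151688588673843282318477594383387641449090360948236,
    60742320158857312795443801433397971634050869637889593185265148214804958750683654419498393251678430891217689551350114818721914956006721462444312729543649290993132451142678936789183001286753548052026692451751371503352088719691728025569194972191026668462874161984854343524891136604624062012,
    91764120157241519522251592712390327124923116439436497044826470889324916930893459555081114251833998754514014231322495072703130081163995388822534486460275266268498780446847320816372535573226111659826078613550523469832030983194968466394065157721729160498033386666811789536287555357422082190202964509229943164,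
    11025509285454611924266690519245322427661397245589525807289495087212879076104099959693003308374149766308558476196727357237015998456041905938235622962264328345182713067515489799833363572556304282584349806012305455],
    [455663815102057652671227182051654202844101204241075764451206662139365024204319600160721345167578255134012735689815491267616830738494870902595810035875022930278639251235234602197378121862090520922572226522591580390793770190326307335928958622278601444205185561515188424730853174759147828994353210,
    782560731331445929400137018220616339400370149037811353640917117789932113970445063369566780036260583074287949831113995317839328547568407953209189923263955753484479662680933723388624914629633436703710805168471683868294724996092249354401254724385703341399693468285408518857638554201,
    19520691184599393217480722222714526703944698221153387597213207046143661322655863294293656648216973385441049380458156322421923773619289873661190034243059953250725667085122131042215153149213644729909886732479672887330653596807564459935556823438381305901915522196467423910947719849100,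
    1217666125583278688351501322136993589490018125215524543951523741186572151197547235122350969340697765583315855574965309178579148912673510340136662758662490043054364503628631251192389806756559515115110463384856274749071649678907827395046725127737280028341618899918909573879289208256540,
    92701734290969715486857817406831815900264489489623942867257497834035996276011974522193402944123442634513284042282605264689849335893041153749450441150894404916032840052199324980791005830191414737379177523854760542346711082638211286906775718780801535356935312889342705450541147558,
    210839389098787887353144922895404742158269204852710398001602454023740997924765585682387231616550431291181876096501623697941727215612961909621256215200107235292235424917786799067035637921911925034583089712095632627084130534569074360113235606826176274358802160719594549778224768212776384616108,
    16835903914993303024633810765512811916083980656398402674026834455304177918602082427787525743163294791613236387311502932126838085631492935896658033555421367592194684453748060260868948110320258481588886472471079265963572042999834743401759481746118690161473828537004094,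
    3933806020889978760812314995217944422610351420854960681124874992001171599929879964673274290602190613655764088305110448000542125194904035542449485400640466974397999466381834216110304526048840020419000143557046859960284903676174056077267660865811358329612495344131797732771370013531672748,
    962876007337017824039936967816978426258905217079345575602118989320648470462560001353673952185715119574547345321212479678318811853290819273389846591781998605527261904578243497642011426438926532855748842570567402177081777574853235155324503531864420954304880176993840228577251268789334,
    126124572068340795012929078315212426842611988457791274252144711591445451846157445245344079487023662261108658218955817532441157739483190773717837063371497137743809687089321042059376705223717650758160318653930947762871745308673401827763596918219567154443750994686160939573813628,
    180963557989162728558208280569804145503491809536690961151952501075910698077020976765855914040812664384744149789461604605132455887026954841659522017229228518755684511405494054961000781223950150872582764845239512398065933324468198195669433243842250730406280917962483055154504438892,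
    12831972724221550689689954877778077602347888434386373100112848744710786116205133636851456539755922174449460161131143900567750400423208152857452453831872618719014212015477844369573131448981187312951865384265684517381198262371115191218632766240909355526378943300250979118086080402540,
    3537714493332688990886618867865647692],
    [1392056543411460610,
    1725500636690216201907649167301398485878046685824258375928529952795344381133120947936110480147365866223757917788881976459874543039649041443830068274374773243495800076998793711106,
    10362605667597978245746114453008119672370696192078020886627490458869555009476286709388919694915490191859981,
    70346782135725642678606669714033536129907159979033779016597354952276986805928598253965515296540286807790969806176514,
    1198189208905908309727991236177715209417223473095566806522514188228588014634370851496765984644830770830095419823616527260930,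
    124684977330146426690803638407701748811716330339108922581911591811201738958044201297615032335563899940798972353189532676190796052885094137884069900545785203271082200715294283619011509274484472148147755777835266,
    12373011413195799759099652800115086395720738099225230194447884911741641698011663126139714408679378335504987298672777116772557996824122326072425366418717070731840582799401515801238354059046831197265944509442529998662507561456690109665455715841,
    11144154831596799914184981718359029819797761149105062440343879373838549149218259275597883294627894998883983690147640409420122549178963284764547177730,
    74206247497310967485701186323401806975151387113628450691404410168009369003381508994716701702648596329565024321248280736789575321474450224296063045602231586686377858035448573967231514462187918797948429456736777685827021900714242,
    321343360248007134110596861118668383570699533460643915150930553949034076893225074136998558815974407142659376136832354286489173497323250563453658694867233369892750787569033371071513610748064007526433977333397279479110666472414722,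
    6593064869546576868701797748555183176466563601135151697294281579560655573189002314708616762884859997015293166419314583231103622164175925263938601810584379164923575061250814932635619828970073407550010931760891737841154,
    1672737519021991881312822778058553841942215312784985545953574162397227946456858836967020138157453669077462503130194940474736749513529694457971806633835731975174841037176550737585862763596236155053743743500202707813977332737,
    2152871425, 8074890753,
    275795548527694691584386625163847346053247811756576231269277754606276452868,
    3019569876678221727718733184513, 1054113077832440322,
    662721690423519992145414130006643843825549613410796349679904422143359497732,
    583101333268205626413076259289863233297727292012671491876057673001962922665741229381184485485137832796391923484101391708060260975933689320150274131380875499287103514846957348747051803115680903725224794467118085,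
    9316411987843561751111971226141262197592730042370785819840126548648899674454970899841633263945799971524078708835571886041633167800036675914118848235177354455396220476573705629864258635721255361972210573769422686227734587085131661830,
    190581946743118765223264018188809366824212812937054103722544054407682,
    6210645078256791725649661468229309653272414798201875385620468605552101998649908958985944379947740713594496255687613094377536434308300244064378583210540849460227,
    11953442719534663354823388766973468257277195517693814066387833395036763108981935080713349405752605655379089901513704973679038289494747004083775708346088697099998925494081528609414627842,
    125301246798765018955236405596974593,
    6181117903322206289180707751446782593997400646044010705922, 5939883608728276839938,
    48796995250935387635917064153240769372736290613281953172173046567975431578346360249454847576459331520722235506559035980005302295837681684308135171,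
    43289665528561573226472089930653213487315888215872029231382786,
    28601801192895363646631634942415921393864909821444,
    6205998929577699736657634019542104347017067204436989135121800049557144957833830662616123943962914715062901929053382817605409940395936658343333539100298139054747294584785707574733585611771951477820049738027791363,
    26087747379242577711241117717786826823022432863778848672066287447647577838359707534579204271773987988320176204577786822742513162481117436574349112835603761149187,
    112083205384306581330961798201843215203448723970, 2897071416852959872514,
    639669685937920415892111370392206102391960628930372266537161123679267479517280089426240236214839043418994332367270829246774423530152982749942109805503536562462480284840952147348679966699594829735281437116446785184769,
    5289050881, 6945797889, 1862300673, 1681947649, 6967660033, 4030767873,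
    1733712739516716617153978257175505134414056368137707375883989271378813936215877821442624952183392209860701502278647951398728627660631330777511482683856721744579092741,
    640293306159915108272969659613161291013,
    8071734579621625418550684180375901496156018442964726348058054289450557803142984857724587725977327285357062115731073586795179016792527010867195808225209348,
    46836604941547721703002846278997703316827843888984429304047829348749671555430924941366410687170950568179554820636543597386000147816622010076596501852510993146128464799835573887933652495161727753476,
    7812466745861126939380874188079278648545728074357642100307139194197413870885845352281159480341610060642434536895336359081219,
    4262297165382969733634,
    64584208161428109551390565806682577992305587485659214272885312494107722619447358992487670672052227910988665949842110220713025903421103822612939506985428102154,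
    9823820307659831903415215524435200019280487327869288408883460337513281980228776794442528531878764560504122742322787623995980193193243442742852087096581,
    13221565015418257572869542499836051889169057744729854470,
    931407237097657240042603704618813621912891679569353010999109088046919394560277417400866876152368356645485648647929286575939496674059156739,
    292710901504457367844605400969814103707450630,
    2837140113974750158991253120520992546153190591704457717621707437767282184,
    153001779230013474698690948058162650114912598362093096332557634691046164500370347992980691708011320351662602887831006215910448268152501095866990278100738223334826397187,
    359044839907724322540933698206654922766025273777385267482218619377562197046011851059981516302379004059779829547293814429534138786648896094031361,
    24329813232963225632215444178323370602613419253995717229921622353723633171569731732168167570888899758665675964042754,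
    86226142325452222719098260451151070749792637303833314065421156176442844212578138416502574496151437049197574401346641423079444315699933858182294174110298417511305389576807018488036036176877118417122977330535552026625,
    1632642561, 14233744477441, 21999045379329, 28870993067265, 7806646785, 48513064778722856449,
    1397262849, 5322681601, 5637863681, 5793187073,
    3247856293266187041197599739690680766076904679518335574250625970163735282359627864862078330590926808529151490,
    18895362157610997752607154690, 29270786679118998087460130454786, 3730593964508948677815935490,
    217128702729358406438762156762231305338095935694837577009499330955626575859538682394364802089805105666,
    376302477651279911650569104227365434569088472137844837186869772073039470154977372753802581278289765665398114548996,
    607739413976884226049, 535099447043856313345, 37481538359771041988103597554945, 6883098881,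
    289645825, 24122672000513, 2130863361,
    29534034342723741841273345094853057075394901857362621544051970, 20865777524061697, 7466477057,
    1212521729, 5977371905, 8057561345, 3678865665, 1263284737, 27081854203393, 4473146728961,
    149284088126969758938525356072335073647832763350552833, 334411432428264713473, 7991308801,
    20480875728385, 6363603457, 33131126873601, 2567156993, 7247999233, 3717344548097, 6766594561,
    4702940673, 108955972169489921, 457305600],
    by decide +kernel⟩

theorem refuted_nonconvex_twelve_111 : Refuted 12 [4, 3, 3, 3] (nonconvexHyps 12 ++ eqHyps [(4,
    1), (5, 1), (6, 1)] ++ insideHyps 12 ++ leHyps [(10, 11)]) :=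
  ⟨[(0, 2, 3, 2), (0, 2, 3, 3)],
    [1104481554098626215810644637585089234671685709362324362561660827524951330124763345700055457045648448082183256724025081047163073316595893652861253103338455040,
    280179335086700731810845804499641239196689247282287042184505926871609870545740835596051196842672953524791350446428124912836682701606285679985152394373322158409797293627009593567839145276052679627297902839568605502333120850731001713013625796907805251483142,
    51606426642014154156520382013399677191047056809638009255120461966973426552696145383293391538375501862923264081131431480710689852566907778918995055742508437911934265320710340211962777553129846676071196479459616361302028542698292575193837523177766949740862917879029569836,
    659302695724007471],
    [235724752015317634897060871904383586613475899378169401600391658495560746493637757596292552063751335513517444635238093177124043537766592685456179078676317801630118510967982850358767832649839119],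
    [2283886299714129408428714248223911659905900096257, 85148485063785675438217603644747988226,
    846417815940865, 469769985, 352352257, 104889345, 322981633,
    731040864477946073664290566851819267236808383233, 436231937, 188881153, 272678145, 7424],
    by decide +kernel⟩

theorem refuted_nonconvex_twelve_112 : Refuted 12 [4, 3, 3, 3] (nonconvexHyps 12 ++ eqHyps [(4,
    1), (5, 1), (6, 2)] ++ insideHyps 12 ++ leHyps [(10, 11)]) :=
  ⟨[(0, 1, 2, 2), (0, 1, 3, 3), (0, 2, 3, 3), (4, 5, 9, 0), (8, 10, 11, 0), (8, 10, 11, 1)],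
    [487889346738486428646220511585274251988117021396656857070298649639726832487340234310638028099074492107383204940821050240784112664980825430884352,
    770979665843742234855687650617048566598432499776425889705370547316337716603807814168278839285187611580857710294840725541335870651482542377411618328441719351106886765559470036138490329796837521359504,
    32248931261788755983874179147767159599214262654914422231311774390454809261222623094195001482246952996749917729642751707004042707858919536856206536151299847646475843923851937805804929006252437086813116070941019473179962563782931204183320,
    11072070548033172060727818740699009746329726492650646853903011316297221992453786642023186138638042617997947825669172542193716919915933933501182574394250478480508235381096537365209541167702706851748158410106531036899965425748503712548,
    16238989899072837242389175425660588762041003970016447767373803534067151876513051349041813173081709885219669465825770601724850812842686070838002964776291142265852147962327202951086303954151319050737397694249701569387247555925614712321500509959324187,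
    1640512000904609646990374601188273957142846675218064637963048500551093100026866852719791263660702611209168318022859954754001055344626144070718654222774463104280945843687877747756054265205640775036755397631207522153858911115493303202639641537382571319731336505421904290039500133694932658460,
    1844409813499253081936370922955244590842170205753565484509857655901135321035344017138055892912543965012311280856175401657168443224184030397293935741381923071029988537273102275205338066551857807707279545018375025837873442710031421478911148189828819504282674884483365225385307902664772767820,
    1849401860462879800287584429346076089168442956876927225746262020205988411050449794883801242349163098792165535731710784793752497038911447651313657850294654146594516657191428329324233517383591425946271305652425590259161996711834357989760501792921329808566644928570180273004,
    1316065438007447070665158917902524579986938518805419829835262077281241833075719786057693098031586037949109634390003840149655562945085343082498257463109657762338295266781622991211621849073908853342413497444873797820456320320099479849040006418015382314967102,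
    101319367232199922297876522060349938955939239740143692449464141091622716841482232672015352085268084547480803147839679945359869224444690050757147451131439776167307587521830231893687324989332097929632556483868980944783184900613908197930519740878961291393545510397802966928720625798909474844,
    8881342033813950787817309981279640140103701893370086671015698826375177045938654490025297830837649896521215102689316317629058394088089091324962222767110755914022813163027680584315030752978864125212168639826669428222969286214077387082494740162584720244957507612318314562491949656834184362911359792236,
    18380103719771828030615103345329392322899057875788560243445997593416114678482194450572791887],
    [33625890602801474122176455497440701459882760781518939906764826412183786950711007096418271587089857371135324957552526016404261874162485459544684591406430370840931597729954840384258182513722531396910768983314190408294531887558108296447164311882527282912641275242555539638,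
    135363274138904089340397489121232110861216626422231946023171270803326396428217719632793796048063023065452104224464788132949680000178299606690942930129051381722512148839713625537080568773200039985560784254834427896189293051483483507083896552308610281211475594921665072416696829642547,
    26791180481039714232463167687441483427921224448712875353465119069983444546180761261435571920906020865050403063674770006496913451194912657801981332911100681329024421910751893033731206901256511973299004604599389116502970067101341581097748965257682732956009569911811417314380099855,
    21275457779052952386619562818369784389513094306610479924029914198511346719367070393140951115676951325455841928045542657418264139737173756869705771990850670115650335479146970500476435721065125598277762895932684802680133137885396952963221385847869037811058028661265065776593929703342383,
    2170596084370510765355209595733004641467256077858359363762672325852903165478104813797429635927420353632947547000278626064189665642773859538702897044134787482293877977731628044148376671897948285600767385350770804779283455404421033062012173936843638104118749410700,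
    6458423744638077147908089500847471543024807301491147300117384794660351204136049103082956666912924425540491298910056803160393322488285264403342750325793428203754460337544949795662348279476241271755133373068374487357929460952566345230542875422400822636442143543010421664473461087,
    198048887827029123344109160712955635058783780939671036799742473589666808799244038838817542227790381421583102971820808819113024597642708028493183966625112136694487419036148600308895351470930152103396115353452943226280071613414882694873690337667610877446881389000231078194882166,
    11202954594032201133325219660342332860234793033402937468369075170502858156951678506667368113990169678210670428545240054939724188443024207875489129647647878719055354046094390775831908446805548072971028866868972528816751710928125876900258871451291200831910810533368091938697084285421879341,
    304508],
    [2416766760397964356610, 1103486638167471292630634769497018622382503287875489691141,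
    110259936944946346806644877815461158429453755394, 5822229616396728271640765441,
    5011310152948677149752514623920643,
    19284360766336003723674272901660469172587409898005219431586309,
    70737685032839269640330700145211758943509411036903940,
    1538036129059295792965840715185224609107509456610372619093091204928825960076218761065786368131947012,
    87103219980821784753224928704207592570454343908777510610947,
    502669950226139347059623173223171056188380620291, 6444814130563939331952313374389813885442,
    12710804082188254867520681755705800195,
    15366419242656517476783435241675857220067874543166818508384258,
    5821883197868175888874841680451251206, 4963417451734900605442,
    207280254521677142225423985298596944451294764960282050204471587596500597504424209217743970534665498352247966368995873723614508838406,
    33946909167334381235715,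
    9877872573180009960779305857950564877324314854849792704806367912618494953852833128052661279225055239,
    580715832688268202445484736237426427637130632649303290210773128385369295174956099235076655921837938611911029369733092380172807089541203299589,
    36851546887180077669801755443981064925459821979305107664617759179254545851032934122886867824647685,
    326436880054693538474217907725580882015928445578584996097540,
    942008587315812048632113125340972296731803229699,
    170618379234896434546174598312566687262708319753538422070956124948879218596720783938095138094718389509,
    106338322329675582055553505080399862853186440163782251582759484489641775464657101193119543531880012811846892761455728314352682478431610697089630877714199907260322018395924475753046339882746124269337874673587770006961211157043332424440811532636649661013911059340928516,
    1708249965076683457899288502583285243218267371232003,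
    21652896182698474688970447048025886095826758407765537109377056312320036791990133111604838662,
    7470759044212527029218162304203984310967885178224212347544324078987301092115723550153003009454127775202572670896618031449531464532465379345574682469142914045801084154080701018572912863225191327148871207912455,
    5129203925231894334978,
    28143055829820282195190674838190291675418079628734970472058591756153934923105932627390045443,
    2190837579008717671485340235299639457571089048861789207238739846145536766899942747878702465030021197991061378274741037607939,
    47715435119324267576562201742206132546031356438811664599620320890870117229925475791088944818464473338353730858286082,
    19167043083577435943287203607777849127254018,
    195716142271000381927532717783634109341627029147296859678698877878830219080706056087630044346130682120096545918922583105907713,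
    826320897, 1413527553, 574630657, 3896520449, 4177536769, 3875575809,
    144212798980906726611992435375333470082497838506701447851805538774062931941106841090,
    12541018410163238458670831930607985620779043977521446990581058342699295904264264093980066429520217874080638699846811725025824629149699073,
    10588190423553, 2754168781825, 1330908673, 591429377, 3595696641, 15467273113089,
    414435512764016625924688863946161066350588599668300302844038436209245647222563413328625922,
    426501763473360652521979361379921100452606211, 960766695606014418434,
    25507278033963574119415370586267475229750069967251409284071015549182397443752022198013831824018690,
    117277756622850888461259664349703688142540300793155335766280073474, 21613183376642493353994498,
    72012424332316903460378813847216696207962304812319186607366400514,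
    154120341194668054610447975503372234711494592967642941547694977032689177659956298283824955255528381698815073839361476260629586312755357186,
    383490821462576410072087006273144353243806787462337266967558447386252509441,
    758207207984059729748370936606434818,
    3439271676877358504548878839637113575800645356014133260958630694220918422188178982191348679162150895091800146566694421286188087182680578550140162,
    1794113394196026169112869519342052566764773204250817384554715183000724759106775491632557743339009,
    3121292801, 137299012104839302913, 6465608838401, 11757008568577, 17598164105473, 4099001601,
    4864],
    by decide +kernel⟩

theorem refuted_nonconvex_twelve_123 : Refuted 12 [4, 3, 3, 3] (nonconvexHyps 12 ++ eqHyps [(4,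
    1), (5, 2), (6, 3)] ++ insideHyps 12 ++ leHyps [(10, 11)]) :=
  ⟨[(0, 1, 2, 3), (0, 1, 3, 2), (0, 2, 3, 1), (4, 9, 10, 0), (6, 7, 9, 0), (6, 8, 9, 0), (6, 8, 11,
    0), (6, 10, 11, 2)],
    [487889346738486428646220511585274251988117021396656857070298649639726832487340234310638028099074492107383204940821050240784112664980825430884352,
    12391746515429982647276900819079874178896415385226244080874218357828540419317721828119499049793677394511202244064503833280240531073448661492683122289563633267858330527919368983352729335198439596229264,
    26684705661237811821636143343491002638068473030482047937236544097220969402932046226958267112261130536867240171950982965170111123403648097669713795558849977109635727817787083708034395839150877884749419166622271252777704565281111207483416,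
    61444032049806366148137435189048345825626441400188611093833146157850574427939367924046693276417246695264715569888953405324530430348730316260836377354774071964971414837405092967721901993563917509937550271755986048659197625492328740,
    309102839922191272264523819273262637370611898709490234663127875242295867245780587808171025531682651827530721368816829691274153572198299887493029715584482538558529119908651592384330457607034170143389057628257166972046400568443599762591213650457280193999387,
    1889150538804979838051539592186747179407186319057980243766980235636392785862221333504887896063183108355100943495503628732176655936537998889407791204452421499452309847920527860034386416369942963510863606141780628273703611801004038098750925210009969066040717769843451515591069509853888850204,
    93001407588771284678972928251429798364707957240541941676706457419049380659993777576530057781040911533345367344195497481955663984552071257777698347558099393181428597182086239206215721999723164314261892365813893414139955006346253248838734730324438973907664673145361390871153044562224721996,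
    7145817145907619396237429651785985098336501668672966474544505708442716177947012788467025001446928952632877178518693579841518534507648433662583052262465292277621687267557881325881187475040726358403971436922901602841749470531765810611417126023160269345262187497150275011758395187240534380,
    136816440117320290436853940264825898252717716203621137353647225500986254620461680845334912909170610120645707664985351138851116034172232564565789821800745429502261825288842206701297889005485226745913006995760821189430967165079857062331039758,
    353684748709481349092950911750129090662670207516755867559898397307930312064799457674918131846958911416799932278941982311708078597871644948689707839391994263040585196235337565574653224323100882302420877417743937706381683128855747876033487567897563847821895975084320846684841227,
    93596173120035296603093673635984617948957497777533830771920757565760441835559586330307251022869576908819140063842419705393071135279583091985695918209151249865701476375727009342180063060363672455631491259453449624580152705582835686329336504029592611821465158689913492724438033092271413548,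
    362564812402363357685836231078759906212733743781849978651971396125658097610898690740990060738475988772225987750436044248220025389197359019957789743348490681341690663407599694279908001872086461856590654030540741200355098105804165920867208544782853345364837255406216729187702623289055917484771180,
    5179293876910554423511541947703224714977676101614196273060420318326159646799],
    [3178264098784091129634292211777006525642488176334797762834771874274956219168429653170218665544771073823028586457768141972483183655991517557933592816403162047085710237336405836902124285636106232650319667157771216231579631973419887628371924687617253155962042204691012444,
    188755429826293465486733894651483297721149140210753057857077280237860940092923371361486782920760233119255723768736551761646163628757627736167052165096218584301254139550218978653800576536215632901445654186867746427072753999170573294844806301378776327749084721944054935999676,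
    1833435521276033729700532765508545280216146980003387947827595666734113501066200970422994367645466606695721409229003117582197619299071450871246309457967518039264970491943829341790365402068305287382501623032741684132540030686126154439569838843765889709929,
    1504157625382200502930421971312197735768334146074697608472251901062695588260163057156245570902049248668212160737853488810157454064644964274309723154085042402241691364685197984162783435488918743117512052279180799445142185949099175845362747399754286520403148243642103016700921558428,
    3919975363564224416231961406756437125297215348062345415054883820908964776205265836707508237006841184785578082562665473037792809306290152548931693171252696553978212046290638193268086223835391806738958137698588850725285759799905680423434963473852793064138333750655265620942539764063,
    5288903509216498483183527100172221353721493523763732450532794554574683766615372249224628674423103383759755372819738965404459265882032909409313799155238581242551849414935539106934953080762845112882533752077753681412950124354542122627273804053625314722438205342921597293247,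
    4941890188567508679397727396943099754060015203189967825893509543073043807799530842655944324228011264957885564305813817816222870152648807192159183277332402148628052834467271849463424781859192965068509798134357886167469749685792212469428093648757064432413751759509858739160092,
    598601232341462987578901344031189728209439358247181275752850867802932100286251645509910706644480753000896047496831563127040236987575738802324068082984096933724794774554330946747952241525590913756454620071985909174477236645716554803161331977728298661298778884687170623554288354307505238188,
    51696346478251789261217706286908117036261510455814164367728071874433715522545024567517623143215577859609267870744278723934741347840138870921885462892324387732717168643689092672315707156884924290565086133811510986730795599446424008604548298550608653500229349774373958225964305621634598588,
    128126613124940199164184111207068813283602065652974559128852049933684885304291985906084325148836573967848276815039723670341748351792361233595285391938971555743364306903045070000949240077104219796483542189211823981026757090652325625085095283443027202326490966648137814017945647,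
    9719090623967545560588928843423834625036755865462675756189095595477163458327749615855699475864402775258340597723292490783105093976315903158979565575516303418817776037654725533682019082629799909117567022047956340851771072017287332757328901007998534058977762748607411621,
    15132311804269390500848576924483336549160152539867604583068316438829710401557676646616036327234114768536415212626563166657565137300737979804620606512581754152330011586716326965084197583750299170165637675449132686785070703487880452954046120211498774410270170496630529277266664664177,
    435762043816898504062439778611277629326801689885525583604313],
    [9210553591835512462339118156078480451842, 6087943693895861947906,
    66494271312682952154239304759275677626580334747186516958816113853336175800885725581267479605469109836932499883734018,
    106897843998973017508368398169763989831332904434087467398660,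
    13811565459564297529785838750398306155628837926992021084029614371420564383638215447090975404879444968279134220302267405474601930523427500259028238397375941880973971835111799941839539717,
    24531074210975009138529249130415848720899,
    2599046240650865512335639942474440938749360925742498111071116614716284802444358348904564456892644558178763898298959515414106307949648926698019651142943757538115414925200193573878957159282049575911158866104550507524716962931057552996143729652401029832972763569670,
    3894588837836408339305071611394, 6613898003631449972383733129247235,
    2601191302316119811869500223712081717414348699465272968287950937447570982720065071564407008051108452732083195201934126919451967968144662203062803573300726642526179263763768829728564347901450346504160552599241041145965978259536719535712260,
    479951600618858489632200944582136936708, 607268731889949920402792411511298,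
    608023413636236085927397179524009699778726703297497163408265577861338081463556,
    2170094642514728481755318706231139192069,
    153955364235468683207461849248068837852677020204558362574086822895122663218420468709054024635943427,
    233306219132873888550892910497282,
    907305218930354654618977770515313567812790848014706433173384261320583769783872659748414495245288875947098632366607738419205730021462878757894,
    529899623234414065631353145495042,
    456726263060535928878473181673116186086847899061341496384556985388846216108767088438412781359656414779273254773639880012635822749980614228392135660984909039925435636153721234199937790492388209233156,
    16038296461671941058193700061328733190,
    97527693045353893102646418380184106536081631205690685318848295544933708869286112698348545,
    1983942401, 6262820353, 7068065281,
    39108618640324248179035235713592795234578185779604619754360063557383703861916838183803514696626756696631903040215436508300290533919437520253893046511369181629253104355533420203570980444604305406995977797145561599649219332409513632535614373259073156273542831863872833760159339837668334086,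
    109898689164378301165382908103454485732104572421,
    51907292889073548364815968898984409149902819365423801475603396088759898658508904232056562419334151046741585051411881773890114656973926679502479477197200427877747198073830665693983779169545598980628690322489990004079330753436082985430770726577077122013840464496072468180699295161860,
    9679149765683319774155484542642945680348957188, 8006819363651423464962,
    8393509283485419767426579587249216803915634379127424458718539277693752373540851111731723471670211327422324773658696691817804455748582471859171579915115774928429189325357732591104693310848804627788365857756866648705022469,
    8103055719182099796168250545473496080698271754668742771519534102755918498371447332539646686964359567601940197298381394476544488915870545499585756689971996714556631510574224471427208729235406981089790163592667007446533,
    47729790919012531091409777465918631962500382858250471176738248055305375808878497035142263524875719903670433608062762970416230055470510774554921769687466305768952080066548938154491995445097963859532908655385318431242386407595495476800512306113931052547469622687748,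
    429376986276356560514692273153739146675703692280975432061871354569522989258410560243892758492184494803486010643168085676310820890212194843292783221230704625588395412839254728046163201926176195311390709736393532864058759683,
    62888386972994702700227527289037512149982254408532590115125869035194154091791742190481972535106821,
    905565516658937346,
    43688797686799243551430845162895344244529900743888182296961999339877223441471863567898441239419377430020,
    149590846507527791986912121029545632388240541733302561307964398619868337030882373744718851349233000507389185518821190555796815645409586391873799289697039014685281023352054624181883283664445531064592564701457567562448380588617673443351993410953500397293297883031626052587438973214781971349933869033632814128819699699378703466163580542011908,
    3833494383211014306872586232536323,
    2222811192707693516605576452400824782911256186287490032585491621238660709872503110140788993538203507239844021497772537691150972451652965490503793363584851817234973872427597885659062591726154126721877948463024953482074041820869549047959897357818793900626201895439013798113330922529261573075212569424086617677247716362157974003862292213573634,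
    13085824732605163868789306138366346861671979250812893398790683705764697951247641443453496335579138,
    90924581088642313719299, 436569228404479085752441768380080425828478340290111025610515764878594,
    10021887789941496260062675913829891, 102151586343698771573251,
    52681838986132011852572868787603485635292380605171155787239108559621536003,
    31519793510057271365368292361337314886660742512002250441625386385842732905411704127797275428326658,
    795468859136772432788863611338923629311174614617348420066516483,
    38874991978590963136396681547500328523069296017366995515331323555318483191694878481690024916894768391081228340744000650197308523357305155596170250747723271982452737910702669465536154500724381876981251,
    70047703244784741367276613495446951535599360142519962874956496515811364940867293247928023914027690498,
    29112522999118312534574926338,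
    15092823167343746615121326210217841138712567401987233353486647581669142264146983246334478220935466868346280438573955564943114214020863666964685589802436586125013909826642808612503014143166440492121112414330377825480977633930695612900835587564824219018465760721573029706242,
    1374844293147189140951346604430175316453130775780925354582468653397264119703917268500645511476381651031111557270194040063926800577397330904670362046689921684114632477597150581292742892928647138407862064044067212430472505493863196709679169545543885005806557311194761332760576992883645076940688006663545958919346587821779763269776317913489654383622997711991470921164918529691666482124243084232403969,
    1633144321, 2806031361, 4333735425, 6362806273, 4013984513, 1476443137, 2348842753,
    8069067138574661463724392950078248751213656315081359822044320138367697426469508524137462113615457793,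
    4551850497, 7353644545, 1241543681, 5691702273, 743509505, 62830671741380225936398577410,
    22900485650162470206875403506827855346112720277114737723874818,
    376805203140318613592653837683192264771719721296388181712560070858709614524952741590011676587073714435,
    9231789803364595633906832832563633753346, 9932262201454192145901262196967511919874,
    30418015902693938073907629001473327218805755371777, 2634231041, 2952926465, 7050648833,
    3959643393, 7872769281, 2655940097, 487497217, 5306027265, 109824],
    by decide +kernel⟩

theorem refuted_nonconvex_thirteen_111 : Refuted 13 [4, 3, 3, 3] (nonconvexHyps 13 ++ eqHyps
    [(4, 1), (5, 1), (6, 1)] ++ insideHyps 13 ++ leHyps [(10, 11), (11, 12)]) :=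
  ⟨[(0, 1, 2, 2), (0, 1, 2, 3), (0, 1, 3, 3), (4, 5, 6, 2), (4, 5, 6, 3)],
    [500086654871589206595452637513648039751725707668363671457247798918634231298625048448725175330301864787124907168423230207474821442246995957841920,
    6279064748949694424064470187134646999949702611297066862366509725319478494207555211236028396752843055739370609781951800180510201687407400879127405291675755809811252818161787632031688212260229677728,
    5628810778502504324143331962863534002065339655531068861422279242612223396621170535115982085927207679073478524433859548291802525979285208247530969258860330769232987972263906402117594651113551933639290399367042362277185536037759352626504964,
    37978253886683821060278004027808764983897836092607329064325621393408585408516723097248134622480597897853163625670544715534468949350149212469378551026476462704189382157401843131527868320429872537656518023564285511607073732610230182830372392,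
    11039508819292003401237596748789349302581840079726520144784504382570101979497197680751205528983035005145538934617027450741895524010336869372492807166947492585571978446950338770372153952707504143739614458319703482692,
    374169280895353850782685875474047116721272363270995728054842851650410744685563789696225065915527406898948409144295368711309335828629564141344522710907945722853778365872367777059122973365530488683304616467108928068215887591048682574791446015478729038681788893889403611999088907051,
    1965610983260366155402755682107809797689916884528759308576783498967958933989339460392069867053695508391668434916207758716533678888209248744029555022725077543474953209225010647677907776218583502826767157640053245421933318991447571788164913643650977898085094196210034001297787822249381410604,
    4352203863400234479569705731234685064214041456458054286504055427100737511033247344401428382961345667392925504845115457677867825946317488319989330176532452912518985359176739650296207113500849654608138247504981912300422657312759177995528921328784870898496753960320759678349948,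
    1999083363943791123528739465432436262443896111599884739378011904604270214175905640459965730895509326304586452336850643251720369083814786522515394950336836699657719828286565698333514681151619345270976114592643528078239662469667333464042764469269774982365331502,
    672361674135657909890123803576716142003566155164169643660313266525296454825410872299327736071255973349334895407797376677608834424459155797041269673685169289626282500299878892086217053597680218795257214979276214369141735925971361640159712101479732665053374576233952640019900439057154779420,
    39337935883322062263208125049309040792481185528955058300054155534600655761132665643406592769953726140011222282105333099329653199059414285219945754352020954354413257865126362277318007079372941264332339856791222046933102568248046561165950178162359611665278310283598536862197578794594611090547660815776330398092,
    102478],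
    [10286653277847853419418622876474691403813027151402881065444606006866175472566931970371182733771796862052540925971682137612536523406670137019890887050774657900643673218498079899038474775599555032099498426964476010881352857968770136955569287470703071132532035532367523253717384752907916,
    21793075128879490271651890153495264930667769591351142321915390202058424015509211424824141305137970151531660995701860224518852246427997713090147684635600241445094610976259372122902575208980823016074917836456691988237826271101796629283739197126764261017737882039777033447257341459837199,
    1427074384915040326079211579910796807184203526396839813122179506304864986172520535533166970947820562952066299296517970849027449027819274541696634901024295606240898853347086590253318359656410780320412354875774634413421993004942233406087682951886075723552468651325706166156610915164,
    1459213775041934846955616923633390203442596118140568711069926422132018736146342181614934338177947838800015888394756084373342628540798495232377918954688325183268095645589186323775083820338307038760829662073606362586311612767597500922548455807613395121246038769374942249411304512581914274996255,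
    5159798850075309731698209583160734330988185101022724780038969298945118290177390671122200485757121748526154965781148255458377118648760733665527803471753667215281659089613078872458829405794914784961913339493943925540494330074080656328450903457989105278912413536728422771276,
    55124676197955250912129922005419084231125900109095726920311094808088956803883564422648848019016367469596799441842422838547526720099036512966149143869773612269997481998237937637125390573573719126071740370387654294616798833402587501768032326815118800890705735729602525613112540049612,
    356063129637695737475575274227509929979698656057246610436059675739309929791065632524103924481586135615250897685667112880571087662708423865927269689590796877261100884459890218581770991700353831589435939929854548487214924775952355280357579304217555021815041109582194355369241164,
    91607814991070062417325459042741050767491612539039985540344102003222692108397363459330745839439503676089104116879404696015060552088410924493612705192499908312004936307338036585730280338224495683671678848869166493220136816961281576019499799924594505014713666536653793869576424603836492021921212,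
    87584274090729654448457803836143262202935396750071395378554165783484727394939348353151296220085719954877981213148031650394214759019933646271677427067071750191896820351096715020172013323470203026386241624525611399988845430302873564508505646631142599821942338144104140538384849591950444,
    12981442576944769540330032611923752856268604114048563328336904353507403333397070145556119280546062128634510965220323995491622602489910077592859899174805923903912137814250093205142436907345447942826084147042402436709382093880095568953950878460395055356137582593803013010289982424132732,
    19935992529160814349287768491499410003482761301863862319883354818549156283200448573172912439221820362550674075505167829924793001631291590574143157684893533889399456860586785340593842406880467139112708460736267800403680507925019034908649883212257936064374058035975938464332,
    11591113067892041274717941423720537555990980574151766831620993734614129343666962034005328258168874703244912247913149731764825966080055061067348304011826809577403461219456838331200116191865914516535557772185019230620997126300899326805662009234205319788302584183844375285067146519972514451080719,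
    3735895020802866055445413044348515691297943146674766883168361609022377810926294110291101839646997114204712690478822724925185896029928603796877730801987713151469929831651787483785],
    [2027122314252880386, 29248327939314900030963202, 44568778195500614346243,
    8579474801822907818498, 583229473475432757167684092229122,
    14864965637201037193720150895414459148226940441969808863636576547878145712993855196818693636968722944069668615512089177072645906493921411275993919134903179043143623010437864592245549914137283025873100788739771880003255257487452208230524498124930594952434865882944576056644061328899007765556205840273808469412152356755832800168766356919336886575358468,
    124205143098422325603532548913305547419139,
    11328674661869072895365234867362769076451867073515401843286893613325075810036472806169922484315238340509474113425515023831974278343589381831392860969125816582771837780730274892330230832532095784777232775401263254104341024551411328933008468122960780693010275516614110454500931716931864634793786656207342650158295516677272185300084570678819628912658762568984975739604019108848801034521381701654563243608283907,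
    228776636331354225126991278618405105237150107916906685136189126658442649425995885797520566810954666693433863,
    4999630745991529242114,
    3579639240284010634125856927280025752381969383668617091209450122001623647485015475365071350148796549167004801492518317253536527454017723200751222494808132762880028046348120113299078364920676592588657819792320926494578274233233206786482911381345317995440206335998377096867695885754967008227261905991259653,
    40073043645238054649262617666601810978165079072878140481415426,
    268668001021678024038251404132012345824037466541885188050483860397881038564286979,
    28755391415737329285160944211122510670049794,
    761149311254984176722707975134577859693679546897779103209928157003041463139137443087018308250197144329500387322367650347344610020350302202422541281650987513070222486321608171573270797818099219245388256046874878383472198203361725201820964300969903089408310215073650649876074471559741206298335386356874554245170902712905246909051373503316372132265253638836803076,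
    400668593452767643047495084679682,
    11588987140185846236396537251332139995447058467361578111342023880024937766709328742750384640683576160229954130347688996723803269870426340687902103674759759410465129514742196470408365986421462485379865108998282115949719695395827201360511359590759673889379371610942846302664121350424596648883458719763428570370522712247760655877,
    503271229481046651857490857738754,
    44564772416462750949176490656645919313566388057163522564403496919809237373253490249755700553919564663400382044158595170546141575691549061429184250596285028969634080452551380985253372107179941664812904645296289389054195040400924547480360988242289309521573637659997303718331910091922908557831070888290464801704063120866721074495280192004,
    67046081023644073984234036190103330224014212163489114702920093632709808841818423785274452887442912525543867840087150273416106324860749371960215136266158181824652440351538128665439524355,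
    6389436927451940883896841790378257659493216560108327807088547800160399309826,
    218291506237989279884467662651609240576932810931953326665826028573673975329013006156601954608186584257609914403044736237335758262560515730749356865125663275857945690292170110341781483828983263957904017077780103754708366090907987580115083683132488481937762225491290040591199472133,
    576891203400777802993555136377346,
    335924892522824286242915731423449986983817374222717585214308613774510232067541092213966705790448252039220741420876656323463250235430685552907122583628757627478641746998365896811874203351323947392166823696060426292502086364940349440250437608029060275358934522991733389136803968660195493464988171511137140832390393399039492,
    733309879051221860788951105545726761873774083, 605049310941819705709453777250677366264338691,
    1708461042953549653804686861727910779321248612990087182512032901738038133570893400553197481272077337704886634955831686599504709802975198194266650565972462382142429574803425466946185695632391594593438070455881632255340925664137289162341306705089063998513674,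
    11328787976285284269040905652357059626456441988038503148034, 77636077478723615631875,
    35789068620500179564283314407356586868665363873438619698400529585189407265141352627946473764296984120792219626458283698507259629815980319126958890073589129373930104810466376215134262129003837462904277011956693152182571012245213958295240012597215767414054579532047752534275657156748928941789347942698786732605233492101387779,
    44592752030862208566323842036048729728619807569198290414934530,
    3817506838104425610662071779861441470988425887191925361986170848283990275373915964513739234714347366931658442980961130103818101888536638689207014564049517396666702285233359171806722076380701166356361908590774493923191435066352496416572631915771640929939731583889419113343327319274153645393983617032470828653005441923761746089531049306284546,
    6381826317795349113197080291249898265090,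
    3943527974278757202516268942533326598986420165957278083778168471792793471714636301051131781536396089157113715003849368638607024863827753529136233220675966528678795169392795773577995431004662672550390850407587672654595161018749007410377531551537357633763344576932736361575496784934477770189491567219990202786915021181234671372873713114339915841030049564489328675841,
    1224787969, 7050691329, 490781697, 2705391361, 4513118209, 4781570817, 3594562561, 27904],
    by decide +kernel⟩

theorem refuted_nonconvex_thirteen_112 : Refuted 13 [4, 3, 3, 3] (nonconvexHyps 13 ++ eqHyps
    [(4, 1), (5, 1), (6, 2)] ++ insideHyps 13 ++ leHyps [(10, 11), (11, 12)]) :=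
  ⟨[(0, 1, 3, 3), (0, 2, 3, 3), (4, 5, 9, 0), (4, 5, 10, 0)],
    [487889346738486428646220511585274251988117021396656857070298649639726832487328439333971149694164325288282633857594898808794893158770992018948096,
    13067982932005813656313662810700328070379170631825361990511884484499690664725576353770184226642004820126964563244410816468419891917179806481593969429686252421679018364179521539328931532976958341776,
    5628814957433197885734190136520725465574731942606586169392722904922842743699995195332304373270850268518477101815474891168920302041581163363248237879916047585491791093855798872171921673337179210391533809786653014183286807046951537565807620,
    18334933037798051078109723966846852396327304081301942019522365902440976049660925422183309140035161388892288465923031777501606689417165264124074168986673494197033349503148835005883930264133187211004298080236949745338653058345739785016145448,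
    11448812755114442174215754110284539315506463878284707909360736510314624880388024197874438863782057822598478484105209147929055405552199780980783509390332691762846453543430017548311865810822311700998327603229530219659316,
    762279757872896529547555323991318548886519578161437053248007644036173070780458669448959662376768050931187803287140087878838025948133055214483033059603185033089082277660893222495369569660496116015914636888518366271898749048036833259313302163889026995613658606316296329368427263287695128076,
    92852666393585588940186815504594765354169217994010846525326560553801325279724453914772141945792731551781571538792246776417578466348893097346740685015354789869431555068055302214682984756411035482492868399699505195047928505774209871483241512298380904525278278584493659309516079092585530940,
    67173673909579345498756587323751768619846918069801450269622372910507398960969509729423381101870991368633423186232534389548994039938252910990635943532414793685184208639921220038566358114461815294232380307442641375934816546832970523862380158006607979174664783681160994403299929394494275692,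
    23693509190458014813998419528086153760953695080446561295646992365128599835599202362727149512208057358859293306749084429518982635258897323214224773841808985872542634062333113269097072575479053992856442683334162095277566711895760850491539402998685710,
    1276648201107244909339963533367291865835466188955053287126734859333506642184605322787560135558861312792815442278005758998769714395953481933455885276116437921886956059756055315933574211341134185592984092424762800560250234249260010603237065578360521858043954343381076555579888305245396613148,
    168933259252844700777588805754525404005730546842035002743521567546983863753170360566182847691106367714149136961338478387041055720952998010470778269938122500670276817446798706840491697821923582689199378687776357198514308078872564751135332443600553404571343359211693231510826267548728863052,
    976839876870656859757744545472123844103845229735263739321684449160067057855636138369358244380421174801181761914954162177381201615023636522872253251407196374109845310246942],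
    [131002283203521914758966063607024611015611120032302187280872135619756972939026608526720105392498025835568019274954155990376045401729947055249520767387643093255676481650118228706875377386914959888676471055852509785563919374802669221945645843105916591607333339334777334038031270,
    104800962590707922683510771456737441935665761010129728417380158806588988212720886157789902939577392312679983428403413917696456834888730703805715373886416073390539000187025253965643451926445899912635375108843737758123917458337033389054629694308261874290520463874177383797132487027368970,
    627793964413951697878132080207090483097268837069007526992152879748523793152128700534661112067290603601514918070835411142713275644643420884299750441034636613756511997859503671418605727961733199726637521711453607816183227056971501181557408400487938699142457989688006795176434423689602556133344716,
    91249839325339322703541672122411969959744074739547636643965572589963872468063929372369261607233468430561008579693651956373648188497292319374330647481840022554421166865623517968052823962575148704158445914236540541854823205731999033640713862956244996493008895360674674209207778801656863305,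
    229047404832710031436400529168205505598025051544144081495833880426333039937457111669957711745817773566124624234314068172489918363182531878089916067196967822488381886360649978634301645201651057187712333517248159986714774156601743782191481698740197018932236824207633418222665287979122991,
    295188738968688812095899973308797987944929187399719751933351821953897921308185549120875594423745218895365439472115974410681784545745953198060968073489974338036032648388975810858554866988500659197531454599319238719793709422568802147413684942649029055835546747733546476964233718100677305409583,
    1230642572343651784265657307684240376386108072399070880813485581123050016197764319368516789970786428871329916268485051511117520761415593568293242351266083758466611274065072624798309118574644569109348042415216545718410095732085105290303335028241957372531050161018185918853963898491135423,
    3060302992058172402494698283916318691047701131028486813754148284185594093607223388616246270497613702827159781418419878644086098381782590489757343296935958377844695071705481246936348923712585513880765327401405555494584375515377245011191361551053086408864458459170570905016908,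
    2170633925920068604455869708314318489150388995330432018715462739965922988293354025643763501202097530436160613670962513368064959417549439257542340436063940586361791107384377868081428982439755423298068185537651071754282983438948241021826966089699250564738185118145144609855848049603472,
    2002875921662051254707502740211160126745766646162076029742641265244062723565002424446168063655319115480952366160407900278807540585284093540859341210685078325318792405087961710062369534032752316246580736252426754389917709112823715898388739597136616311783329517065235179100,
    260449475158297660639558166832252050284638226450624727482066006180591631918580734535647411507716406495557241291637391898508622726126760293090020543526122740434976131077278557032501065501828041333643506702295301311756567460977554689879129274288910514633537480514386558619629982218411362237609,
    5171295607562909393271747683281317173206776544944893167233059083347454342676748015307717945302435820256008872615285630342369313216733743451634898917944024886901093939773034721611549732888445689579639607094873898243856436305798557880240168378013843939050017036807836910609391602029910860,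
    1718544265921838988035184582058589901575704842035294873423443035874562131817053331929897764053290475884338925504379316713352294855307784637198705073981649746248506933628141897637917121216818237251205875838449728643718144207503276884127350022451470780070],
    [6216868198330837021698, 1644146462710010630348298304515,
    37166152529534099297030302031003565503060141987963374595,
    15205764629774569352431593819107011587, 335084266921906227002474874113859825156,
    10741253056081099083297960527660036448770,
    124794815566628569687772703353528656110621504757049316597816615530415369074074523141,
    67912225942921851814586878496361045361485726793783858430342901253,
    573035332835000311679755905905154, 2171273835537565186,
    28326696945909937086374702712877537581011387858436,
    153043340979913700178662110515599630700950536259628548, 1842192177653309698,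
    151676748021272718425818465794, 753067781860398313029223215619,
    12647392095198109879900641472349257548780997917055008262,
    25408980329053896768525893639985125461998745466514594751053847253597796831592567380190149263894059659725595022001669,
    350234615696371861506049872327381173510047470095594211805164637131608592662921091103590380846135716254150494470204051833328257541976161276533231682512269694022767500806,
    1771615963791432145428821181709244349804326687694757171652155923723133361665586649475950748894840310488776197,
    32565575149847090562046716248157205003817904612930604549725725010620642865639978776198483264926960770892430431076677857871189655075180876188320505535953218878543888544264,
    743479051545996802,
    2817330353452255025308225925363350562564563330157486083688211975778808495193804126728558865972395534289247270942884121191913303948760658645455507041914316618432829217994018728995750931547887110,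
    8895546975610290442976794178484170621129419121407852390172712269387833133077170436,
    3046399748173092595459476826757509090630008055807359483395299183302931896509838891113347273240068,
    8621523069037711435449586405292088647701088065440231279012588803233274662235750863158179327478014972582009629525509,
    229525518609629117660765915285297737455719889783618901179728962570567175,
    74402380093454486096952379373603318968257775489008390798284125153746636330482864595932664949755595209020372935309531295492,
    147018986077441001133670471170,
    2240347720861228920876817254156394432772722987066186943648398282559225037383836066796137857212297829583953069835491428281285892215955094023040998013835141685522729403068045040056279313034398285317,
    175209464815166261620239596868766141783544671746,
    303921055084362310668343226464657500330629015092289143865242394812417727292859330329982537815724335612102151,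
    4700927818922431088215013862945092909863260526547882163402242128767729241880623373624645341397448840477203191090683998726,
    20983866695960855107943973868824392118271564771105863174, 11119883064903371484444971437814278,
    288282983803677143795361823434890410631670549296313183200191124130053, 8930615777627639596546,
    12260652729328125912231044158335523989075873269626250895263180354428793689511569200326646748316381181810802872173480822468193064968,
    2035335515124190797216689994755, 6032905031361051652610,
    10448702817034742080921947216381613440420154277642801562980727131250778965684872321363946474130323819367026638085,
    7412328347086611968951452319259877964557573,
    2184100646354211658066581273374287834794409054850890947894323406865911351274328221392225707261142223378253061,
    1142723167015801742961690845427999402358004262533228556140667539923445506036408576020813785825131990926632315591244764323505831287316127947978236423,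
    2297218731347085826, 50353673802266643787402979189779304981415931796452349462201875085319,
    9677408761837505061739026379814750689285,
    2381172969436951098089594233726182257624162919512077027784954546695005220280161752983923462274649952800767395697828080887299074,
    1416529884600246001538667724291,
    10465385383200908539321940521517783099732662373312639993108733191, 7397194218107288851970,
    6323437084336873723870199020851214904481016405595820722516108964007437499059220051337690929559847647050614679338843790547462,
    640806508102472446576377369483032960367979792721834570574452975819912954533944770140552155375170645380610,
    702769603352942572806997538440131195443280732255791867542524203382927919340337810433380138225813473428688951581297248562960029963019243234242292027149520163919889994630260044194721809064896919045,
    12189632631369625507886595,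
    326890758795915702233767340746231536106886456526628491378830984530563217945807860028519100142890290123703556,
    685923431817552975882538879977992708361101944549358091774612083317585116651026189809160,
    18387325372087720204972531015844165783065237458841525665898147947055916035508013453674675312907881720622595,
    254828410116799904410913174415874, 93773696270362194455859508268765057716737817857982153334275,
    22663051088263753274564415369663225534453371925421395880693741945510626303620488231467248251032652580145079899730917524448344789509,
    537565286913529263351842817838594, 500733457227987337618328014176770,
    27804890666494975991596791906776532039911301147176126883783153641735,
    926177323189428705572958018323417674113756891339997180261688127943729327836830389209615812163079,
    58533735050253700593696689620418908458696847922641711176366198831745318697636266364982805394196060121746851937034280239218255037797005033315410429941253,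
    1090898483993527360002,
    2367661381097854193667579560405842555627275819477559348321831872231175429,
    4093140897797083123466823193695543885226818916682661500771463426308988718499303663900072038170288146647142437715712839774548493807107574779108930666335601982598452741,
    3592368705440062313288107068046852,
    9408583542131327000865635682033304818059679827093014320137993930452175934401303948146948765976827614630103125221284962949163962074355992219250287670831552535211075427305460793690350928890089732510794290692,
    3009831890480946550866717498081427316914804346691423977862040711022421636485100913144739509533428092833390338,
    43071340617545023661962754,
    5385293316888085968622737965163075571795389053324723069444941742115307772993210961104575457519506086984475348667216701723210817635573853489219428398635588714326130471597483446868785725838261879190347016197900561851768769065309292024091031305618096143799961568913541540754411415817409138293606879605740841303392023046,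
    509183636688854067936229453353109724133200717236013175153337811210188728490521469368129464122887,
    39954050197244194284315795400363883560948039126428254968778861988971249609151779232212464206432046603,
    10788814054673189066216667483965848631375838994714724712321039183055444907905638769579085893951771665358433342598558816939163316699384754955597679512491082500863636745725188786000365432837767048248027234611944486086593418160624923155887536797953539,
    8503949054673188699650,
    3279363322626441790655443466946657508541651397394965939625194426077890691679046414988774618854666,
    1782818785671835770076095821280154754145026878153262902971737671102985,
    1672009452086955393100144942698761775522172759790634383304833577453842291674124788755093189232352713205664851933627679866253829,
    42173454367703357597312246037181048999309250070027100028035906483004249420393221710837497130682077854735139471784181750202171948667626079341916089609410219088586473045405583006912257494218016764766214,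
    130940363493480853362593245492900460326528089206484308208087440030538318508594546888807290880771431976820082828098840290907936144294109917562302926663691523265033731,
    2328427410813635866499996310779492320740269240135462420232110736091796382406128115544322413778262167918304745794570,
    328493507522125340149374027696249870006187540744717678784891038626466952894092121781634047008177779350443956995283558117728591215875768840457591948269655372407476036038583042,
    1531260562901712386, 9868749327794844512100110504559263442913111413649122619193705491824902,
    2483108557766277065226097102649507906099207, 1564918300195746310347208834051,
    1599486890338087913334012856769802544638214611954231907832784009219, 513467812997924354,
    3284948461465856515586, 8136590987142561787394, 2004430917482364418,
    15317953852690252040192467720586378375387193519552821024507483076080582823590756642880600761497778771456783520525552474515490731391488136015335984338181952107435974454016148056341289933308570010599398297178709761579897790447850116309217090454351193222596088812080613856571271023828114601372076123044299757055109193989342965265171194093392624596261518208099509956156486148,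
    18714846073053736844611845276534412268980658116901800580983912306712352497474106477919750,
    22929295063442978224711932941338903908776415349251896456366680549205509764891499846676168882332621869936324453942587996232830966196971254440145590245701988875734799556677615431042064183291519230467,
    46211568790347364119082283600861435646851934196770272020433230522683059415397810241042346906964537730489691798423085899857446212565892378579343385715556294209783722570369714310430313825118174566875326168470113276368529393689288436695651145072225851395,
    4152909363803051591170,
    34011245444260647202422038294709105256130367010889449165544973956174543953703361908781158847680877034107888119097771835455429850779193879966758335546247981015618230916075789781363381737205164621894248508072538937174823239958977547318179248152281697407435296371203,
    15037412387733190116218228687519543861822260017326371199742492523492785872147570042801488918562664259200502970504889519012310338898825767380688285445769575363254622706022536934835214907004167491339896604485439249373836318390879954031451403330550701677075079114791262205225847274508346501122,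
    3915930541738216940120275349385184528766737603908064047683859134803434681370067785294463794733126627754991622053753671096792128726017,
    390116353, 7319891457, 358417921, 6513232415561629814274, 1157679136270784002,
    22193382800567052393563704237829958662,
    15808417927681767551025307073725012196752506211121819973893338563891713780226259988456568564741,
    3432562743877680493058,
    662734122524999568020866152727713766973193599113346442496052452844498487784673586214878845354647993149032513369452475252000717289564099066864134387090273578483872917902799486079149994432424964960793923049808389,
    291522611548706805125242627, 4326905913528764890237303334168879933339966724,
    164934286203376502517461854022322330116,
    35682264593101395198936103744651667730483090098490310970379543300147546295088925779350615815882877993233824691945293763332,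
    582533175084313606822588788568856970377821917515478105351,
    62820689568133067350707058079213215822449087848124094024487905121058175671121661190331691483371652427530463552833399086345135393685111068195571982321630394882511359674488325,
    87408779437399308743218060607117857715716,
    258568827553070570785335136003429359074269378609865313174395740935635729190783256931698153270044915384748286572044,
    22579544098620930209472301575258023662807119891802729705754248295119934847930806371097576774043665991890288499796045812908786004077504768225717526571463236083149585672,
    19295550239003832827771348509643495540753652048034667838050987634170824759753950343317674342263280646767747570355488569422339,
    29402330020100610156017650487751923714540843243462507781589943595907697632843243759859034426858849966357343992099058109260240957895462786151498607568693080673533210093909211366538779170655201780335564056712674160060474647338063553027,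
    1083152494777297889988696567687101206703188813648359411981316923768008036382706444724540187141214825639416264666060455608527890637053258974802631015866764548870057558657723908908362245637296157954715494451809706937413132987240460097689452138373348021346685835328149038425644956143957341575190251879426,
    60255583365632671697417880854450761694482641999508125049578393483879035971141527829332258784882131055017534339626711147074263555,
    24574857055575535412770831571504793540719949375158753078851384500249733214672052200624936383036454723934373008474884225676703788107414667257193502210,
    3586680671973818913273401262368295470389109366092327690939799000969954018422293338290745471795352118500234843154499540790187522,
    103130388750077256241426933381826171343287905105334098767561662717487610066713944812810747639030257967854915235447860782735105,
    4280761732490588892418, 76299658044941057, 6864571561639842458882, 124994829032662785,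
    6878702337, 6799797505, 4866161921, 4585031937, 6547891457, 27136],
    by decide +kernel⟩

theorem refuted_nonconvex_thirteen_123 : Refuted 13 [4, 3, 3, 3] (nonconvexHyps 13 ++ eqHyps
    [(4, 1), (5, 2), (6, 3)] ++ insideHyps 13 ++ leHyps [(10, 11), (11, 12)]) :=
  ⟨[(0, 1, 2, 3), (0, 1, 3, 2), (0, 2, 3, 1), (4, 9, 10, 0), (5, 7, 11, 0), (5, 9, 11, 0), (6, 7,
    12, 0), (6, 8, 12, 0), (6, 9, 12, 0)],
    [487889346738486428646220511585274251988117021396656857070298649639726832487328439333971149694164325288282633857594898808794893158770992018948096,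
    2887450659305703584369120701810494906825947577573034891569444563491710121410499984508826660156583625599195891959375095926120964585656616482343828262081090218434674023843311308078934151628718736,
    5635174077607770726449180349625823487679509734686095647597577368516792040147330959083703114214220152083175189878352312154739394569478126318694178658386738438778416443286252718352778900315906088066774807775763015167924811404586469273153796,
    19759374597556320727709147052330928811457533500036959806693013667044597172972002003517450533264372312354716412729254439637490596620068881963364843199461591245216537923712114678499092269842442753171328144046016378298190789289365043885385526,
    96341905483615799021624740208293197901117136011903179119740839646037948782803127215582682683720447014360660257358856341013161903209780783138693074153496706876808605677338972738728263362852023762533682443173580868,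
    841231071101267638406919135955950525530633550093629702147657503248605275621530286264597443994799751226756043681336902914456074643599555174546612714988998360985677810564616979208901623994584393821579784771111160650917108898196275045149564307190299286585667577577572595609926360590411965708,
    1922469013396489408855454032298204729403833201156240246468788811732968021498678314278781932275644688957593855252768135283884394761536588749468758632073636351136821157695077646741591452884900447676484807426045797092984668351029220404912271832901942435428252912177801207063618278094953519404,
    1846789142099776954482040871745105768746986538297887889488545216555155429083920549532390369323672275680176218393268323483375631558308529213964995221608613216676058972006289468886187534533709772056790290477439272105995547673071633149951365168132538009554020489814820870775265399156326371420,
    1849401860462879800745806892041675468439145015946674154008879328386000553184164608173529356959860903493672649706231472526657764690760613058975973027306857880805221120147864703481227131091134274420839633821902433663447215611744102823503274841494676590681777601625529029484,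
    39785641549422273882350730585511093919366608038460486843366427279514814576162242971749794055152599906558643390209905259957779567630045950530926799483773492205579367699297968990523362051848920987048973448814979622077622998139479414296638,
    6514711543368067484287800278833837199188570336912275541004786045750448534875154764319805081955942049762066130706847046427323297967579992982128615538111840188703331349306238505324576693530099034990721707006141252818023695743919828138684557272704854131820044064287357792823733846168618,
    94181614021647599379202411629276763509302408385324743449858007098149399235754252133245920658461946951074214190265481207114825277387667316341308069219868095229610590624591312878633331856377521721047805611668261996413193106093446474496755270208903498556499451895437298663701393851205818668,
    16739794112670892364617382230613735661745468166596777095238479821256215158956772172681559512995663085692528643243668261279420734562613454618206796465859739065171344101865333981077094866953598180094394569612229244329227258476837301386094199049798456911001975366292108370938249185628,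
    9151020184044071665887480132390324972625859306296398481636825217884354304909222130442354658395366875638709119442000928962991281549208851764033885196],
    [19705122968850034409160808619104544534062457893340452504915291342508457720732248874868759598911954867656187101613929076923227295897227493413584618301136862948762381979618613856794760402129265869259727493570752183500268659467722274860200398675702180084420908509780062129324,
    1476673282899918972127500429259481125433656935926724723807250099260331972384823595252790366678435708009459358396814332035997389536245492612594118892060618509159393036513100242862421229192812672361072338122830239520018910941784099796105581263767408859479493204609371254988,
    5111292826950555040637739290363566501858252220092270911633810243403208079210093912162041286432333238796187927819334209825303434514153643347632580381644189000107861348116992712641198777213273760836071604877958557372903403591268344398954228759638741571518542922880546450374782,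
    83011979577898638974746234597614953709260022339510934230600681631949989760487972674727635708823676811691400937623879742390150239097596354864220515035595888500005974929280710383580950240654243768242075159232030337245523405658950660747552348127125961902447645497691354998482211,
    50740131327911241538136732757682734151867551571159581010103459042897727338877049892151713016988772581816110342987707535611480271172682581512933687456168628161402507720970474897619595667314776052892755323106880244825753152647672661617683729959439120374969579365653665928103021666655,
    1906343766303110587267258510853872616682466017568434426282355192939739106330298955287295919280315799525432592154312733651085848530857515530303259916091263396011426167579230181081419300145746674506849149029867661792174968032547353899463527045388590124393230629145103634479,
    35330087287843042498976127909418322391619834183866268523822713224951843307983900564722458527269804571056652803627872934520726880510534536150660673640729318572422788633513638336375346289063693694992157868629553418625294504963479083936253866410730512565282447551210409750041393964783985138764,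
    112596343615783525696064027020418338649768150312867319787466844420764836870119420111241178791858930800182384858209861989493006282359117340493594913765264355918421999243358265210750601939389191335997310868457395504020869445718838851480925110997942170241661946209672372625457923740,
    1939328520220721300990309536909120695963141877684810153528855578067432656142072718360229958373339015260655039620078009954477002567228341334198124102579003980754298788891761854681979781808411447330645522100817769294327338444723867330934086101533052351636467524430425914973993449592492,
    43060928428548303814396636081621184393247185456176712476319968264717151031927264760053429428599420391343968051065005218917347042512993564779549984379214976943906249699736594768306036614065297847881414503122232054581154422026551906244379514634829863535938964888125928258977880515964263804470876,
    136148243881458600136258137836095461379649878862858416503982446311703322582216509356540013460450927831176231922562371182542079079898167103570109456374403277119085049614238945128629253163016039826536612416909331597209581138653671316601581731984612396600458359517771286926280056222831,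
    87885111108137527756664602497522277663062979953187504714127502396601134159816419789913480558703986810994658725530150297223999530638489690663349032096215608237215896995756905953154070993906662734423553222809504966175789786190256286748884943954429255833713011835843390129596,
    116877990301717830598485528030871526982026067904354393078650464353892555543804348542627955368215112514831132592012881262523369493106067960973826492813103829072504943956841047012133087640349863536272834252081324620779864217915889135857056624498671433776518159107412359379204716,
    6276124424892230997052951194702059815603305785819510108000699722628670813932293155791913243801960166909921009089862261366448287996970251461110067844205645374464123483328438797960813688549602939282874548413761060219600321324559269549654143771617674354736658721526669261649908175,
    381785305808691366488211522579230579213249331898956137035923204111980729851067835280012249420715010006490296933552438018950937518452979905803607626122498985628364517567245562427666723722091399404347152982962342483263913533508515253115509357673887838726048406,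
    32316140278273240668898417812306057603043023007819925167460699196955174133674041013619291149458549688262806408970968099765776457956307864820542708057545273033173514655291470114816403601088886555143819854299856049658000260906915368494437789420705839123328224540145647165571556550,
    63796235986887675766234855623660931975079109117227216647214643988560149321608878218803995306053312402578648505834757733841060360365539870895808746419854322492073097841699911697476156913944247457113769983371808650278651593639121500513268448754539667167613005116998,
    6437419197465991891455080033954512292821668278251075065983304946728202008649662606192520287978460556825472210072554092],
    [5147691266234568981506, 545304542593475249074773535278082, 47387582709696349260002306,
    8606424100278720017286725222760067068270569536381190, 5295650280532444925695169045633870658821,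
    1163525898227072404341686110423684357,
    7588200520616546371462990550350503799151234612002077143240354308, 567775764469759490,
    2569390345008533788438383526589700053094157939974, 4760071180031471006210,
    14974636807260821299236748510656495076613,
    202904758578253452748396282540468491953496190943768478655200990131059664180345403425314447683253075432223820852090666825494692815252328156923339010419057611000913649552140805,
    33442421013847803990744314155406621555203565745668, 597263373321235359515712003,
    2085399665074197912860016505347, 6738664915118073550639539894906377108250621521997062,
    12311293327404194889365168767316336036504624833094830532965046981706756530207161871805702,
    5247856945870082456660808920494583102441062998698861097779589219507068862708038916,
    5040277026887171645851550762046522060293770404857346269055553384682400726806517103375340404545799,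
    4144252510717902548483, 3600936283826545351258594129228809350621592097813337499123145678089,
    1176608710763027168273825624784713755292339209156763283353408635532609465665625609,
    189024961729444380197306658923296465327547979167561197377152261061799282605327192371887452218180163544107937380624631487609694096231721490881031,
    94608426722419570990285568108398161788613420566800253045166927933190505703485216087192642957625688943019024345755478973720836502732158337335382352329851182599,
    10315479256134702006618623792849927259711582757505286,
    7420973991520911245333292677756442635929120083066124003217910635006154485562063465529678803393112202633207016278434940266539509294378685508829435737775569446206146594381020497254653406674897498761736,
    3610139044655105700755100016001536540726862192311275896305196852417817546134184461596937,
    32845024594034065234565462826528134755844919625023817716172337094598272282033971465131030925379600150296760491497374279182324024886494471,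
    1917843083719148485229659108390554302725,
    27249214298203280417442554057736939059335756945912064552657560380302979456623846323507461416231857415183236241925,
    4792861490291084994728049699541202171085207941783544696153473544710,
    221475340629020169925591161536457703975340319154200974432789001816122668298870403017632183037902917700248024584226982719509887634557799717923069752004602147618055,
    121427186105165143208080749275392797068452617124105114871715854600,
    55867946315912281824730597370372,
    5472662329232981374160308410205130640810934951791753363537123622665997733539621062150,
    831655855604952089521753447803394,
    5053495738469386804877670719535193364018687588861727576902831157740798853822997935130736133,
    1564096044310323164072636685733715853592108226310613683905680089091162233640180351013815225878298016419647398181861638,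
    9447180779503008976665179888617744432682070479918109647487508691879136163815774538457042956034646573426195051623981124879109512825032503513057381378,
    28032542079919011420744706, 10276647280245182959106, 74678625079312067465731,
    94392861502628642014191720840254271201843159411854278190866281811812850119779169377223332864238597,
    18547972600975559439653430505169256925671945213932258331437664472123809719433311890783270444192481181844092562660020396096727694600,
    10992344075340663744520626344411437461338245845832784712886691636704612499691218697278695018662406,
    60683876199985013302499162030972968395741996305185636620887902552167809399342597,
    4527115552851984835208062529369366390301684348672041400038661,
    2272207898101164102944806849338868322517737603796529980617096387475427427595656445827366014085957358714512090774602877861379073513158018564438437698342412,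
    7483265688285791841289144688337382871299385116591442249093361159,
    529135025392559087112124941458067270037692123926089749172178972584371155112865846367084750468858316543131669228337498662992138953125299928425781458707740942043011220051306790256921919956399937537440811526,
    220608660664716275557436866500098,
    33074363219880265013322019918655518071095019619521909055966679180295,
    6680748476028524844242465172287560798409598129412,
    565597136732086151125939042175425373880587120052080907772480418376060879980280017922659869727471962888856567908273390029115735962356358990480579724967829190736331343428269802944387365102548036283855621992650753013105609185435536124849936130559078363723015,
    35573411922716169463434671926811878080942251338391497117984365396259220740351308556781228304155288696901327606952454954919882876567133000987514185524488463924058955371604833004032518,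
    634482354356823162855854261532668786999450499897197909511,
    15532945222745580209216142198416661022874119042281402539099926922661382,
    64585352861052549326272582841084184687256588203379685973201231745921292350525298446434797522201334793391305993,
    27430430753197247601806501460310829201788366926703431597260856693433283234900851193432665788031665110965555878268570407782398775736762467822616919401167191261354256672427968203440060598539527,
    1856975890806143393361834861053577669327435317150913863038146535476591797452436268201978332431452426756592015710922758,
    1098957099418376083056504236956531347708353608151510815561812917209085218293565739386670668868583008367574923556571120793391269610132285600159599123354002515897877186039869986209604174958854403397818431549789892528492206105094226223785833737,
    1395439181923872494450841362929400146060960091474696649691350796791279562374233290328674970984492775025102629380,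
    13570069783725626375144757167681680106097218532925793281018169118009588446469,
    68369098250768213320488460160364666448030757334715885037005753057324186757495289776274756085229297464756403655134486490264950278,
    666946433550179117443414100152834,
    794435844333976430914653996125793749079933560624734218045031719660240788609402885481358181960832417197575178274945583569765795563932085074072269719498164212151009874921936303051564436775379183105334956217950845533651202013022897360316978694,
    340580066246709375648851511383622394918701824201893672626789000004967754477827964721696884185603,
    8795924574320200574551815394460121606066325585898686291926847503287487341573,
    2445781482007834114,
    8502603080672745982813009436334147056790374055342024293054330844652159733238878740278819471464324611755735625024547968328476258280355525583939479382933274908789374781017986117316715040807651843,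
    140810288653055416061443, 968565603012730187048528360035845,
    33025260616437269044193783781395799607794477525627344064611449688344115517958,
    49278940664762423189286004990273685712324496524631248409465044608094716992161670072623725203373426389733004437653616626589213900543090059308672104579180252684355705010946812045603958432882083655939,
    23026670990195806780931,
    424138142892059588872835609321000032608484578778722723885748507807640134044299779251541716306565601344739114443371582147182329075503738706423915726542867973,
    853685750894425478591493131129881920458763209325570, 635997148702768408086522371,
    192281222700164928581536607065219994676636067714983980350226665326220443106822,
    263420868567932339782998842148594069296648567540592746094879314644038149,
    37023721646433192256156546895496419358859525, 3397795260430596831347070446599350292292100,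
    1261771080626709618221571543118725072089271781219884307106566542184746830609066502,
    51290923342573566076698212524653790020422759812086900180205866156536273082190597089107123382267833815842464915108938198463863838407074820996048058364671872975227879937325104318416348709245221917653180933,
    13202287873292553929629776172147708002997399640437574467743809103718323338994768828696928096975656650924144771803768296549889135989221669715462,
    41369001568635561202950109614419367432740512104503851078932315869343143210785905772318618392652381250355751657725365841105234700235553420968720083739893469130801852729508307474110477829,
    73032733652086625623689864684553451542374941240968926999607560,
    955852204278034321343051818018923073224843029067132068912145855734591838640398229858141672304975863652615294905218310,
    19683429658986746253707422300637982311447122512595175961106688348460704983834387107814880632340595778146871191563538310554420466052438832231956083205,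
    631240868662041644332124475317678335747741648043640242145522003452914350664252598865198366125562695922280668180236148689327745484686479395717782947908815412941727945541716242316807,
    464294670633424434178, 20696310793217, 826317569, 9433774593, 26074641341308018763015170,
    120352969321904045745198556708794841401226338818568546959341553911514865312561405023540743,
    6423413038804084465710865149109352498087490615734150531966285083500424280660004367268340091113341782534,
    177866612674639979888859507198965990813781689741185885856058381025392053602386762245,
    13654853372565082794227679140424239005186,
    39473138861786539235990297098179705528512083767174384365656581,
    749338758715282961391399600197122, 621181944600859065688313881052674,
    2624203407571620072075238971494675005323966727563630514973935962311378876854392094682970087066120105674841676998972723177731281374865248743686,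
    6309863572734253529602,
    200200676243483477583812573432791054428703132796787353667707114899277319,
    24190735226999851367302574331427486151292451421273333778573610303718403511375421111272653406275524140146721634310992124886655308444839134416586421761357406759913132501828665206096709836659737573986344364617640794281444071623141259888803157869775500472152813650958539034976582699122418663709195527,
    2931201603365949321341355050356175019196484513163523257158875609046389508673636393309733537114031811538689605761236829720730963536467972614,
    47052826627268218270826784836825988780723776955841236718083002948862931945434670233478966913503588491548098839679746790558169299803233457431016155835464310231710836121740810021652395519044029357824603565032574673651546117,
    293400366557526466465104616383620306127677430815209170711688210322771839012088124672750817959463181629191157233667,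
    13875223355090253175813442236386819, 999705313634331525595344515121927256881616462345730,
    1976882265302387038722, 1717582894397366451714,
    23992919732873687836021201222871389705217511200228478633432746415188282125927471774072973885328134458392629044008786181,
    18841882947637166454783166079263422896955537866352524230613311685228051448745799392572152358906902116553283274877476310545986771503131754163330373757622724608090880739651686069703312000363355215953396519554476251269046938397401983998518481700960835420667576097740198669628141710808353070371477764,
    8938895508752518760415331523645319809922893137287034395789064017689269083764169955365395012719798878359789467822597,
    2473516959046859904641928845337660970266068565650987769838908607278983032475573410799452721242575410728999319139719339251159565937165,
    1383064724516769825089606316822452747934727,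
    2928633344326029050323915510537136845698309952289020654347288681753642502646439388798076175766761646494347277054102846378966924676761774861524085428193991851689098407105955429218688247383939034573165091637271294866767026496715559389619293938367247892764741626251295920298213075823961065201393005348033475791472641923990512759582848883533328988055826547133311422995356175931622302973550613523381156300687913388074555737619872191768607585542,
    163732343211195374080912737362426376923412152659370562219648915412312169146834299152582981692006058737467147551628809780071718081135399451257813722079835485843390783398602330370657348817028747417979121045422813538686284542997472495593427338105554893359573636935530697736218612323516395012488181630783172271296421997615026252573520607022585207636930392379582167424763963818562158783672662500105993102341,
    5215261079641924966443694229192103996589138546646278,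
    164495012241615145766433013575248969896108888325,
    1549083616517502924195271198688181302655372564626749812785025733179499133864391839285767869360738315416513813201342080722822798343,
    1155906293195180109707973940827160796289831948066833488878282139941680215594706459540882123178308495391229717814763980663269734900670141523748442975299321705102918080500638737897385747878054876234386044217502256411387395752520348301232352802972471405101962213511608208900,
    740819675835642839095404957006009014312454811445960867393349635,
    174938964825192124558412201956795936494337254941238468651468548672547675484199482597772950069917838221099652619621090135631120476859896074455126285291436086302235007305951543492140600223468671378944990846382176780500581809463879728092689398031747922254228021572652564111507416882075119725761480746151170522374,
    113929904958551502957059,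
    2005012210168594683444534506448074566739103534315809685193373323257497536876083691443389258084902290028163604958773449731416992277992791420030030134991205963747027101697558257390570258377277336485006217386715562736359356821975973159136049058432849542378025382998810764094234107683335855106422477007891924463268358,
    6815686849187560244225200171469592878210655526649295867512757370837832546994924359454545353984153987181653577500006729583051780497601821714740507664820257005151856306364962642705960493688454646741884033717666842524354968189916840599292669188618297471779198240472079476957847286433388854975591673741688069,
    11044233012857527724294249335647125002959169543284868158136957566316007905911253758266346751347375523221329239698152706056801090434523747456058831532740913220672336543870010598717759089546789267942003613612648722140613539953282647834912283592877755447893112930416175889332647570684624305413,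
    3022966814464444525546671580607496207534160789642472216881138501703133701,
    5595774355441496485940192802809926307618321787391885956471933224361337124234575907787267,
    682019518793283204921225904590159669687404075224579,
    17020387183069859786357060475850859471876241261833854169352,
    14548566819823519556659073491915569596677,
    71465155902054082220833096336907675137959534918513736807689,
    116400627180688499840970322770037271434081291011230779006377951995025715975424561712698932868075255735787244133501076412625371519764018782885545756347623281912327856834736948533975135010053,
    9188589901174333198462886829558871080453,
    24124224115553718509252200515134195575582397367407097789208747523281918612367382978209409949912373765922236620592843094152853178054332944,
    196998899059102571171735267653180818816128498188269220676069989665340523072168434485598724,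
    151531220981870273164545636614445054492688101482795099443364424250449054148120812419538099779352879137042491458353600303379286246642641711449566011999047732993264260252262062825872717916911754404863706878747649347914018371586,
    1568829416516231099906,
    1146608827497880607269788816684290024351915445783266279200897110154245962372966578148076048866834780675,
    278154425941957883228904498583969479412099155869104256786730762204879356375543226739452648043501021758768321513849924171851092562934335453748124086439948434205567284883234385292300548,
    205741039139619865804274172534337199677511277136730817446442246, 67304390561012525450755,
    10422617684098298024334909601798901715205, 54455587825894032918945932802749448296131923691012,
    172163148456902793374402943306831194277311480927819021728532236902708309128060784320509648875625602075536683725612061529869771461639010017209011470467043773987544870322771462723024766739151132370801439870469,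
    10121328946970006970679773157469699,
    646159723775464918809620646782702811037721687322742975126220649622514790317569425052956412932,
    452606889309821700613336995515223841075834908399617479913336801645089335384869776655565913332312127888681743239280325989095038629565909187480354436956567298223998562869331967907416117763,
    19274456534612155958012609805826, 4325463678186598549655753148641448450,
    23438517348966416811765330958565256307834673984161958757696061602672778767748473888368892925553905605822240083953018835524805346821,
    2086009950056357210229710506565200463386354466536831405927847873074864641949645941227757382710791263353702438170401962391171566425883814676363854979830542105314000779107283714153635219636474910361524607656175559164700028033789760401762075809642610655814189188085064033527923762060416313363566397702,
    2586687789512193095842608014523251568276536416348924736883818660999877506847938405272318715663834787051125669591174958367040764167880781032910319056726607530014237283970278070116725479601866099169860392348838914704553640001943161733312417813437398053562069931520515,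
    825059963330907259885254364844066639715893312861420300360819673536278257278169392938730622261336693458118378588809203791869733601875026647317650706844675,
    60897574505434655540758393060187352399399938,
    66384076292670558865645456780809514571492349683683774852873772644671165420833754497516498731514161144267343162157688804834071486684850069747716602817183693875070467,
    183906638869917211531779,
    68012630102518794651209940821264971552823483777501140630135378799674127329431870415487220987553173561724409272065066842974537099988161634496623584303644639229628008898700748639555751991270448946446061323608126927578003857100772562348240864605238318747686733356631713238020066994970022419391530443922278514818126605082729672313090,
    13361984570132453707621546274086507807542741544103643924588869043331549507604881168868355483987377654407867416986432922452069561314368001,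
    1058121985, 1816643841, 901993529601, 4534900993, 5100366081,
    867726009102409286305030005035765740026760742428182893670912647490076462081, 8644624641,
    10071308545, 30978617874753708382003314985217, 138507009, 1346465537, 9902848769, 8808463617,
    5167719681, 10172757505, 10909435905, 5809973761, 6497759745, 3355605249, 10760026625,
    5139645953, 5339375361, 54565121, 5453033729, 6061281537, 470719745, 9600857857, 357547265,
    7302319105, 877221121, 6056473555426437491065695745, 138236728619824641,
    224616278977228573830593115779544065, 9584023297, 26331945380609, 45985716924929,
    28393531494913, 6877245010047868623541978599232107033368831786530819,
    1716541451651762933372115991610095943002772329143822108261700097382774690549846841278123787468441296000932418385769108199504931306653567607774751044849639931412330425726544195925776860484611316621403539813160164421249992787362549062177191887117635152899570518307928468084087485780258367858528771,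
    166336512568342381459622934623700803759893529973477151068344764194771720115871118491682961016852921183681718903709928308956507007634992899793727748029954,
    177952109552414963510844419,
    3938518895090011860464746029544359307071545523130984590175778389427141471067780979714,
    369374653790653423379925089637279134640894151000834846828766931716095482385339863790850,
    23787984897502923154545717322693117290731186380318906574142538305233489235318212218598817069266178,
    59319408174081, 47703698483201, 42275732222977, 10339969537, 2143306168321, 3511654913,
    1598068737, 5473601537, 3993011201, 6278910977, 8204098561,
    3559826457323689398878692812253454977092896663190561017691649, 45438024283393, 8259541505,
    332173971216348911873, 218064045338774090241, 5031417618827008],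
    by decide +kernel⟩

theorem refuted_convex_ten_common : Refuted 10 [4, 3, 2, 1] (convexHyps 10 8) :=
  ⟨[(0, 1, 2, 1), (0, 1, 2, 3), (0, 1, 3, 1), (0, 1, 3, 3), (0, 2, 3, 1), (0, 2, 3, 2), (0, 2, 3,
    3), (1, 2, 3, 1), (4, 5, 6, 0), (4, 5, 7, 0), (4, 6, 7, 0), (4, 6, 9, 2), (5, 6, 7, 0), (5, 7,
    9, 2)],
    [139961460144043815444552804901323958248721454616754368115193812063167619036879567039428584480776182274782629078374801703542881948220171879247286959685590658187711817515008,
    16510636273279954054919790062322756959585524224735321116513579426847209262307751114891525514297832766225909776224114524944745051927555417827862617193020173934711365185297468547184781966562904670281646130973393442117902504820378303449822480022691170882854,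
    83978772526334115839222751074276800449410344313874129634468222289902264980103255936508106039977518541228561578631951330371204541203308060319264216254573011617174391428502414033917905355234855578043199066217361206780550235487138477155546639850127341870806888162200178592798276068924,
    4779129219737897757936279313135677666155195141165053412989462770867166293523518483260919798685611147043471526010921906969683042772483404874336893927391254212965558594765424083272129805885729547644672264627269797084871516602870276158,
    14765613937824146119034828638194284312271635206225159567994563697607205767270712092203139694265618584074576413198677318126811934804713539128731560067550080530547716239263772294524524465176263105712523828618315598002943500763366560493874733889943536233774727999251129725192362887280399372,
    466841495878304162680053253205286167102897387356304639436514146794813690745882178531143044151167368148430432296409159404106278653038759861650169917945849448626112258843931148568631519463570402320268200499563415287878277644852454116498309618182505045615095146944511236146969488734990562862083366549580,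
    35372524575217234616172232724740059207637461217782082223521092421724623173298484370694739437686688344716115808278596095375138316965371140237800209759028716650154206486649743867270212271136190322781289828574697045255754125513346871534122025874990522624010375502315471089698726630904380247623560483800072682263162911,
    230701780565905146845359205203856965771704454224469306171759595678],
    [213821295505951681279695864883023564175844286366788903284742978514690963056805190525192099307754761827465841094973992953778107459713384223091477913481544409826049440635338200560048961431791574477873533690979758407195533133462175388242683052932659901596,
    1690346008429748492088033398374709287053142492410977543353747978537745715398260279735064407337979766260521579269445269654064305848339437411201998108509642481730888333781609114431941531254021251039527426427283816350385573683921652056290355,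
    4130942095243483733365922013213789697401705949769047583515315565906801167867572478236802560976710340096180890794955791601308932728587199719714425397066739347318634101671205825226865794722190065678999913084505332364327014256127716599689289899905050436643,
    984463553458284986972326807179848414670586597421670953522813762097539476349076024178720173667954680395151211516087489554694633749622926029006546964857781963801807023600928169883222542461912295737659340149975498210852800929423674234173503733362688184910223021420,
    638420327485892529782042429083039352247247866341632227752209373989592653377],
    [50616884804489851570381986422431109832770474987279641601, 2571176705,
    178169130652046395218077504595264830465, 306253569,
    26540329690338364316060531470851848527700995,
    14982020232509691171981245233278461913812900547585, 541100033, 859855873, 1044401153,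
    1581286401, 1832950785, 2152188417, 2337127937, 2370651649, 2622257665, 2705386241, 608224001,
    2051044097, 2671780609, 9482410220450780167972119417874153572013472915122045955,
    34048416649224912105122055170, 1883323137, 244086126626633061314279199984502508092882526692354,
    2048891621111531070505628284219956173573350498387502249042293827509412900540207521773014217774472310183259104000856695813812885654863663899725570,
    99603880273093317944298402634619881153270749607894916988882690266619462888000432980174833088606742802344942671824533729456367034278467330,
    2403457793, 272284382490500656477803791220587353887745, 3713737451521, 6393801259777,
    39068226729121773701317633, 2684372993, 1346402305, 2839582721, 738227201, 620794881,
    1280040449, 2118716929, 1648973313, 1510551041, 1095314689, 1162414337, 390673921,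
    2035303766755870562287319448142281451345168434616337151490,
    46031178574081727546365779269753091126278781186, 3168993925876826716359059720366956259586,
    2914986581978004617474, 168361173535967812353,
    1201597363903180506067638130910705996347189766916751301509850086324680324686593, 960637697,
    7936],
    by decide +kernel⟩

theorem refuted_convex_ten : Refuted 10 [4, 3, 2, 1] (convexHyps 10 9) :=
  ⟨[(0, 1, 2, 3), (0, 1, 3, 3), (0, 2, 3, 3), (1, 2, 3, 3)],
    [207640973913739448301508266714683460355065670697982538786622807188890203113069066594152861039664490951430904943748650236602078599540100275689435578705127805562427669417486663708377088,
    69748560845570356928317626884885295803186765038041239947413095055347906475691510606040770227346357874623367082576241297369847727730693339991512994060744501155643415954364103935700060188194088073608945379291097173056525797018397743736270207476696047097688682672666,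
    4190816143360348511025798976589371088910579290447772246970657415414255351773654728760213279801333312539078061077598108157904087495255802071763848353514439661138239995497526183997833791201149597452],
    [11849840741124651904995759303676532454507645361372341758149982009228367058084966878564648613161164698625724472945487962343340743808152944993206942000982996138881169987672882264099715483040900364964574807433841910602791039566899],
    [231436744055435890064684158432498393519192601910414470331538433,
    3448536079276297894970669860239714289362220291190721539, 83113518413389784646785404864846850,
    3370199027769719142096247965715196923220739265797481813076082727937,
    51425156063380724214115111781542921802074268582114895829408000],
    by decide +kernel⟩

theorem refuted_convex_eleven_common : Refuted 11 [4, 3, 2, 2] (convexHyps 11 8 ++ leHyps [(9,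
    10), (4, 5), (4, 6), (4, 7)]) :=
  ⟨[(0, 1, 2, 2), (0, 1, 2, 3), (0, 1, 3, 2), (0, 1, 3, 3), (0, 2, 3, 1), (0, 2, 3, 2), (1, 2, 3,
    1), (1, 2, 3, 3), (4, 5, 6, 0), (4, 5, 7, 0), (4, 5, 8, 0), (4, 5, 9, 0), (4, 6, 7, 0), (4, 6,
    9, 0), (4, 6, 9, 2), (4, 6, 9, 3), (4, 7, 8, 0), (5, 6, 7, 0)],
    [17458278149730832559390527388877534979405864207711008446040948830967280022867445136965753145606633146193630862284936120413126566447340158429648569260576199942899759120384,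
    52329847352076495733948640675185603713883301153488116007792012606007400906404588625868534290164474044139073463298525181412055477902934651885911523731041059344257511132397674265570371436167808074789477956572306577215685497291121386921694212,
    1924996942291584542303118735954272679534660097437919119009051504423188730953302240307837167305987583607362370600010104491081395055077623880573928903593855165220542273792943372799851869230707399152114418543238564107807448490691432778688386771880729270223937373518112068158906109433139635484,
    907325278783007227567360560076498915854610042755938814659974722083278993892702216008872386787979922778278153197998618889137337398188660960962144998579828164469957175165230905135859346272958406809781464019189504127040231964127349033151658542456705180758685555021148764,
    216687063301684141486230779948275587008373349415633673568995082069515501853032889531243581044990896175828751006839358401274292072733114915114256657261968381584692364797793186489274310497140001028667813233116961664978404758581093093580243086,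
    3809854707292083716398659344251308345616693750616354721173051328900389802212063845088863251641453467524499758374043708941081333727810849685943916840778979363404452289633886957047127411889978256910580694759549302765585595526326225455946299421510231012608485474978891466523,
    8425271897467680257862150080605873362893683730914351775003533100730043532378413540163277956943282463002465952109072637108132195924066445051852201489155049290039584632450397730786991461750390539635615054305106332973644889987554379360377294131288683979747658933555705388,
    217139394208929933212098945202873810329976564066571652949608350789341904913322133835416204386090927451616519837381130283870198166152040796328875370136634724280082191991805477362431363427994432668803462289893904022502837466364214225693586333727215052685706546938002712100623235226847478541231810355806065817875518666533522197801748566864213243671145341269164113964730071463468,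
    913461753740453627615329278683720305269899079975995462656954557988357817265377813357372041417095286505860542161113240222348460464959418730198537796404764309972872105808259072070710347945459469693890226700609136073858872763598498423065768015],
    [10419180279915442142168567693088544989413679170674090840933120206200346376181433191300350574360447595000550560576351473309509504155329806149389759617806980595578663465377317214081962059595206962669712981142977458250176012922811573685525047622,
    9149594032771127217481673767698887534541438262131558686907509944208646569190266097070775185819788282571645984655686316342445761525806200130296875984596043411174943488948044230641486655934102395949751284032346390546471837459562785996740905717387658524451453927635593,
    4536119224927296950886451143178860224559434931099336565087954015231474298707506206195155787879534458281003837223719382730895857510440734168145458943568702898882876378812977960444419148009217189778808734243178958287950275321642089217579102092436290763874959171344764,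
    966799389932102775474068681325526484531742795874160889159695310539872486341307659388339436410588882166515089654546682589937648483529474630674134649042742413507808287395077000077611942046572208104798193301358756030684806620629280924891244604617850909,
    1058439409917584596426424633378030847029422794932284387179486547280862804076714599566665997493979346534906232459897992832921624429292419185025388664108901911141016451382368445326516848254489660048350469316676409122330252959745860924196027215141822596097420,
    26299075574015553337212050876173023129821374349785896156025520504839223837075766892364835872122236756905356186068186635510083397398107923479972566971965845166952434381855027501762340797442416759063190771399976311471208636814866355465538652751289616374345,
    211544894775643110942358521011793646996145265751204971285667424556543387146836828520699562290980018611154857003197552874917989067858910041758284203171700805561498825292233042256727669200775726869214954095962833167589366905948576216465573896750569219046793232518301768772172,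
    13391253889403990621816285471795921928962344383777240844010687500705597304115147437886802572839720900764864691607688494906578338335530269376562935759864307335819677872308779575565687479103111002775493425231651561734984490577419914040124642538565215547780721348268286,
    304332319795932692483942215906935504902811845024006842889830825400527148758781861718714939520570350268159992471760986904898314827626885628687875074798011641093217083218126714857278917011299853614619341755668514133565459186712131672441360714500468464292412348741,
    45706351705546209564619525548533214207004206723196380085274711230702505092068830406583389622947626600794194995322415052265941635742034643246176352244046398019163000945267714921319383195273330270859027156886742122905118945567533096198234820955533770814,
    1365800404284053065362154214395349254642277170581534],
    [6445563363732077117773336717539351985593022468, 3063524403793505592322,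
    31242289252436996622509792002395670245462698858982168869234693, 6549512962961448713730,
    32833781226119314629751399344923490727163324804111295636878134349058724847520425942638819939792488996958855404139659207925243471506437,
    1650017257521252108570893186842989202274308,
    7388671090689492988490629651374712927353814954303792504301265493780995,
    41754006825516226089638337883765284470269054636008119495062540405178682446540454305185507647407270940607205682966632955274097176153820637928907782,
    30437446066698520236842293503951232680777478586563534006555653,
    4469094737345206892534927330645015469452590491851446347579348926674752048648,
    131777747062621656767633177940124164,
    138423794471198913823431715732438659531441524210385205312362491620549531760682870243810750410457660638290821449279382791939852079303942257527705306513195159196759704816654044402960112349056844261832563226885397662117670022196690701061006409792882129004553,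
    86581033731011504133440270669613093067827946661154039819948371228746630332963173444094743570441,
    845491424468654574587730758877277287717631530711908222883578456573074044355987153886153501094513203090810749956,
    6057045348432688849257844792409519861142576879450204433410, 432472328665846274,
    2951636704513005122050, 504491407986859522, 497238338912088920199941221309131179771290120710,
    844205871669220111663544322308352673626293452348792325, 1089749654785164834306,
    4132084345235009732098, 398522209424117008109534791176991636460249653188889628166015491,
    24168866346189389880460806135300, 1270211087920870914,
    1546758941027632476606272998981868773724676,
    263026934206986119318011889114984843243860637773263755530863154640392,
    5574367370724947661973637101012046657029,
    1775100054936933130483566345325943223786178902846638757843760390284636042305539920365785109404086274615182339,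
    1039988097168367706136075714381109784496132,
    39874761240828508322950930941982693185759267726874648377542974277503096086327851723104567051590814655638161654089221,
    641769968587922687094160573380883501107079784050227841631933600365581166343298675660038257142192452520829822329894915959919075736413746072077293538278406,
    8827342078350229838924037034084222708512444765812088145925, 376006637261977686932232195,
    7253637920986487188327483177111812311408320933331266305680307291597241830366769371979349436325670980026261354833183351216784332604706187525939893304162249757343196424396967184357618988249534628699153423945697405400977834685644014694149,
    544306130980839794665114248323699176051775186919874847370783198218845020735866780142734466859203619009029,
    39874761240828508322950931769344098439260481424300811257339833483926009669231408997311098242249039545827206370231813,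
    4861622490613076189298649805244495926636075012, 128213454596811831289858051,
    7575988995033061647902332531494801511059506728994938635267630790890502,
    362708459082886280994921475, 2870729619933091641889912284689574320907669291273075857413,
    99880080483098825490267053435945813455514138822571008099297226029743381257445293748542668734467341946518822321142724413589851090951899585672448028693591911596201966384615198548499950205974006112224268,
    1375592929090585417041770718851186614675255273588651770117144302847979629666555492752050345890013801146000584918682900797609760508240066198492243251616040951146073984290312098374540382099079600589342587729223400636624425514941394447832836345739030602789911154894855298347999268607929352,
    4719272254091435762919441213012044192287009413248081382466932664133216108142783730665336773706677551579392582294813196670263421250686162721616970163207,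
    42549253515714012886292832907207423709489327833276617912191803217924,
    27671778393486876547300352077632390147,
    765708561329622760285557297024961862699315028405026653219248648497100983733162175336664164019573642568201320938246340945238822470398796344579284089293526019,
    7740079265860855054332687174668703967736758790348237166097097819236591891175870434421763,
    708992609096909087880844744357000308058916623745519091432051929014020995279383191005195266,
    96796386833155850021817982699343926108752433824075009531738162340488523318275,
    4464661862648711310850, 1454056088490679666881172007595191045,
    919472323830834301137908142204777696142834580742,
    1125473292208337494487050807081489286786111504334147845,
    615365398532098096092142335990015051138351713308017065236563308437064339177495159947404033287,
    676390008718640949856917026778127299458057247541774703087195817642847775461283334,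
    519074856427492836284617782135966098294050723276388835280210691850501,
    524953733834023273593146188118805201712660328758068723378412820194759042055,
    6592136579708553269316812767739810894027898003904898658212981147152258257827557858624518,
    718216916454546640151739648003, 256393541573518407267018755,
    199990308993792522632980781598365046721821209094,
    7010876851032325780061650579407512957419291333556806274874319848711341996552,
    7029952805467956705794, 7380584193386049553794519455958780883337097313163721990,
    519613508443903697929920759768953801497552968453519055958513415915840413191,
    934879794679339874821146131757500664289806786280402837087409872985252514654589643934884336827911171828720767499148479385864,
    2613331262250171163132464108539005856166188735058354321273918641670, 7509568151382727326210,
    48383756871251682297634329643621348359367639521830702131611635292937113255643549202671681648503820325506052161282682395040164272347892613796531785367662886324832262,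
    12157938731697592732402588152239935812727584783025787991788822806294811380270212743055177460741,
    1069349641731023541032502601288370302333775858901880756393882433677219597872376494819935882850107880577434322697393455425480906063545669470952557935321303061712907268,
    11227067731951347475995789687606888252166462932800259,
    647065074309432232353031263427113923268805980012843177853801736460290,
    134968491296455745760118458370,
    843568126373699892090586717879301919974389959857660108684907749758484378172927563535503831780899992167467564207157984221236783382296579,
    10515367213246650562839879237127216526478259521847893497849773014664195, 185120490172671085570,
    670276307850722267752819127061271802150796347120831865212114503410987349101221366490114,
    747342753734568104105586942820894213385564406562353360891634179,
    177865551632009459892054338555605093528090433376230763416273268081674158288752827231869991280671785866342471999116780730260996,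
    7672806677786054718371249119567543104227517956, 190725616006931750617521385561322960223748,
    70637520126492324825041268492611428375795117278370030877642004082373211155224837088090901697388807158654104840549575102358354661450087387332301059,
    482470420955587530872619423220056019768123442535944,
    14746750776683180869257899004763638292004785515207807585649254231983807683495655806059776379252966079635341321530413818418167692416229094270327136280196374599714241538,
    3799093099598222313177951297139117538136516178432489760706420708884952045364564286660005408074296190794999315641228716420618978022334876294456222458881,
    2789251073, 3040913409, 3946884097, 4534082561, 2000692993, 2604673793, 6312449793, 6715101953,
    9491939230650818305512969847495622741153710097962317234104165077048882815459150945222240787418662645615026068607800615526616548354,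
    1681722923736453326330881, 5020599041,
    40767568571264665417816341998827807176409058179813108760854563256537942178418286728945526117404718288726186643012257398828962125261146440705,
    7621078017, 24472287463425, 123648],
    by decide +kernel⟩

theorem refuted_convex_eleven : Refuted 11 [4, 3, 2, 2] (convexHyps 11 9 ++ leHyps [(8, 9)]) :=
  ⟨[(0, 1, 2, 1), (0, 1, 2, 2), (0, 1, 2, 3), (0, 1, 3, 1), (0, 1, 3, 2), (0, 1, 3, 3), (0, 2, 3,
    1), (0, 2, 3, 2), (0, 2, 3, 3), (1, 2, 3, 1), (1, 2, 3, 2), (1, 2, 3, 3), (4, 5, 6, 0), (4, 5,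
    7, 0), (4, 5, 8, 0), (4, 6, 7, 0), (4, 7, 10, 0), (5, 6, 7, 0), (5, 6, 10, 0), (6, 7, 8, 0), (6,
    7, 10, 0)],
    [160400923446271989464873670639600614550437764576658984506953597971692529698824759131055890285495686058309414572988866863024478625456479305071586645001934622439932346564608,
    1161725073925376665594129380252189757491947044782736210407835992807497886098589560068356384673901656572780180042646051631711601573313477894805960649806430507753018670634367093610878373246192098972899522369088404471071542548510470,
    28826149578933408173393853640598233029892280962782264257169010248037900823193029200821507628195866080421492972840277633068402948311846880409247581802039945372524558360422137575231877235033087333021412594831746445837111692918681456756055563362956515676350570324005901719112124827578890,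
    1927255349355946474130153251760972907846179508314265955168845838685586378791059450150971937764187667687093319719553980007769618672796868432704880305591915218704447619008559165125892840514984679436673671428524374815174781412133994389620568744841705109164500063381213801497587946464499224908,
    17169318408863195317849729516530974578747136012973020961715227130216463572110153430214663133010233902293915232940634962261917673297925414149954377772549546031263360668238565298342718140192384725759569353763544200230482274829538314128866642268812,
    1307947362109635967299007110116114331888964067646429768182407106383532877788196443188816377786937913440993099204073048538343336479457845686482332091179648739420370068349123856666854991191074828579308999184961090942942147008309366714999525630,
    1530760780053345717071869658921075369847810340692797844107415931022423387065800508320466995587230937730172376214022248931061650796007507017042365330796740907225557111846059369081450907955723186225908441375592825671165225669353597801404198078810885045035927340384568122760905478567958427404,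
    744760801932846491620109229867683644168238812090536107182799589717179715438525851632074055534014187817310277625717478040899539089610581153277190881860756205677990386984743249543754236203521447144209178323759441074482143412143895812062874318923761491365902545818189700452633772230928053804,
    72121928967993031695345112187352569104019773923484070952345506797342704113787567283096194449742927993319991694827314386534336762823747965615671933288474983075810973277723913780674010517588765518583162435924684831885453266135538115312726436376296892154048057708,
    1426138691529733440429687957352210681862465867321679617460193582584728779443143648991051636114987772664048294350135309960970743987021733333772961803590956342619655747645166862575056779841626101996022150943423588667467491814700753349152051222219583200787138614617919404237741761611275069763748731362933829822861047434397239473409429964140029497087275,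
    145663666317379535836134042401522412193846935838603062356445008194217701414259519611598177708391395829957258008132553700852791690649867738587501181664712276795680162635758651073205280571978900721876618698331293575912880504806479193134024631452592544470553071066619983,
    90091817742752075100446],
    [137091071706560158380824814386885910694793600863829831542576531308633528255768275398932333792575018801914511651221222689928662512200470514296007037170855159396164091863080916995219909256587250880789395656876279312357735714718632260214362514216531276760815737,
    50739356058647733868342889711671017180425949338690607314539103775154616221199988742345676183600526276214777460352643622091518490501393367006211302448531110285475080786049705428653029048301777815416094215101111733865298809283120994607636357229375892919793609109509137183,
    10110295752647857219563446674218645752670224501222716487783474043315294484614515642193472383458733364051459710367185096065962990695953109288044902575580472813457903873122163013057860958158031502097716663846921704518147442816756301908482063458514442608336987427,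
    555066033846519810410670233056473482033964019409674168421650450400650610113677214995172193951282299506272320687473752531672104407913133221407786686056188654237719580874330670902998024566063539677766224756154174184551661092458949013247889469553149310499,
    252757098428360470627206684740169136329033200597499333579046391635147587575130241868484829869702201112454552597818037683127698107397389410327929594078097704078983541814361514019841606664723279020884705020541696044156442357995386001594624881432421611610900227096621,
    19384574285574363543697760877292193781214144271521229125413161861117484627079777286617779308665651491081405629366775577766739991160800545307344968730730262924471804232591361718687512647724063887115086974022219291252969186949456470726407899591088474117716372802187710511,
    114153670274991279428915334362122817995173099225044711332453975127367765487045772878360073164243070343318634164470937843459351355683354168846994223922798481642810262636326082951171551470458264935054081057420291229002556762618798013662898232160355621289738375297692,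
    1152482980646618552776735868627050752602809049912119950187052464470869030923335796756724370749284154318737845930072381881885548350606768849703283463704802358496021530150825706668805057044297463251383586152204145196961566188434043071800497636626525406134387531154134508538929503,
    13648637635055303021567107923296277213681442801120221158370620654143811651484971686873010965984469386140445542276506562072389475185320617599067006175763202924521361048011028755776241163398962582196993543391705014041227419736765308457340933822979280658638026409148411228671608355,
    12624478834028597795428647193406530343554923460646129479853757684769282536684777182703784371673815980638113545253488642139755289392937827170852472123601022496447580537721203292538611690992724686970341082464319624768015267757154245074453453325342020870341043247,
    6024828651772092688290259194831762770504589720104701008034089628323544134686540640767889966623732822984864849617506980297039625825352769051380050625874863716318010929804829262154800248221045344343006294273994403168128807274505098561865844473382096654448369033786389263923,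
    549983823278414769883220007547045704177683171900622742611147708880589390682139348350529361823021819767416138801521411881215166412768682010568877994593995329216997583154717289862497293554520850165878316629725496090044274892662472130250103896159557756914037767395259389676117,
    169800782518493945262037382938303867711716765686745487064864669529869476396497294962147271345259680603421081348112621921174874311809153935305488948078846929320450883544044554824480354179045634274621202810683202207087256517049768236007898947316193932,
    1080869735852133145390256473523614358779873211542684508338433825491759344115928884108127520768510402292625609508625158506945330703104078859737187907335026042726303797872156554336946030866697218306045067881761420],
    [752765087189795175909098525220639860847609317976066, 148705567402413343146805251,
    8085171155795435814161410, 143083154298520709139830851211619767483124997634,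
    583484906901985550830353094253666240371861811551672617121835552868955219453307251941989974516970587617041965552757946711762450971236682044214152065849653065224808793134020667616308991378438,
    24186207982124130338113539,
    4474411703337801573744190702586589249533430450201109970243539353962477404351555061507639352990097378031927222876583557033131013,
    10108923941386336168450,
    223884045614350186369783431208802128749717525732977515724478901068534788,
    30072040161887167246202207450620656998786243247171077822858150703407119540793677261136903626356331651725437261816048928624672549570935832530222903359363700449867130720578052,
    967657435870059987558057919262905248093854095056433526850234785182814427429199411760497220474936323,
    4656070346900647472406841883900576608919322054367515619779284586889010042879589611513513323742413562323504442943492,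
    613563332314033936814044686776834,
    1625707905468575267080271010412113016090748658287768024364076293081034304142666557860567500098178419843220903922642837578419215922302083568419160724481646380953625213432374597945573714459682924433503943223811,
    20519318558926325976152643691521406130581275648671502531872744726742628477504418347185041282230086649227460556176916849924508495391737890583261727734483542435135903194289463657475,
    592903485128465479625307515377188784176216891499997383124762785473663772760500230,
    90138111379369211091355452465191243895024483629702141870440376524433552391,
    485701576656014998372480191180476796507009236845072089174689053761627990630910940652084599755041758794687606413258459359092224652969832657878415144135038786206639719008960242728217640102365445,
    5601190971840433012332790641363073611845237283353300865704784674000092080884600062194650408677058566363368914423917862337538431865348,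
    5439913148689429053726248306682790284652373528205863754763356509957037742881070589881382074917924181556817352962264607433836949347696499323282699,
    37893994770386060011385090869850241216876034,
    75765050812095226566606285181827676574766659855340288590083,
    348882765201058255044114976480593269053693776580006561349637380080214914201542055202720175975291100623204689937896041025192436309705851397,
    669022696407623497671562784567579039859196163,
    17937786891398626561235112708052779744810767945162545830433831265087548618756229658267971252386623943969187873246534206571024684050190471591199747589,
    890409705361348054460855132544752013961687563635774439412366278187161015934146007134808294350762596565695732627173122555450750655286549802671621,
    199218100707396399140207486277442910977691241613682049829010622541218874383202563586,
    3819588783249120092674, 2997408496930344487735304570268490828721093110787,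
    2263128574260368063401495716355,
    5632368247567832914011636866376067777520277610121465693423089156,
    8459072658137269495347260696924236849161974456552531455497789700,
    129075205354877769350920853385802154537741877382030834025475,
    10951145806710435278309945148963344768495070102459834776511733316816502348775690457415493971461,
    273456416778959958490308456572656886018540547132884194216774473522882864519752817919441650901718170629,
    4242146084339414027300262743423230183802415615570520109698392351527333918988125796244166661,
    3043310364136620372323584825815950467707604847619,
    6437497059755415902359483792270606755487344747453478269157224181561713967402477481387014,
    7305226539857533234178, 43367971508480358340206745568069850115,
    6306873644679874361240919983242437392703847206482730435448289725767863671795953690208107619127973525746111972597436482653670830124927488445688034176480864164879092344297082330987672654855,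
    2860927944472480955138346179952129647242217823238, 1588562773644876053886288900,
    3927102493260086879981777800264475830847536532850862193981495187701350203363730809036184255652139367134869591655859615199695037625416515105698103693539684019156138582159173638,
    812805829850343871923404007124113399564944818607109,
    11117881742628373430627868060995631490589999056932580730500802687535952558482023249261793151018556224410708109561613225537087468748352821475814635403644709932515787125976432963957561306053383500254394840493270719567877,
    149305789668728221011266412072856232224080468077633137275874477943627627150669583859700047418749912232492943784828548821401799603209276999580926139234963293903140753548438205294414942351410181,
    687171566668247204619049661022722,
    694761563034373219056721689019933395428794965134540326244626524540263796447007811621524990598852646911001608318582997377191022414136851346307739592255712523873974279,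
    1296929641088377009217124725120182137781114290756318706333957980996094541156548265967933496754517605464699056680053427480411161425432341094184957415189139356778810247936998173551798238881798,
    80828426564547397092408317545834131148704194904021211363984049289009637703995769609148020888246409661405460987873253251914107067312248974600133202240502859253414166255098848165342432774,
    532126326668369253540519494408053376040351231104996499618367347960474610109460097186277674771306541167401144008971542090757,
    1344754061077795699173189810757483628423707069122708978190267263510147424902171962515985353616435366489198952453715211541612155305761677094701113621829656768270203174549426988229100548,
    629538482816367949381141305347, 32648703491237710315686915,
    3103625543868625004212267790704974114386409722223997661328481219753182627207114446904252424,
    5550393077654103566664188651108976889262969317220818632458394814174747658040558300106667055566799406812078913428149131202151735469589137767356502498040124272718785918228064774,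
    22338198408448835346264178312877113887343232483276361744204671572559772302791547492049215334132251265786389485842098161342613683146253827850187513848037153091470957951050341280323230176435709076010751891407958572460647688,
    959358117394934906942350592804637696276869601346864726918580223588089093,
    531622040091760174410311974745506065864214150479871581051781558778315360030854267863290190975811803314456867619519554464821290781238292271803237416139226601698720211133712737117640665498090226936853608398528760499070020205179912,
    248648461520545121635372154774174928698079593284364050600989900569846616741278297942474079266839247739687313984742287485429146508947889650758574520002862416398747147036632783933863984087448298058081422113620352169868411018099047736891652237639408789991606368803361445132100284938584399714702586813507744864262,
    16292380277160865837164358011013036926598149, 2276102401704163150231833463477897295491588,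
    43224559075720039955796482,
    56174261320093344234112308529234716984787705018277750658646476966493824360496642,
    8339828828161154721422649540609573165852978926818056607234,
    817443088746125347593803723127853547117959606371741244900419841191426,
    1581017493136272699064187052465571757554066353522247017793725517056629733148059784545973641766209858735205216727617308629415285331981242487813,
    686788479759440114209015617676886089899147832461004663815,
    85707130040015016944411561539411168336366644694288461207716946358941943269409822550241209260060271807753152307758161228804,
    10840710570456230712567492011476689581483517956,
    180507626892052861246293993955068741048504648925537890605312223669869260863494,
    6118863040110351597127842041780637691826214372834312089962256709966752276504193267979630161399886852066736246479288931630342,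
    1394651412246067657994947868997368926926556966907756995784635522821559390715465450276609667392942518261058230224626439912712,
    43564120561800306650892695633869019380520450,
    110661880429452764557485901562056513747924687434611674156035459373286187369939558580054817446127350671823111,
    44339663271751517614324918959198306377882489966904459212887511096583,
    37689021570418115870707056581425624638762069983404271324578369668492614974172501670948859398,
    4913367052868935042225265452071005328898,
    1314443393083052934425728662433406054301872818257975212222256625975843652734067978588767057910666421150389332165764227985928,
    2559104500573474438853111275544438051731051677301593216895842331454819233120123650954650462279682334353685271836386893566835036302536959831350647882857271493401348649477234005333484792484411999474988599613869421365025612181359041530515201696553916918958087,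
    6108510653539875120422747520042163980973706267266353414493879759536988282021421572,
    3506206744904855453001460053708687692186340839370334458107551872445970315765631522057,
    13560991243844831056621598370603436709757662350226062316914363317568240554628101,
    16784712713922769223648133268070880496583600850960728459676874249633238577701992326518790,
    61199322945263248735125533792238648089523858199934214315156359383047,
    26329935229504278549223565444822070745779874158914233666752378544321427933245772275476209442610405617607508287499197030509967426253126128033604742115835491177028004854058500,
    64840766941474554778828819826342964383570890445954870221638883593435734604308988999484244293062531162880446618644662036713212508144628319462783997518367926686156515124572764283158498119585092322298413934422686708172458822401924801273727394934937174891339385075003018419329910056295618569,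
    3665966917005250141388477345592927800415557712014659652525227394151773362021988026739386924269094069257,
    120801109144049082392214408522076836095128625710490201257374587103090799176816789230798804609772954862193200785160887434351444298949840574209062686271239645760079878,
    471029401220028719343557241241394578598296163959390660108249094,
    9798267004137117651266668028151431937626698474882051, 285314185000927081638430723,
    2291118141000601506112289831316136144522503803577524873955752153439979718661,
    883860704351529859299676874717524823201900826541378864976776198, 392908582946629078992586755,
    35199493750290177,
    257645725389458071105791105037590797545910790176674633240854722515319358066208903465409875838982,
    123569647281982209,
    26629979404925925937931727649243781175031505455079126630260106928856914686419007260845723531557667672938524271939644063517934670631029897909386223590827842934344262231286788,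
    1348760903695537148468791502977980229319993293826292984494932690874691093206520540842080995253853927679422333112197687705631690325398170557828559961879555,
    79379432436892624534179341719114265105686812011566109919455727818949144657985238068688392183067061904176351141889407584099317800373872491607422681668952771705052945720751060735253507,
    3716771721064198620552259327302512860097417594456077526193225237981790813864729742827774537912367174013834545298360223753178098521209209737026559770855377328240900933407358977107942548376343942179419118276640273963483037039503959730500574252044607647287684305103386629,
    67658817477861029793208578377061383758360062516258584425004744944149003778077889743745734443193124613179710456932217766411472089380905543782474951196306742919716587590733341002946945204372034565530438152317732022690835297515679293630156224706153976015521132779224812806328809448452,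
    13019242262962750192538522924870791663178026346272772878782263386269440436262505724591807672137354493813443708155880217965316846726569954433865789069276805779578811489921682658911042906933321694461322238848535767327189119485476771136981401983413424471048714932217271662592618221013330590728,
    328035126177405811719371446705356289362506888381223313384398216577267916159391525007878950782979,
    150174192735425550856047658392611201962925743778280866841950485928137499593023557204767519390693163956533202344322512486688749499350381414284489608892376764067710189329706575741307089105741897175613279987141032804618976963273550510209099467600325408872436142513878020,
    4099344970091078633200027103289503478583093561652818504012396306410530819,
    11441174498900164609530167066760590260147630285137531356812146963726578847817195692522499,
    970274380132941293829978048601229695608649497348591879172,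
    12492418115865455792778419500239698879637501685770164052533871466732440409976102146833143811,
    54952691958948950638784605386966813729382860549962840515058690, 498179362803486329858,
    46028842711291610161838595125706524675,
    248264283020493617316848857062298011947853060175220110563216101779423529483993561464931442775043,
    22870582715775868804762125477375733845198267936745432607968096384712726531,
    2655543560322698163035327837949177308371872582649393123984388,
    76058707058177200449195002193103460895717096450,
    852423166882678217336262684143377454549288519616122761306707381349223261812904278508766688954047491,
    529143168490213418959716644053627227752540999277570, 283340763510926306869030026769105710081,
    2923455489, 8611014401, 37324528316161, 14959484023713537, 31003544423425, 32129457598793729,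
    4131427329, 6245430017, 231477988517335613330433, 7721820929, 8187393793, 4752510209,
    5675132161, 6396481793, 704935169, 5943570689, 6597819649, 7537652993, 6778456321, 558157057,
    9013673217, 1610634497, 637589761, 5050182913, 6946383105, 4785881857, 8040662785, 3426930433,
    99403076548764929, 130646798963675393, 1027952897, 112896],
    by decide +kernel⟩

end FourBlocked

namespace FourBlocked

section Clauses
variable {f : ℕ → ℝ × ℝ} {col : ℕ → ℕ} {tbl : List (ℕ × ℕ × ℕ × ℕ)}

theorem colHyps_holds {m n : ℕ} (h : ∀ i < m, col i = 0) (h' : ∀ i, m ≤ i → i < n → col i ≠ 0) :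
    ∀ cl ∈ colHyps m n, ClauseHolds f col tbl cl := by
  intro cl hcl
  rw [colHyps, List.mem_append, List.mem_map, List.mem_map] at hcl
  rcases hcl with ⟨i, hi, rfl⟩ | ⟨i, hi, rfl⟩
  · rw [clauseHolds_yes]
    exact fun hn => absurd (h i (by simpa using hi)) hn
  · rw [clauseHolds_no]
    rw [List.mem_range'_1] at hi
    exact fun hn => absurd hn (h' i hi.1 (by omega))

theorem btwHyps_holds {l : List (ℕ × ℕ × ℕ)} (h : ∀ t ∈ l, Btw (f t.1) (f t.2.1) (f t.2.2)) :
    ∀ cl ∈ btwHyps l, ClauseHolds f col tbl cl := by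
  intro cl hcl
  obtain ⟨t, ht, rfl⟩ := List.mem_map.1 hcl
  rw [clauseHolds_yes]
  exact fun hn => absurd (h t ht) hn

theorem posHyps_holds {l : List (ℕ × ℕ × ℕ)} (h : ∀ t ∈ l, 0 < orient (f t.1) (f t.2.1) (f t.2.2)) :
    ∀ cl ∈ posHyps l, ClauseHolds f col tbl cl := by
  intro cl hcl
  obtain ⟨t, ht, rfl⟩ := List.mem_map.1 hcl
  rw [clauseHolds_yes]
  exact fun hn => absurd (h t ht) hn

theorem eqHyps_holds {l : List (ℕ × ℕ)} (h : ∀ t ∈ l, col t.1 = t.2) :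
    ∀ cl ∈ eqHyps l, ClauseHolds f col tbl cl := by
  intro cl hcl
  obtain ⟨t, ht, rfl⟩ := List.mem_map.1 hcl
  rw [clauseHolds_yes]
  exact fun hn => absurd (h t ht) hn

theorem leHyps_holds {l : List (ℕ × ℕ)} (h : ∀ t ∈ l, col t.1 ≤ col t.2) :
    ∀ cl ∈ leHyps l, ClauseHolds f col tbl cl := by
  intro cl hcl
  obtain ⟨t, ht, hcl⟩ := List.mem_flatMap.1 hcl
  have := h t ht
  simp only [List.mem_cons, List.not_mem_nil, or_false] at hcl
  rcases hcl with rfl | rfl | rfl <;>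
    simp only [clauseHolds_no, clauseHolds_nil, Atom.Holds] <;> omega

theorem insideHyps_holds {n : ℕ} (h : ∀ x < n, 4 ≤ x → f x ∈ tri (f 1) (f 2) (f 3))
    (ho : 0 < orient (f 1) (f 2) (f 3)) : ∀ cl ∈ insideHyps n, ClauseHolds f col tbl cl := by
  intro cl hcl
  obtain ⟨x, hx, hcl⟩ := List.mem_flatMap.1 hcl
  rw [List.mem_range'_1] at hx
  have := (inTri_of_mem_tri (h x (by omega) hx.1)).1 ho
  simp only [List.mem_cons, List.not_mem_nil, or_false] at hcl
  rcases hcl with rfl | rfl | rfl <;>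
    simp only [clauseHolds_no, clauseHolds_nil, Atom.Holds] <;> tauto

end Clauses

theorem exists_append_holds {α : Type} {l l' : List α} {p : α → Prop} (h : ∀ x ∈ l, p x)
    (h' : ∀ x ∈ l', p x) : ∀ x ∈ l ++ l', p x :=
  List.forall_mem_append.2 ⟨h, h'⟩

section Lists
variable {P : Finset (ℝ × ℝ)} {c : ℝ × ℝ → Fin 4}

theorem colHyps_of_list {pre rest : List (ℝ × ℝ)} (hL : (pre ++ rest).Nodup)
    (hLP : ∀ x, x ∈ pre ++ rest ↔ x ∈ P) (h0 : ∀ x ∈ P, c x = 0 ↔ x ∈ pre)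
    (tbl : List (ℕ × ℕ × ℕ × ℕ)) : ∀ cl ∈ colHyps pre.length (pre ++ rest).length,
      ClauseHolds ((pre ++ rest).getD · 0) (fun i => (c ((pre ++ rest).getD i 0)).val) tbl cl := by
  refine colHyps_holds (fun i hi => ?_) fun i hi hi' he => ?_
  · rw [List.getD_append _ _ _ _ hi, List.getD_eq_getElem _ _ hi]
    have hm := List.getElem_mem hi
    exact congrArg Fin.val ((h0 _ ((hLP _).1 (List.mem_append_left _ hm))).2 hm)
  · have hm : (pre ++ rest).getD i 0 ∈ rest := by
      rw [List.getD_append_right _ _ _ _ hi, List.getD_eq_getElem _ _ (by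
        rw [List.length_append] at hi'; omega)]
      exact List.getElem_mem _
    have := (h0 _ ((hLP _).1 (List.mem_append_right _ hm))).1 (Fin.ext he)
    exact List.disjoint_of_nodup_append hL this hm

theorem le_of_pairwise {pre rest : List (ℝ × ℝ)} (h : rest.Pairwise fun x y => c x ≤ c y) {i : ℕ}
    (hi : pre.length ≤ i) (hi' : i + 1 < (pre ++ rest).length) :
    (c ((pre ++ rest).getD i 0)).val ≤ (c ((pre ++ rest).getD (i + 1) 0)).val := by
  rw [List.length_append] at hi'
  rw [List.getD_append_right _ _ _ _ hi, List.getD_append_right _ _ _ _ (by omega),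
    List.getD_eq_getElem _ _ (by omega), List.getD_eq_getElem _ _ (by omega)]
  exact List.pairwise_iff_getElem.1 h _ _ _ _ (by omega)

end Lists

theorem Btw.ne_of_common {a b d x y : ℝ × ℝ} (ho : orient a b d ≠ 0) (h : Btw a x b)
    (h' : Btw a y d) : x ≠ y := by
  rintro rfl
  obtain ⟨u, v, hu, hv, huv⟩ := h'.exists_orient_eq
  have := h.orient_eq_zero
  rw [huv, orient_self_outer] at this
  simp [ho, hv.ne'] at this

theorem Btw.ne_of_side {a b d e x y : ℝ × ℝ} (h : Btw a x b) (h' : Btw d y e)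
    (hd : 0 < orient a b d) (he : 0 < orient a b e) : x ≠ y := by
  rintro rfl
  have := h'.orient_mul_pos (a := a) (b := b) (s := 1) (by linarith) (by linarith)
  simp [h.orient_eq_zero] at this

/-- The points `a₁`, `a₂`, `a₃` are in counterclockwise order around `a₀`. -/
structure Around (a₀ a₁ a₂ a₃ : ℝ × ℝ) : Prop where
  o : 0 < orient a₁ a₂ a₃
  o₁₂ : 0 < orient a₀ a₁ a₂
  o₂₃ : 0 < orient a₀ a₂ a₃
  o₃₁ : 0 < orient a₀ a₃ a₁

theorem Around.rot {a₀ a₁ a₂ a₃ : ℝ × ℝ} (h : Around a₀ a₁ a₂ a₃) : Around a₀ a₂ a₃ a₁ :=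
  ⟨by rw [orient_rot]; exact h.o, h.o₂₃, h.o₃₁, h.o₁₂⟩

/-- `a`, `b`, `c`, `d` is a counterclockwise convex quadrilateral. -/
structure Quad (a b c d : ℝ × ℝ) : Prop where
  abc : 0 < orient a b c
  abd : 0 < orient a b d
  acd : 0 < orient a c d
  bcd : 0 < orient b c d

theorem Quad.rot {a b c d : ℝ × ℝ} (h : Quad a b c d) : Quad b c d a :=
  ⟨h.bcd, by rw [orient_rot]; exact h.abc, by rw [orient_rot]; exact h.abd,
    by rw [orient_rot]; exact h.acd⟩

theorem around_or_quad {a b c d : ℝ × ℝ} (h1 : orient a b c ≠ 0) (h2 : orient a b d ≠ 0)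
    (h3 : orient a c d ≠ 0) (h4 : orient b c d ≠ 0) :
    ∃ p q r s, ({p, q, r, s} : Finset (ℝ × ℝ)) = {a, b, c, d} ∧
      (Around p q r s ∨ Quad p q r s) := by
  simp only [orient] at h1 h2 h3 h4
  rcases lt_or_gt_of_ne h1 with h1 | h1 <;> rcases lt_or_gt_of_ne h2 with h2 | h2 <;>
    rcases lt_or_gt_of_ne h3 with h3 | h3 <;> rcases lt_or_gt_of_ne h4 with h4 | h4
  · refine ⟨a, d, c, b, by grind, .inr ⟨?_, ?_, ?_, ?_⟩⟩ <;> simp only [orient] <;> linarith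
  · refine ⟨c, a, d, b, by grind, .inl ⟨?_, ?_, ?_, ?_⟩⟩ <;> simp only [orient] <;> linarith
  · refine ⟨d, a, c, b, by grind, .inl ⟨?_, ?_, ?_, ?_⟩⟩ <;> simp only [orient] <;> linarith
  · refine ⟨a, c, d, b, by grind, .inr ⟨?_, ?_, ?_, ?_⟩⟩ <;> simp only [orient] <;> linarith
  · refine ⟨a, b, d, c, by grind, .inl ⟨?_, ?_, ?_, ?_⟩⟩ <;> simp only [orient] <;> linarith
  · linarith
  · refine ⟨a, c, b, d, by grind, .inr ⟨?_, ?_, ?_, ?_⟩⟩ <;> simp only [orient] <;> linarith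
  · refine ⟨b, a, c, d, by grind, .inl ⟨?_, ?_, ?_, ?_⟩⟩ <;> simp only [orient] <;> linarith
  · refine ⟨b, a, d, c, by grind, .inl ⟨?_, ?_, ?_, ?_⟩⟩ <;> simp only [orient] <;> linarith
  · refine ⟨a, d, b, c, by grind, .inr ⟨?_, ?_, ?_, ?_⟩⟩ <;> simp only [orient] <;> linarith
  · linarith
  · refine ⟨a, b, c, d, by grind, .inl ⟨?_, ?_, ?_, ?_⟩⟩ <;> simp only [orient] <;> linarith
  · refine ⟨a, b, d, c, by grind, .inr ⟨?_, ?_, ?_, ?_⟩⟩ <;> simp only [orient] <;> linarith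
  · refine ⟨d, a, b, c, by grind, .inl ⟨?_, ?_, ?_, ?_⟩⟩ <;> simp only [orient] <;> linarith
  · refine ⟨c, a, b, d, by grind, .inl ⟨?_, ?_, ?_, ?_⟩⟩ <;> simp only [orient] <;> linarith
  · refine ⟨a, b, c, d, by grind, .inr ⟨?_, ?_, ?_, ?_⟩⟩ <;> simp only [orient] <;> linarith

end FourBlocked

namespace FourBlocked
variable {P : Finset (ℝ × ℝ)} {c : ℝ × ℝ → Fin 4}

theorem Blk.blocker (h : Blk P c) {v w : ℝ × ℝ} (hv : v ∈ P) (hw : w ∈ P) (hvw : v ≠ w)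
    (hc : c v = c w) : ∃ x ∈ P, Btw v x w ∧ c x ≠ c v := by
  obtain ⟨x, hx, hb⟩ := (h v hv w hw hvw).1 hc
  exact ⟨x, hx, hb, (h.btw_ne hv hx hw hb).symm⟩

/-- The truth of a clause for the points of a list. -/
abbrev Holds (c : ℝ × ℝ → Fin 4) (L : List (ℝ × ℝ)) (tbl : List (ℕ × ℕ × ℕ × ℕ)) (cl : List Lit) :
    Prop :=
  ClauseHolds (L.getD · 0) (fun i => (c (L.getD i 0)).val) tbl cl

theorem Around.ne {a₀ a₁ a₂ a₃ : ℝ × ℝ} (ha : Around a₀ a₁ a₂ a₃) : [a₀, a₁, a₂, a₃].Nodup := by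
  obtain ⟨h1, h2, h3, h4⟩ := ha
  simp only [List.nodup_cons, List.mem_cons, List.not_mem_nil, or_false, not_or, List.nodup_nil,
    and_true, not_false_iff]
  refine ⟨⟨?_, ?_, ?_⟩, ⟨?_, ?_⟩, ?_⟩ <;> rintro rfl <;>
    simp only [orient_self_left, orient_self_right, orient_self_outer, lt_irrefl] at *

theorem Blk.nonconvex_list (h : Blk P c) {a₀ a₁ a₂ a₃ b₁ b₂ b₃ : ℝ × ℝ} (ha : Around a₀ a₁ a₂ a₃)
    (h0 : ∀ x, x ∈ P ∧ c x = 0 ↔ x ∈ [a₀, a₁, a₂, a₃]) (hb₁ : b₁ ∈ P) (hb₂ : b₂ ∈ P) (hb₃ : b₃ ∈ P)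
    (h₁ : Btw a₀ b₁ a₁) (h₂ : Btw a₀ b₂ a₂) (h₃ : Btw a₀ b₃ a₃) :
    ∃ L : List (ℝ × ℝ), L.Nodup ∧ (∀ x, x ∈ L ↔ x ∈ P) ∧ L.length = P.card ∧ 10 ≤ P.card ∧ ∀ tbl,
      (∀ cl ∈ nonconvexHyps P.card, Holds c L tbl cl) ∧
      (∀ cl ∈ eqHyps [(4, c b₁), (5, c b₂), (6, c b₃)], Holds c L tbl cl) ∧
      ((∀ x ∈ P, x ∈ tri a₁ a₂ a₃) → ∀ cl ∈ insideHyps P.card, Holds c L tbl cl) ∧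
      ∀ l : List (ℕ × ℕ), (∀ t ∈ l, 10 ≤ t.1 ∧ t.2 = t.1 + 1 ∧ t.2 < P.card) →
        ∀ cl ∈ leHyps l, Holds c L tbl cl := by
  obtain ⟨m0, z0⟩ := (h0 a₀).2 (by simp)
  obtain ⟨m1, z1⟩ := (h0 a₁).2 (by simp)
  obtain ⟨m2, z2⟩ := (h0 a₂).2 (by simp)
  obtain ⟨m3, z3⟩ := (h0 a₃).2 (by simp)
  have hnd := ha.ne
  have hne := hnd
  simp only [List.nodup_cons, List.mem_cons, List.not_mem_nil, or_false, not_or, List.nodup_nil,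
    and_true, not_false_iff] at hne
  obtain ⟨⟨n01, n02, n03⟩, ⟨n12, n13⟩, n23⟩ := hne
  obtain ⟨b₄, hb₄, h₄, -⟩ := h.blocker m2 m3 n23 (z2.trans z3.symm)
  obtain ⟨b₅, hb₅, h₅, -⟩ := h.blocker m1 m3 n13 (z1.trans z3.symm)
  obtain ⟨b₆, hb₆, h₆, -⟩ := h.blocker m1 m2 n12 (z1.trans z2.symm)
  have e₁ : c b₁ ≠ 0 := fun e => h.btw_ne m0 hb₁ m1 h₁ (z0.trans e.symm)
  have e₂ : c b₂ ≠ 0 := fun e => h.btw_ne m0 hb₂ m2 h₂ (z0.trans e.symm)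
  have e₃ : c b₃ ≠ 0 := fun e => h.btw_ne m0 hb₃ m3 h₃ (z0.trans e.symm)
  have e₄ : c b₄ ≠ 0 := fun e => h.btw_ne m2 hb₄ m3 h₄ (z2.trans e.symm)
  have e₅ : c b₅ ≠ 0 := fun e => h.btw_ne m1 hb₅ m3 h₅ (z1.trans e.symm)
  have e₆ : c b₆ ≠ 0 := fun e => h.btw_ne m1 hb₆ m2 h₆ (z1.trans e.symm)
  obtain ⟨o, o₁₂, o₂₃, o₃₁⟩ := ha
  have hnd' : ([a₀, a₁, a₂, a₃] ++ [b₁, b₂, b₃, b₄, b₅, b₆]).Nodup := by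
    refine hnd.append ?_ ?_
    · have k12 := h₁.ne_of_common (fun e => by
        simp only [orient] at o o₁₂ o₂₃ o₃₁ e; linarith) h₂
      have k13 := h₁.ne_of_common (fun e => by
        simp only [orient] at o o₁₂ o₂₃ o₃₁ e; linarith) h₃
      have k14 := (h₄.ne_of_side h₁ (by simpa only [orient_rot]) (by simpa only [orient_rot])).symm
      have k15 := h₁.symm.ne_of_common (fun e => by
        simp only [orient] at o o₁₂ o₂₃ o₃₁ e; linarith) h₅
      have k16 := h₁.symm.ne_of_common (fun e => by
        simp only [orient] at o o₁₂ o₂₃ o₃₁ e; linarith) h₆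
      have k23 := h₂.ne_of_common (fun e => by
        simp only [orient] at o o₁₂ o₂₃ o₃₁ e; linarith) h₃
      have k24 := h₂.symm.ne_of_common (fun e => by
        simp only [orient] at o o₁₂ o₂₃ o₃₁ e; linarith) h₄
      have k25 := (h₅.symm.ne_of_side h₂ (by simpa only [orient_rot])
        (by simpa only [orient_rot])).symm
      have k26 := h₂.symm.ne_of_common (fun e => by
        simp only [orient] at o o₁₂ o₂₃ o₃₁ e; linarith) h₆.symm
      have k34 := h₃.symm.ne_of_common (fun e => by
        simp only [orient] at o o₁₂ o₂₃ o₃₁ e; linarith) h₄.symm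
      have k35 := h₃.symm.ne_of_common (fun e => by
        simp only [orient] at o o₁₂ o₂₃ o₃₁ e; linarith) h₅.symm
      have k36 := (h₆.ne_of_side h₃ (by simpa only [orient_rot]) (by simpa only [orient_rot])).symm
      have k45 := h₄.symm.ne_of_common (fun e => by
        simp only [orient] at o o₁₂ o₂₃ o₃₁ e; linarith) h₅.symm
      have k46 := h₄.ne_of_common (fun e => by
        simp only [orient] at o o₁₂ o₂₃ o₃₁ e; linarith) h₆.symm
      have k56 := h₅.ne_of_common (fun e => by
        simp only [orient] at o o₁₂ o₂₃ o₃₁ e; linarith) h₆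
      simp [*]
    · intro x hx hx'
      have := (h0 x).2 hx
      simp only [List.mem_cons, List.not_mem_nil, or_false] at hx'
      rcases hx' with rfl | rfl | rfl | rfl | rfl | rfl <;> simp_all
  obtain ⟨rest, hL, hLP, hlen, hsort⟩ := exists_extension c (pre := [a₀, a₁, a₂, a₃] ++
    [b₁, b₂, b₃, b₄, b₅, b₆])
    (P := P) hnd' (by simp [*])
  rw [← hlen]
  refine ⟨_, hL, hLP, rfl, by simp, fun tbl => ⟨?_, ?_, ?_, ?_⟩⟩
  · refine exists_append_holds (exists_append_holds ?_ ?_) ?_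
    · rw [List.append_assoc] at hL hLP ⊢
      exact colHyps_of_list hL hLP (fun x hx => by rw [← h0]; simp [hx]) tbl
    · exact btwHyps_holds (by simp [*])
    · exact posHyps_holds (by simp [*])
  · exact eqHyps_holds (by simp)
  · intro hP
    refine insideHyps_holds (fun x hx _ => hP _ ((hLP _).1 ?_)) (by simpa)
    rw [List.getD_eq_getElem _ _ hx]
    exact List.getElem_mem _
  · intro l hl
    refine leHyps_holds fun t ht => ?_
    obtain ⟨i1, i2, i3⟩ := hl t ht
    rw [i2]
    exact le_of_pairwise hsort i1 (i2 ▸ i3)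

end FourBlocked

namespace FourBlocked
variable {P : Finset (ℝ × ℝ)} {c : ℝ × ℝ → Fin 4}

theorem Blk.perm (h : Blk P c) (σ : Equiv.Perm (Fin 4)) : Blk P (fun x => σ (c x)) := by
  intro v hv w hw hvw
  rw [σ.apply_eq_iff_eq]
  exact h v hv w hw hvw

theorem cnt_perm (σ : Equiv.Perm (Fin 4)) (d : Fin 4) :
    cnt P (fun x => σ (c x)) d = cnt P c (σ.symm d) := by
  simp only [cnt, Equiv.eq_symm_apply]

theorem Blk.nonconvex_card (h : Blk P c) {a₀ a₁ a₂ a₃ : ℝ × ℝ} (ha : Around a₀ a₁ a₂ a₃)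
    (h0 : ∀ x, x ∈ P ∧ c x = 0 ↔ x ∈ [a₀, a₁, a₂, a₃]) : 10 ≤ P.card ∧
      ((∀ d : Fin 4, cnt P c d ≤ [4, 3, 2, 1].getD d 0) → P.card ≠ 10) := by
  obtain ⟨m0, z0⟩ := (h0 a₀).2 (by simp)
  obtain ⟨m1, z1⟩ := (h0 a₁).2 (by simp)
  obtain ⟨m2, z2⟩ := (h0 a₂).2 (by simp)
  obtain ⟨m3, z3⟩ := (h0 a₃).2 (by simp)
  have hne := ha.ne
  simp only [List.nodup_cons, List.mem_cons, List.not_mem_nil, or_false, not_or] at hne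
  obtain ⟨b₁, hb₁, h₁, -⟩ := h.blocker m0 m1 hne.1.1 (z0.trans z1.symm)
  obtain ⟨b₂, hb₂, h₂, -⟩ := h.blocker m0 m2 hne.1.2.1 (z0.trans z2.symm)
  obtain ⟨b₃, hb₃, h₃, -⟩ := h.blocker m0 m3 hne.1.2.2 (z0.trans z3.symm)
  obtain ⟨L, hL, hLP, hlen, hcard, hS⟩ := h.nonconvex_list ha h0 hb₁ hb₂ hb₃ h₁ h₂ h₃
  refine ⟨hcard, fun hmax he => ?_⟩
  rw [he] at hS hlen
  exact h.not_refuted hL hLP hmax (fun tbl => (hS tbl).1)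
    (by rw [hlen]; exact refuted_nonconvex_ten)

theorem Blk.nonconvex_spokes (h : Blk P c) {a₀ a₁ a₂ a₃ b₁ b₂ b₃ : ℝ × ℝ}
    (ha : Around a₀ a₁ a₂ a₃) (h0 : ∀ x, x ∈ P ∧ c x = 0 ↔ x ∈ [a₀, a₁, a₂, a₃]) (hb₁ : b₁ ∈ P)
    (hb₂ : b₂ ∈ P) (hb₃ : b₃ ∈ P) (h₁ : Btw a₀ b₁ a₁) (h₂ : Btw a₀ b₂ a₂) (h₃ : Btw a₀ b₃ a₃)
    (hmax : ∀ d : Fin 4, cnt P c d ≤ [4, 3, 3, 3].getD d 0)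
    (hcard : P.card = 11 ∨ (∀ x ∈ P, x ∈ tri a₁ a₂ a₃) ∧ (P.card = 12 ∨ P.card = 13))
    (hc : c b₁ = 1 ∧ c b₂ = 1 ∧ c b₃ = 1 ∨ c b₁ = 1 ∧ c b₂ = 1 ∧ c b₃ = 2 ∨
      c b₁ = 1 ∧ c b₂ = 2 ∧ c b₃ = 3) : False := by
  obtain ⟨L, hL, hLP, hlen, -, hS⟩ := h.nonconvex_list ha h0 hb₁ hb₂ hb₃ h₁ h₂ h₃
  have key {hyps : List (List Lit)} (hr : Refuted P.card [4, 3, 3, 3] hyps)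
      (hh : ∀ tbl, ∀ cl ∈ hyps, Holds c L tbl cl) : False :=
    h.not_refuted hL hLP hmax hh (hlen ▸ hr)
  rcases hcard with hn | ⟨hP, hn | hn⟩ <;> rw [hn] at key hS <;>
    rcases hc with ⟨c₁, c₂, c₃⟩ | ⟨c₁, c₂, c₃⟩ | ⟨c₁, c₂, c₃⟩ <;> rw [c₁, c₂, c₃] at hS
  · exact key refuted_nonconvex_eleven_111 fun tbl => exists_append_holds (hS tbl).1 (hS tbl).2.1
  · exact key refuted_nonconvex_eleven_112 fun tbl => exists_append_holds (hS tbl).1 (hS tbl).2.1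
  · exact key refuted_nonconvex_eleven_123 fun tbl => exists_append_holds (hS tbl).1 (hS tbl).2.1
  all_goals
    have hS' (l) (hl) (tbl) := exists_append_holds (exists_append_holds (exists_append_holds
      (hS tbl).1 (hS tbl).2.1) ((hS tbl).2.2.1 hP)) ((hS tbl).2.2.2 l hl)
  · exact key refuted_nonconvex_twelve_111 (hS' _ (by simp))
  · exact key refuted_nonconvex_twelve_112 (hS' _ (by simp))
  · exact key refuted_nonconvex_twelve_123 (hS' _ (by simp))
  · exact key refuted_nonconvex_thirteen_111 (hS' _ (by simp))
  · exact key refuted_nonconvex_thirteen_112 (hS' _ (by simp))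
  · exact key refuted_nonconvex_thirteen_123 (hS' _ (by simp))

theorem exists_perm_pattern (s t u : Fin 4) (hs : s ≠ 0) (ht : t ≠ 0) (hu : u ≠ 0) :
    ∃ σ : Equiv.Perm (Fin 4), σ 0 = 0 ∧
      (σ s, σ t, σ u) ∈ ([(1, 1, 1), (1, 1, 2), (1, 2, 3), (2, 1, 1), (1, 2, 1)] :
        List (Fin 4 × Fin 4 × Fin 4)) := by
  decide +revert

theorem Blk.nonconvex (h : Blk P c) {a₀ a₁ a₂ a₃ : ℝ × ℝ} (ha : Around a₀ a₁ a₂ a₃)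
    (h0 : ∀ x, x ∈ P ∧ c x = 0 ↔ x ∈ [a₀, a₁, a₂, a₃])
    (hmax : ∀ d : Fin 4, cnt P c d ≤ [4, 3, 3, 3].getD d 0)
    (hcard : P.card = 11 ∨ (∀ x ∈ P, x ∈ tri a₁ a₂ a₃) ∧ (P.card = 12 ∨ P.card = 13)) : False := by
  obtain ⟨m0, z0⟩ := (h0 a₀).2 (by simp)
  obtain ⟨m1, z1⟩ := (h0 a₁).2 (by simp)
  obtain ⟨m2, z2⟩ := (h0 a₂).2 (by simp)
  obtain ⟨m3, z3⟩ := (h0 a₃).2 (by simp)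
  have hne := ha.ne
  simp only [List.nodup_cons, List.mem_cons, List.not_mem_nil, or_false, not_or] at hne
  obtain ⟨b₁, hb₁, h₁, e₁⟩ := h.blocker m0 m1 hne.1.1 (z0.trans z1.symm)
  obtain ⟨b₂, hb₂, h₂, e₂⟩ := h.blocker m0 m2 hne.1.2.1 (z0.trans z2.symm)
  obtain ⟨b₃, hb₃, h₃, e₃⟩ := h.blocker m0 m3 hne.1.2.2 (z0.trans z3.symm)
  rw [z0] at e₁ e₂ e₃
  obtain ⟨σ, hσ, hσ'⟩ := exists_perm_pattern _ _ _ e₁ e₂ e₃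
  have h0' : ∀ x, σ (c x) = 0 ↔ c x = 0 := fun x => by
    rw [← hσ, σ.apply_eq_iff_eq, hσ]
  have hmax' : ∀ d : Fin 4, cnt P (fun x => σ (c x)) d ≤ [4, 3, 3, 3].getD d 0 := by
    intro d
    rw [cnt_perm]
    refine (hmax _).trans ?_
    have : d = 0 ↔ σ.symm d = 0 := by rw [Equiv.symm_apply_eq, hσ]
    generalize σ.symm d = d' at this
    decide +revert
  simp only [List.mem_cons, List.not_mem_nil, or_false, Prod.mk.injEq, ← or_assoc] at hσ'
  rw [or_assoc (a := _ ∧ _)] at hσ'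
  rcases hσ' with (hσ' | hσ') | hσ'
  · exact (h.perm σ).nonconvex_spokes ha (fun x => by rw [h0', h0]) hb₁ hb₂ hb₃ h₁ h₂ h₃ hmax' hcard
      hσ'
  · exact (h.perm σ).nonconvex_spokes ha.rot (fun x => by rw [h0', h0]; simp; tauto) hb₂ hb₃ hb₁ h₂
      h₃ h₁ hmax' (by rwa [tri_rot]) (.inr (.inl ⟨hσ'.2.1, hσ'.2.2, hσ'.1⟩))
  · exact (h.perm σ).nonconvex_spokes ha.rot.rot (fun x => by rw [h0', h0]; simp; tauto) hb₃ hb₁ hb₂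
      h₃ h₁ h₂ hmax' (by rwa [tri_rot, tri_rot]) (.inr (.inl ⟨hσ'.2.2, hσ'.1, hσ'.2.1⟩))

end FourBlocked

namespace FourBlocked
variable {P : Finset (ℝ × ℝ)} {c : ℝ × ℝ → Fin 4}

theorem Quad.ne {a₀ a₁ a₂ a₃ : ℝ × ℝ} (ha : Quad a₀ a₁ a₂ a₃) : [a₀, a₁, a₂, a₃].Nodup := by
  obtain ⟨h1, h2, h3, h4⟩ := ha
  simp only [List.nodup_cons, List.mem_cons, List.not_mem_nil, or_false, not_or, List.nodup_nil,
    and_true, not_false_iff]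
  refine ⟨⟨?_, ?_, ?_⟩, ⟨?_, ?_⟩, ?_⟩ <;> rintro rfl <;>
    simp only [orient_self_left, orient_self_right, orient_self_outer, lt_irrefl] at *

theorem Blk.convex_list (h : Blk P c) {a₀ a₁ a₂ a₃ b₄ b₅ b₆ b₇ y₀ y₁ : ℝ × ℝ}
    (ha : Quad a₀ a₁ a₂ a₃) (h0 : ∀ x, x ∈ P ∧ c x = 0 ↔ x ∈ [a₀, a₁, a₂, a₃]) (hb₄ : b₄ ∈ P)
    (hb₅ : b₅ ∈ P) (hb₆ : b₆ ∈ P) (hb₇ : b₇ ∈ P) (hy₀ : y₀ ∈ P) (hy₁ : y₁ ∈ P)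
    (h₄ : Btw a₀ b₄ a₁) (h₅ : Btw a₁ b₅ a₂) (h₆ : Btw a₂ b₆ a₃) (h₇ : Btw a₀ b₇ a₃)
    (h₈ : Btw a₀ y₀ a₂) (h₉ : Btw a₁ y₁ a₃) {D : List (ℝ × ℝ)} {s : ℕ}
    (hD : D = [y₀] ∧ s = 8 ∧ y₀ = y₁ ∨ D = [y₀, y₁] ∧ s = 9 ∧ y₀ ≠ y₁) :
    ∃ rest : List (ℝ × ℝ), let L := ([a₀, a₁, a₂, a₃] ++ ([b₄, b₅, b₆, b₇] ++ D)) ++ rest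
      L.Nodup ∧ (∀ x, x ∈ L ↔ x ∈ P) ∧ L.length = P.card ∧ s < P.card ∧
      (∀ tbl, ∀ cl ∈ convexHyps P.card s, Holds c L tbl cl) ∧
      ∀ i, s < i → i + 1 < P.card → (c (L.getD i 0)).val ≤ (c (L.getD (i + 1) 0)).val := by
  obtain ⟨m0, z0⟩ := (h0 a₀).2 (by simp)
  obtain ⟨m1, z1⟩ := (h0 a₁).2 (by simp)
  obtain ⟨m2, z2⟩ := (h0 a₂).2 (by simp)
  obtain ⟨m3, z3⟩ := (h0 a₃).2 (by simp)
  have hnd := ha.ne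
  obtain ⟨o₁, o₂, o₃, o₄⟩ := ha
  have e₄ : c b₄ ≠ 0 := fun e => h.btw_ne m0 hb₄ m1 h₄ (z0.trans e.symm)
  have e₅ : c b₅ ≠ 0 := fun e => h.btw_ne m1 hb₅ m2 h₅ (z1.trans e.symm)
  have e₆ : c b₆ ≠ 0 := fun e => h.btw_ne m2 hb₆ m3 h₆ (z2.trans e.symm)
  have e₇ : c b₇ ≠ 0 := fun e => h.btw_ne m0 hb₇ m3 h₇ (z0.trans e.symm)
  have e₈ : c y₀ ≠ 0 := fun e => h.btw_ne m0 hy₀ m2 h₈ (z0.trans e.symm)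
  have e₉ : c y₁ ≠ 0 := fun e => h.btw_ne m1 hy₁ m3 h₉ (z1.trans e.symm)
  have k45 := h₄.symm.ne_of_common (fun e => by
    simp only [orient] at o₁ o₂ o₃ o₄ e; linarith) h₅
  have k46 := h₄.ne_of_side h₆ (by simpa only [orient_rot]) (by simpa only [orient_rot])
  have k47 := h₄.ne_of_common (fun e => by
    simp only [orient] at o₁ o₂ o₃ o₄ e; linarith) h₇
  have k48 := h₄.ne_of_common (fun e => by
    simp only [orient] at o₁ o₂ o₃ o₄ e; linarith) h₈
  have k49 := h₄.symm.ne_of_common (fun e => by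
    simp only [orient] at o₁ o₂ o₃ o₄ e; linarith) h₉
  have k56 := h₅.symm.ne_of_common (fun e => by
    simp only [orient] at o₁ o₂ o₃ o₄ e; linarith) h₆
  have k57 := h₅.ne_of_side h₇ (by simpa only [orient_rot]) (by simpa only [orient_rot])
  have k58 := h₅.symm.ne_of_common (fun e => by
    simp only [orient] at o₁ o₂ o₃ o₄ e; linarith) h₈.symm
  have k59 := h₅.ne_of_common (fun e => by
    simp only [orient] at o₁ o₂ o₃ o₄ e; linarith) h₉
  have k67 := h₆.symm.ne_of_common (fun e => by
    simp only [orient] at o₁ o₂ o₃ o₄ e; linarith) h₇.symm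
  have k68 := h₆.ne_of_common (fun e => by
    simp only [orient] at o₁ o₂ o₃ o₄ e; linarith) h₈.symm
  have k69 := h₆.symm.ne_of_common (fun e => by
    simp only [orient] at o₁ o₂ o₃ o₄ e; linarith) h₉.symm
  have k78 := h₇.ne_of_common (fun e => by
    simp only [orient] at o₁ o₂ o₃ o₄ e; linarith) h₈
  have k79 := h₇.symm.ne_of_common (fun e => by
    simp only [orient] at o₁ o₂ o₃ o₄ e; linarith) h₉.symm
  have hDm : ∀ x ∈ D, x = y₀ ∨ x = y₁ := by
    rcases hD with ⟨rfl, -⟩ | ⟨rfl, -⟩ <;> simp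
  have hDn : D.Nodup := by
    rcases hD with ⟨rfl, -⟩ | ⟨rfl, -, hy⟩
    · simp
    · simp [hy]
  have hnd' : ([a₀, a₁, a₂, a₃] ++ ([b₄, b₅, b₆, b₇] ++ D)).Nodup := by
    refine hnd.append (List.Nodup.append (by simp [*]) hDn ?_) ?_
    · intro x hx hx'
      have := hDm x hx'
      simp only [List.mem_cons, List.not_mem_nil, or_false] at hx
      rcases hx with rfl | rfl | rfl | rfl <;> rcases this with rfl | rfl <;> contradiction
    · intro x hx hx'
      have := ((h0 x).2 hx).2
      rw [List.mem_append] at hx'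
      simp only [List.mem_cons, List.not_mem_nil, or_false] at hx'
      rcases hx' with (rfl | rfl | rfl | rfl) | hx'
      iterate 4 contradiction
      rcases hDm x hx' with rfl | rfl <;> contradiction
  obtain ⟨rest, hL, hLP, hlen, hsort⟩ := exists_extension c (P := P) hnd' (by
    intro x hx
    rw [List.mem_append, List.mem_append, ← h0] at hx
    simp only [List.mem_cons, List.not_mem_nil, or_false] at hx
    rcases hx with hx | (rfl | rfl | rfl | rfl) | hx
    · exact hx.1
    iterate 4 assumption
    rcases hDm x hx with rfl | rfl <;> assumption)
  rw [← hlen]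
  have hs : ([a₀, a₁, a₂, a₃] ++ ([b₄, b₅, b₆, b₇] ++ D)).length = s + 1 := by
    rcases hD with ⟨rfl, rfl, -⟩ | ⟨rfl, rfl, -⟩ <;> rfl
  refine ⟨rest, hL, hLP, rfl, ?_, fun tbl => ?_, fun i hi hi' => ?_⟩
  · rw [List.length_append, hs]
    omega
  · refine exists_append_holds (exists_append_holds ?_ ?_) ?_
    · rw [List.append_assoc] at hL hLP ⊢
      exact colHyps_of_list hL hLP (fun x hx => by rw [← h0]; simp [hx]) tbl
    · rcases hD with ⟨rfl, rfl, rfl⟩ | ⟨rfl, rfl, -⟩ <;> exact btwHyps_holds (by simp [*])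
    · exact posHyps_holds (by simp [*])
  · exact le_of_pairwise hsort (by omega) hi'

end FourBlocked

namespace FourBlocked
variable {P : Finset (ℝ × ℝ)} {c : ℝ × ℝ → Fin 4}

section Convex
variable (h : Blk P c) {a₀ a₁ a₂ a₃ b₄ b₅ b₆ b₇ y₀ y₁ : ℝ × ℝ} (ha : Quad a₀ a₁ a₂ a₃)
  (h0 : ∀ x, x ∈ P ∧ c x = 0 ↔ x ∈ [a₀, a₁, a₂, a₃]) (hb₄ : b₄ ∈ P) (hb₅ : b₅ ∈ P) (hb₆ : b₆ ∈ P)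
  (hb₇ : b₇ ∈ P) (hy₀ : y₀ ∈ P) (hy₁ : y₁ ∈ P) (h₄ : Btw a₀ b₄ a₁) (h₅ : Btw a₁ b₅ a₂)
  (h₆ : Btw a₂ b₆ a₃) (h₇ : Btw a₀ b₇ a₃) (h₈ : Btw a₀ y₀ a₂) (h₉ : Btw a₁ y₁ a₃)
include h ha h0 hb₄ hb₅ hb₆ hb₇ hy₀ hy₁ h₄ h₅ h₆ h₇ h₈ h₉

theorem Blk.convex_bounds : 8 < P.card ∧
    ((∀ d : Fin 4, cnt P c d ≤ [4, 3, 2, 1].getD d 0) → P.card ≠ 10) := by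
  by_cases hy : y₀ = y₁
  · obtain ⟨rest, hL, hLP, hlen, hcard, hS, -⟩ := h.convex_list ha h0 hb₄ hb₅ hb₆ hb₇ hy₀ hy₁ h₄ h₅
      h₆ h₇ h₈ h₉ (.inl ⟨rfl, rfl, hy⟩)
    refine ⟨hcard, fun hmax he => ?_⟩
    rw [he] at hS hlen
    exact h.not_refuted hL hLP hmax hS (by rw [hlen]; exact refuted_convex_ten_common)
  · obtain ⟨rest, hL, hLP, hlen, hcard, hS, -⟩ := h.convex_list ha h0 hb₄ hb₅ hb₆ hb₇ hy₀ hy₁ h₄ h₅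
      h₆ h₇ h₈ h₉ (.inr ⟨rfl, rfl, hy⟩)
    refine ⟨by omega, fun hmax he => ?_⟩
    rw [he] at hS hlen
    exact h.not_refuted hL hLP hmax hS (by rw [hlen]; exact refuted_convex_ten)

theorem Blk.convex_eleven_common (hmax : ∀ d : Fin 4, cnt P c d ≤ [4, 3, 2, 2].getD d 0)
    (hy : y₀ = y₁) (h5 : c b₄ ≤ c b₅) (h6 : c b₄ ≤ c b₆) (h7 : c b₄ ≤ c b₇) : P.card ≠ 11 := by
  intro he
  obtain ⟨rest, hL, hLP, hlen, -, hS, hle⟩ := h.convex_list ha h0 hb₄ hb₅ hb₆ hb₇ hy₀ hy₁ h₄ h₅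
    h₆ h₇ h₈ h₉ (.inl ⟨rfl, rfl, hy⟩)
  rw [he] at hS hlen hle
  refine h.not_refuted hL hLP hmax (fun tbl => exists_append_holds (hS tbl) (leHyps_holds ?_))
    (by rw [hlen]; exact refuted_convex_eleven_common)
  simp only [List.forall_mem_cons]
  exact ⟨hle 9 (by norm_num) (by norm_num), h5, h6, h7, by simp⟩

theorem Blk.convex_eleven (hmax : ∀ d : Fin 4, cnt P c d ≤ [4, 3, 2, 2].getD d 0)
    (hy : y₀ ≠ y₁) (h9 : c y₀ ≤ c y₁) : P.card ≠ 11 := by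
  intro he
  obtain ⟨rest, hL, hLP, hlen, -, hS, hle⟩ := h.convex_list ha h0 hb₄ hb₅ hb₆ hb₇ hy₀ hy₁ h₄ h₅
    h₆ h₇ h₈ h₉ (.inr ⟨rfl, rfl, hy⟩)
  rw [he] at hS hlen hle
  refine h.not_refuted hL hLP hmax (fun tbl => exists_append_holds (hS tbl) (leHyps_holds ?_))
    (by rw [hlen]; exact refuted_convex_eleven)
  simp only [List.forall_mem_cons]
  exact ⟨h9, by simp⟩

end Convex

theorem Blk.convex (h : Blk P c) {a₀ a₁ a₂ a₃ : ℝ × ℝ} (ha : Quad a₀ a₁ a₂ a₃)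
    (h0 : ∀ x, x ∈ P ∧ c x = 0 ↔ x ∈ [a₀, a₁, a₂, a₃]) : 8 < P.card ∧
      ((∀ d : Fin 4, cnt P c d ≤ [4, 3, 2, 1].getD d 0) → P.card ≠ 10) ∧
      ((∀ d : Fin 4, cnt P c d ≤ [4, 3, 2, 2].getD d 0) → P.card ≠ 11) := by
  obtain ⟨m0, z0⟩ := (h0 a₀).2 (by simp)
  obtain ⟨m1, z1⟩ := (h0 a₁).2 (by simp)
  obtain ⟨m2, z2⟩ := (h0 a₂).2 (by simp)
  obtain ⟨m3, z3⟩ := (h0 a₃).2 (by simp)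
  have hne := ha.ne
  simp only [List.nodup_cons, List.mem_cons, List.not_mem_nil, or_false, not_or] at hne
  obtain ⟨b₄, hb₄, h₄, -⟩ := h.blocker m0 m1 hne.1.1 (z0.trans z1.symm)
  obtain ⟨b₅, hb₅, h₅, -⟩ := h.blocker m1 m2 hne.2.1.1 (z1.trans z2.symm)
  obtain ⟨b₆, hb₆, h₆, -⟩ := h.blocker m2 m3 hne.2.2.1 (z2.trans z3.symm)
  obtain ⟨b₇, hb₇, h₇, -⟩ := h.blocker m0 m3 hne.1.2.2 (z0.trans z3.symm)
  obtain ⟨y₀, hy₀, h₈, -⟩ := h.blocker m0 m2 hne.1.2.1 (z0.trans z2.symm)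
  obtain ⟨y₁, hy₁, h₉, -⟩ := h.blocker m1 m3 hne.2.1.2 (z1.trans z3.symm)
  have hc := h.convex_bounds ha h0 hb₄ hb₅ hb₆ hb₇ hy₀ hy₁ h₄ h₅ h₆ h₇ h₈ h₉
  refine ⟨hc.1, hc.2, fun hmax => ?_⟩
  have h1 : ∀ x, x ∈ P ∧ c x = 0 ↔ x ∈ [a₁, a₂, a₃, a₀] := fun x => by rw [h0]; simp; tauto
  have h2 : ∀ x, x ∈ P ∧ c x = 0 ↔ x ∈ [a₂, a₃, a₀, a₁] := fun x => by rw [h0]; simp; tauto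
  have h3 : ∀ x, x ∈ P ∧ c x = 0 ↔ x ∈ [a₃, a₀, a₁, a₂] := fun x => by rw [h0]; simp; tauto
  by_cases hy : y₀ = y₁
  · have hmin : (c b₄ ≤ c b₅ ∧ c b₄ ≤ c b₆ ∧ c b₄ ≤ c b₇) ∨ (c b₅ ≤ c b₆ ∧ c b₅ ≤ c b₇ ∧
    c b₅ ≤ c b₄) ∨
        (c b₆ ≤ c b₇ ∧ c b₆ ≤ c b₄ ∧ c b₆ ≤ c b₅) ∨ (c b₇ ≤ c b₄ ∧ c b₇ ≤ c b₅ ∧ c b₇ ≤ c b₆) := by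
      omega
    rcases hmin with hm | hm | hm | hm
    · exact h.convex_eleven_common ha h0 hb₄ hb₅ hb₆ hb₇ hy₀ hy₁ h₄ h₅ h₆ h₇ h₈ h₉ hmax hy hm.1
        hm.2.1 hm.2.2
    · exact h.convex_eleven_common ha.rot h1 hb₅ hb₆ hb₇ hb₄ hy₁ hy₀ h₅ h₆ h₇.symm h₄.symm h₉
        h₈.symm hmax hy.symm hm.1 hm.2.1 hm.2.2
    · exact h.convex_eleven_common ha.rot.rot h2 hb₆ hb₇ hb₄ hb₅ hy₀ hy₁ h₆ h₇.symm h₄ h₅.symm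
        h₈.symm h₉.symm hmax hy hm.1 hm.2.1 hm.2.2
    · exact h.convex_eleven_common ha.rot.rot.rot h3 hb₇ hb₄ hb₅ hb₆ hy₁ hy₀ h₇.symm h₄ h₅ h₆.symm
        h₉.symm h₈ hmax hy.symm hm.1 hm.2.1 hm.2.2
  · rcases le_total (c y₀) (c y₁) with hm | hm
    · exact h.convex_eleven ha h0 hb₄ hb₅ hb₆ hb₇ hy₀ hy₁ h₄ h₅ h₆ h₇ h₈ h₉ hmax hy hm
    · exact h.convex_eleven ha.rot h1 hb₅ hb₆ hb₇ hb₄ hy₁ hy₀ h₅ h₆ h₇.symm h₄.symm h₉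
        h₈.symm hmax (Ne.symm hy) hm

end FourBlocked

namespace FourBlocked
variable {P : Finset (ℝ × ℝ)} {c : ℝ × ℝ → Fin 4}

/-- The lexicographic order on the plane. -/
def LexLt (x y : ℝ × ℝ) : Prop := x.1 < y.1 ∨ x.1 = y.1 ∧ x.2 < y.2

theorem LexLt.ne {x y : ℝ × ℝ} (h : LexLt x y) : x ≠ y := by
  rintro rfl
  simp [LexLt] at h

theorem LexLt.not_btw {x y z : ℝ × ℝ} (hy : LexLt x y) (hz : LexLt x z) : ¬ Btw y x z := by
  intro hb
  obtain ⟨-, a, b, ha, hb, hab, rfl⟩ := btw_iff_mem_openSegment.1 hb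
  obtain rfl : a = 1 - b := by linarith
  simp only [LexLt, Prod.fst_add, Prod.smul_fst, smul_eq_mul, Prod.snd_add, Prod.smul_snd] at hy hz
  rcases hy with hy | ⟨hy, hy'⟩ <;> rcases hz with hz | ⟨hz, hz'⟩ <;> nlinarith

theorem exists_lexLt (hP : P.Nonempty) : ∃ v ∈ P, ∀ x ∈ P, x ≠ v → LexLt v x := by
  obtain ⟨v, hv, hmin⟩ := P.exists_min_image (fun x => toLex x) hP
  refine ⟨v, hv, fun x hx hxv => ?_⟩
  have := (hmin x hx).lt_of_ne fun e => hxv (toLex.injective e).symm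
  exact Prod.Lex.toLex_lt_toLex.1 this

theorem LexLt.orient_nonneg {p x y : ℝ × ℝ} (hx : LexLt p x) (hy : LexLt p y)
    (h : (x.2 - p.2) / (|x.2 - p.2| + (x.1 - p.1)) ≤ (y.2 - p.2) / (|y.2 - p.2| + (y.1 - p.1))) :
    0 ≤ orient p x y := by
  have hd : ∀ {z : ℝ × ℝ}, LexLt p z → 0 < |z.2 - p.2| + (z.1 - p.1) ∧ 0 ≤ z.1 - p.1 := by
    rintro z (hz | ⟨hz, hz'⟩)
    · exact ⟨by linarith [abs_nonneg (z.2 - p.2)], by linarith⟩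
    · exact ⟨by linarith [abs_pos.2 (sub_pos.2 hz').ne'], by linarith⟩
  obtain ⟨h1, h2⟩ := hd hx
  obtain ⟨h3, h4⟩ := hd hy
  rw [div_le_div_iff₀ h1 h3] at h
  simp only [orient]
  generalize x.1 - p.1 = x₁ at *
  generalize x.2 - p.2 = x₂ at *
  generalize y.1 - p.1 = y₁ at *
  generalize y.2 - p.2 = y₂ at *
  rcases le_total 0 x₂ with hx | hx <;> rcases le_total 0 y₂ with hy | hy <;>
    simp only [abs_of_nonneg, abs_of_nonpos, hx, hy] at h <;> nlinarith

/-- Points to the right of `p` can be sorted by angle. -/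
theorem exists_perm_pairwise_orient {p : ℝ × ℝ} {l : List (ℝ × ℝ)} (hl : ∀ x ∈ l, LexLt p x) :
    ∃ l' : List (ℝ × ℝ), l'.Perm l ∧ l'.Pairwise fun x y => 0 ≤ orient p x y := by
  classical
  let key (x : ℝ × ℝ) : ℝ := (x.2 - p.2) / (|x.2 - p.2| + (x.1 - p.1))
  have : Std.Total fun x y => key x ≤ key y := ⟨fun x y => le_total _ _⟩
  have : IsTrans _ fun x y => key x ≤ key y := ⟨fun x y z => le_trans⟩
  refine ⟨l.insertionSort fun x y => key x ≤ key y, List.perm_insertionSort _ _, ?_⟩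
  refine (List.pairwise_insertionSort _ l).imp_of_mem fun {x y} hx hy hxy => ?_
  exact (hl _ ((List.mem_insertionSort _).1 hx)).orient_nonneg
    (hl _ ((List.mem_insertionSort _).1 hy)) hxy

theorem Blk.five (h : Blk P c) {v : ℝ × ℝ} (hv : v ∈ P) (hlex : ∀ x ∈ P, x ≠ v → LexLt v x)
    (hv0 : c v = 0) (h5 : cnt P c 0 = 5) (hmax : ∀ d, cnt P c d ≤ [9, 9, 9, 9].getD d 0)
    (hcard : P.card = 10 ∨ P.card = 11) : False := by
  classical
  have hl : ∀ x ∈ ((P.filter (c · = 0)).erase v).toList, (x ∈ P ∧ c x = 0) ∧ x ≠ v := by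
    intro x hx
    rw [Finset.mem_toList, Finset.mem_erase, Finset.mem_filter] at hx
    exact hx.symm
  obtain ⟨l, hp, ho⟩ := exists_perm_pairwise_orient (p := v) fun x hx =>
    hlex x (hl x hx).1.1 (hl x hx).2
  have hlen : l.length = 4 := by
    rw [hp.length_eq, Finset.length_toList, Finset.card_erase_of_mem (by simp [hv, hv0])]
    exact congrArg (· - 1) h5
  have hmem : ∀ x, x ∈ l ↔ (x ∈ P ∧ c x = 0) ∧ x ≠ v := by
    intro x
    rw [hp.mem_iff, Finset.mem_toList, Finset.mem_erase, Finset.mem_filter, and_comm]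
  have hnd : l.Nodup := hp.nodup_iff.2 (Finset.nodup_toList _)
  have ho' : l.Pairwise fun x y => 0 < orient v x y := by
    refine (ho.and hnd).imp_of_mem fun {x y} hx hy hxy => hxy.1.lt_of_ne' ?_
    rw [hmem] at hx hy
    exact h.orient_ne_zero hv hx.1.1 hy.1.1 hx.2.symm hy.2.symm hxy.2 (hv0.trans hx.1.2.symm)
      (hv0.trans hy.1.2.symm)
  clear ho hp hl
  obtain ⟨x₁, x₂, x₃, x₄, rfl⟩ : ∃ x₁ x₂ x₃ x₄, l = [x₁, x₂, x₃, x₄] := by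
    match l, hlen with
    | [x₁, x₂, x₃, x₄], _ => exact ⟨x₁, x₂, x₃, x₄, rfl⟩
  have hm {x} (hx : x ∈ [x₁, x₂, x₃, x₄]) := (hmem x).1 hx
  obtain ⟨⟨m1, z1⟩, n1⟩ := hm (x := x₁) (by simp)
  obtain ⟨⟨m2, z2⟩, n2⟩ := hm (x := x₂) (by simp)
  obtain ⟨⟨m3, z3⟩, n3⟩ := hm (x := x₃) (by simp)
  obtain ⟨⟨m4, z4⟩, n4⟩ := hm (x := x₄) (by simp)
  obtain ⟨b₁, hb₁, h₁, e₁⟩ := h.blocker hv m1 n1.symm (hv0.trans z1.symm)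
  obtain ⟨b₂, hb₂, h₂, e₂⟩ := h.blocker hv m2 n2.symm (hv0.trans z2.symm)
  obtain ⟨b₃, hb₃, h₃, e₃⟩ := h.blocker hv m3 n3.symm (hv0.trans z3.symm)
  obtain ⟨b₄, hb₄, h₄, e₄⟩ := h.blocker hv m4 n4.symm (hv0.trans z4.symm)
  rw [hv0] at e₁ e₂ e₃ e₄
  simp only [List.pairwise_cons, List.mem_cons, List.not_mem_nil, or_false, forall_eq_or_imp,
    forall_eq, List.Pairwise.nil, and_true, IsEmpty.forall_iff, implies_true] at ho'
  obtain ⟨⟨o12, o13, o14⟩, ⟨o23, o24⟩, o34⟩ := ho'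
  have k12 := h₁.ne_of_common o12.ne' h₂
  have k13 := h₁.ne_of_common o13.ne' h₃
  have k14 := h₁.ne_of_common o14.ne' h₄
  have k23 := h₂.ne_of_common o23.ne' h₃
  have k24 := h₂.ne_of_common o24.ne' h₄
  have k34 := h₃.ne_of_common o34.ne' h₄
  have h0 : ∀ x ∈ P, c x = 0 ↔ x ∈ [v, x₁, x₂, x₃, x₄] := by
    intro x hx
    rw [List.mem_cons, hmem]
    by_cases hxv : x = v
    · simp [hxv, hv0]
    · simp [hxv, hx]
  have hnd' : ([v, x₁, x₂, x₃, x₄] ++ [b₁, b₂, b₃, b₄]).Nodup := by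
    refine List.Nodup.append (List.nodup_cons.2 ⟨fun hv' => (hm hv').2 rfl, hnd⟩) (by simp [*]) ?_
    intro x hx hx'
    simp only [List.mem_cons, List.not_mem_nil, or_false] at hx'
    rcases hx' with rfl | rfl | rfl | rfl
    exacts [e₁ ((h0 _ hb₁).2 hx), e₂ ((h0 _ hb₂).2 hx), e₃ ((h0 _ hb₃).2 hx), e₄ ((h0 _ hb₄).2 hx)]
  obtain ⟨rest, hL, hLP, hlen, -⟩ := exists_extension c (P := P) hnd' (by simp [*])
  have hS : ∀ tbl, ∀ cl ∈ fiveHyps P.card,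
      Holds c ([v, x₁, x₂, x₃, x₄] ++ [b₁, b₂, b₃, b₄] ++ rest) tbl cl := by
    intro tbl
    rw [← hlen]
    refine exists_append_holds (exists_append_holds ?_ ?_) ?_
    · rw [List.append_assoc] at hL hLP ⊢
      exact colHyps_of_list hL hLP h0 tbl
    · exact btwHyps_holds (by simp [*])
    · exact posHyps_holds (by simp [*])
  rcases hcard with he | he <;> rw [he] at hS hlen
  · exact h.not_refuted hL hLP hmax hS (by rw [hlen]; exact refuted_five_ten)
  · exact h.not_refuted hL hLP hmax hS (by rw [hlen]; exact refuted_five_eleven)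

end FourBlocked

namespace FourBlocked
variable {P : Finset (ℝ × ℝ)} {c : ℝ × ℝ → Fin 4}

theorem sum_cnt (P : Finset (ℝ × ℝ)) (c : ℝ × ℝ → Fin 4) :
    cnt P c 0 + cnt P c 1 + cnt P c 2 + cnt P c 3 = P.card := by
  rw [Finset.card_eq_sum_card_fiberwise (f := c) (t := Finset.univ) (by simp), Fin.sum_univ_four]
  rfl

theorem count_map_eq_cnt {L : List (ℝ × ℝ)} (hL : L.Nodup) (hLP : ∀ x, x ∈ L ↔ x ∈ P) (d : Fin 4) :
    (L.map c).count d = cnt P c d := by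
  classical
  obtain rfl : L.toFinset = P := by ext; simp [hLP]
  rw [cnt, List.count_eq_length_filter, List.filter_map, List.length_map,
    ← List.toFinset_card_of_nodup (hL.filter _)]
  congr 1
  ext
  simp

section Three
variable (h : Blk P c) {a₀ a₁ a₂ b₃ b₄ b₅ : ℝ × ℝ} (hn : ∀ d, cnt P c d = [3, 3, 3, 1].getD d 0)
  (ho : 0 < orient a₀ a₁ a₂) (h0 : ∀ x, x ∈ P ∧ c x = 0 ↔ x ∈ [a₀, a₁, a₂]) (hb₃ : b₃ ∈ P)
  (hb₄ : b₄ ∈ P) (hb₅ : b₅ ∈ P) (h₃ : Btw a₀ b₃ a₁) (h₄ : Btw a₁ b₄ a₂) (h₅ : Btw a₀ b₅ a₂)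

include ho h₃ h₄ h₅ in
theorem nodup_midpoints : [b₃, b₄, b₅].Nodup := by
  have k34 := h₃.symm.ne_of_common (fun e => by simp only [orient] at ho e; linarith) h₄
  have k35 := h₃.ne_of_common ho.ne' h₅
  have k45 := h₄.symm.ne_of_common (fun e => by simp only [orient] at ho e; linarith) h₅.symm
  simp [*]

include h hn ho h0 hb₃ hb₄ hb₅ h₃ h₄ h₅

theorem Blk.three_list :
    ∃ r₆ r₇ r₈ r₉ : ℝ × ℝ, let L := [a₀, a₁, a₂, b₃, b₄, b₅, r₆, r₇, r₈, r₉]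
      L.Nodup ∧ (∀ x, x ∈ L ↔ x ∈ P) ∧ c r₆ ≤ c r₇ ∧ c r₇ ≤ c r₈ ∧ c r₈ ≤ c r₉ ∧
      (∀ d, (L.map c).count d = [3, 3, 3, 1].getD d 0) ∧
      ∀ l : List (ℕ × ℕ), (∀ t ∈ l, (c (L.getD t.1 0)).val = t.2) → ∀ tbl, ∀ cl ∈ threeHyps l,
        Holds c L tbl cl := by
  have hnd' : [a₀, a₁, a₂, b₃, b₄, b₅].Nodup := by
    have hnd := nodup_midpoints ho h₃ h₄ h₅
    refine List.Nodup.append (l₁ := [a₀, a₁, a₂]) ?_ hnd ?_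
    · simp [h₃.ne, h₄.ne, h₅.ne]
    · intro x hx hx'
      have hx0 := ((h0 x).2 hx).2
      simp only [List.mem_cons, List.not_mem_nil, or_false] at hx'
      obtain ⟨m0, z0⟩ := (h0 a₀).2 (by simp)
      obtain ⟨m1, z1⟩ := (h0 a₁).2 (by simp)
      obtain ⟨m2, z2⟩ := (h0 a₂).2 (by simp)
      rcases hx' with rfl | rfl | rfl
      · exact h.btw_ne m0 hb₃ m1 h₃ (z0.trans hx0.symm)
      · exact h.btw_ne m1 hb₄ m2 h₄ (z1.trans hx0.symm)
      · exact h.btw_ne m0 hb₅ m2 h₅ (z0.trans hx0.symm)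
  obtain ⟨rest, hL, hLP, hlen, hsort⟩ := exists_extension c (P := P) hnd' (by
    intro x hx
    simp only [List.mem_cons, List.not_mem_nil, or_false] at hx
    rcases hx with hx | hx | hx | rfl | rfl | rfl
    iterate 3 exact ((h0 x).2 (by simp [hx])).1
    all_goals assumption)
  have hcard : P.card = 10 := by simp [← sum_cnt P c, hn]
  obtain ⟨r₆, r₇, r₈, r₉, rfl⟩ : ∃ r₆ r₇ r₈ r₉, rest = [r₆, r₇, r₈, r₉] := by
    rw [hcard] at hlen
    have hlen' : rest.length = 4 := by simpa using hlen
    match rest, hlen' with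
    | [x₁, x₂, x₃, x₄], _ => exact ⟨x₁, x₂, x₃, x₄, rfl⟩
  simp only [List.pairwise_cons, List.forall_mem_cons] at hsort
  refine ⟨r₆, r₇, r₈, r₉, hL, hLP, hsort.1.1, hsort.2.1.1, hsort.2.2.1.1, fun d => ?_,
    fun l hl tbl => ?_⟩
  · rw [← hn]
    exact count_map_eq_cnt hL hLP d
  · refine exists_append_holds (exists_append_holds ?_ ?_) ?_
    · exact eqHyps_holds hl
    · exact btwHyps_holds (by simp [*])
    · exact posHyps_holds (by simp [*])

theorem Blk.three_absurd_pattern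
    (hc : c b₃ = 1 ∧ c b₄ = 1 ∧ (c b₅ = 2 ∨ c b₅ = 3)) : False := by
  have z0 := ((h0 a₀).2 (by simp)).2
  have z1 := ((h0 a₁).2 (by simp)).2
  have z2 := ((h0 a₂).2 (by simp)).2
  obtain ⟨r₆, r₇, r₈, r₉, hL, hLP, h67, h78, h89, hcount, hS⟩ :=
    h.three_list hn ho h0 hb₃ hb₄ hb₅ h₃ h₄ h₅
  obtain ⟨c₃, c₄, c₅⟩ := hc
  have hmax : ∀ d, cnt P c d ≤ [9, 9, 9, 9].getD d 0 := fun d => (hn d).le.trans (by decide +revert)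
  simp only [List.map_cons, List.map_nil, z0, z1, z2, c₃, c₄] at hcount
  rcases c₅ with c₅ | c₅ <;> rw [c₅] at hcount
  · have hr : c r₆ = 1 ∧ c r₇ = 2 ∧ c r₈ = 2 ∧ c r₉ = 3 := by
      generalize c r₆ = s₆ at *
      generalize c r₇ = s₇ at *
      generalize c r₈ = s₈ at *
      generalize c r₉ = s₉ at *
      clear * - hcount h67 h78 h89
      decide +revert
    refine h.not_refuted hL hLP hmax (hS _ ?_) refuted_three_112
    simp [z0, z1, z2, c₃, c₄, c₅, hr]
  · have hr : c r₆ = 1 ∧ c r₇ = 2 ∧ c r₈ = 2 ∧ c r₉ = 2 := by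
      generalize c r₆ = s₆ at *
      generalize c r₇ = s₇ at *
      generalize c r₈ = s₈ at *
      generalize c r₉ = s₉ at *
      clear * - hcount h67 h78 h89
      decide +revert
    refine h.not_refuted hL hLP hmax (hS _ ?_) refuted_three_113
    simp [z0, z1, z2, c₃, c₄, c₅, hr]

end Three
end FourBlocked

namespace FourBlocked
variable {P : Finset (ℝ × ℝ)} {c : ℝ × ℝ → Fin 4}

theorem Blk.exists_triangle (h : Blk P c) (h3 : cnt P c 0 = 3) : ∃ a₀ a₁ a₂ b₃ b₄ b₅,
    0 < orient a₀ a₁ a₂ ∧ (∀ x, x ∈ P ∧ c x = 0 ↔ x ∈ [a₀, a₁, a₂]) ∧ b₃ ∈ P ∧ b₄ ∈ P ∧ b₅ ∈ P ∧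
      Btw a₀ b₃ a₁ ∧ Btw a₁ b₄ a₂ ∧ Btw a₀ b₅ a₂ := by
  classical
  obtain ⟨a₀, a₁, a₂, h01, h02, h12, he⟩ := Finset.card_eq_three.1 h3
  have h0 : ∀ x, x ∈ P ∧ c x = 0 ↔ x ∈ [a₀, a₁, a₂] := by
    intro x
    rw [← Finset.mem_filter (p := (c · = 0)), he]
    simp
  clear he
  wlog ho : 0 < orient a₀ a₁ a₂ generalizing a₁ a₂
  · obtain ⟨m0, z0⟩ := (h0 a₀).2 (by simp)
    obtain ⟨m1, z1⟩ := (h0 a₁).2 (by simp)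
    obtain ⟨m2, z2⟩ := (h0 a₂).2 (by simp)
    have hne := h.orient_ne_zero m0 m1 m2 h01 h02 h12 (z0.trans z1.symm) (z0.trans z2.symm)
    refine this a₂ a₁ h02 h01 h12.symm (fun x => by rw [h0]; simp; tauto) ?_
    rw [orient_swap]
    exact neg_pos.2 ((not_lt.1 ho).lt_of_ne hne)
  obtain ⟨m0, z0⟩ := (h0 a₀).2 (by simp)
  obtain ⟨m1, z1⟩ := (h0 a₁).2 (by simp)
  obtain ⟨m2, z2⟩ := (h0 a₂).2 (by simp)
  obtain ⟨b₃, hb₃, h₃, -⟩ := h.blocker m0 m1 h01 (z0.trans z1.symm)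
  obtain ⟨b₄, hb₄, h₄, -⟩ := h.blocker m1 m2 h12 (z1.trans z2.symm)
  obtain ⟨b₅, hb₅, h₅, -⟩ := h.blocker m0 m2 h02 (z0.trans z2.symm)
  exact ⟨a₀, a₁, a₂, b₃, b₄, b₅, ho, h0, hb₃, hb₄, hb₅, h₃, h₄, h₅⟩

theorem not_all_eq_of_midpoints (h : Blk P c) {a₀ a₁ a₂ b₃ b₄ b₅ : ℝ × ℝ}
    (ho : 0 < orient a₀ a₁ a₂) (h0 : ∀ x, x ∈ P ∧ c x = 0 ↔ x ∈ [a₀, a₁, a₂]) (hb₃ : b₃ ∈ P)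
    (hb₄ : b₄ ∈ P) (hb₅ : b₅ ∈ P) (h₃ : Btw a₀ b₃ a₁) (h₄ : Btw a₁ b₄ a₂) (h₅ : Btw a₀ b₅ a₂) :
    ¬ (c b₃ = c b₄ ∧ c b₃ = c b₅) := by
  rintro ⟨e1, e2⟩
  have hnd := nodup_midpoints ho h₃ h₄ h₅
  simp only [List.nodup_cons, List.mem_cons, List.not_mem_nil, or_false, not_or] at hnd
  obtain ⟨x, hx, ht, hc⟩ := h.exists_color hb₃ hb₄ hb₅ hnd.1.1 hnd.1.2 hnd.2.1 e1 e2 0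
  have t₃ := h₃.mem_tri (left_mem_tri a₀ a₁ a₂) (mid_mem_tri _ _ _)
  have t₄ := h₄.mem_tri (mid_mem_tri a₀ a₁ a₂) (right_mem_tri _ _ _)
  have t₅ := h₅.mem_tri (left_mem_tri a₀ a₁ a₂) (right_mem_tri _ _ _)
  obtain ⟨m0, z0⟩ := (h0 a₀).2 (by simp)
  obtain ⟨m1, z1⟩ := (h0 a₁).2 (by simp)
  obtain ⟨m2, z2⟩ := (h0 a₂).2 (by simp)
  have n₃ : ∀ y, c y = 0 → b₃ ≠ y := by
    rintro y hy rfl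
    exact h.btw_ne m0 hb₃ m1 h₃ (z0.trans hy.symm)
  have n₄ : ∀ y, c y = 0 → b₄ ≠ y := by
    rintro y hy rfl
    exact n₃ b₃ (e1.trans hy) rfl
  have n₅ : ∀ y, c y = 0 → b₅ ≠ y := by
    rintro y hy rfl
    exact n₃ b₃ (e2.trans hy) rfl
  have hx0 := (h0 x).1 ⟨hx, hc⟩
  simp only [List.mem_cons, List.not_mem_nil, or_false] at hx0
  rcases hx0 with rfl | rfl | rfl
  · exact left_notMem_tri ho.ne' t₃ t₄ t₅ (n₃ _ z0) (n₄ _ z0) (n₅ _ z0) ht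
  · rw [← tri_rot] at t₃ t₄ t₅
    exact left_notMem_tri (by rw [orient_rot]; exact ho.ne') t₃ t₄ t₅ (n₃ _ z1) (n₄ _ z1)
      (n₅ _ z1) ht
  · rw [← tri_rot, ← tri_rot] at t₃ t₄ t₅
    exact left_notMem_tri (by rw [orient_rot, orient_rot]; exact ho.ne') t₃ t₄ t₅ (n₃ _ z2)
      (n₄ _ z2)
      (n₅ _ z2) ht

theorem mem_rot {x a b d : ℝ × ℝ} : x ∈ [a, b, d] ↔ x ∈ [b, d, a] := by
  simp
  tauto

/-- Some segment with ends of colour `e` is blocked by a point of colour `d`. -/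
def BlockedBy (P : Finset (ℝ × ℝ)) (c : ℝ × ℝ → Fin 4) (e d : Fin 4) : Prop :=
  ∃ x ∈ P, ∃ w ∈ P, ∃ y ∈ P, Btw x w y ∧ c x = e ∧ c w = d ∧ c y = e

theorem exists_swap_pattern (s t u : Fin 4) (hs : s ≠ 0) (ht : t ≠ 0) (hu : u ≠ 0)
    (h1 : ¬ (s = t ∧ s = u)) (h2 : s = t ∧ s ≠ 3 ∨ s = u ∧ s ≠ 3 ∨ t = u ∧ t ≠ 3) :
    ∃ σ : Equiv.Perm (Fin 4), σ 0 = 0 ∧ σ 3 = 3 ∧ (σ s, σ t, σ u) ∈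
      ([(1, 1, 2), (1, 1, 3), (2, 1, 1),
      (3, 1, 1), (1, 2, 1), (1, 3, 1)] : List (Fin 4 × Fin 4 × Fin 4)) := by
  decide +revert

theorem exists_swap_rainbow (s t u : Fin 4) (hs : s ≠ 0) (ht : t ≠ 0) (hu : u ≠ 0)
    (h1 : s ≠ t) (h2 : s ≠ u) (h3 : t ≠ u) :
    ∃ σ : Equiv.Perm (Fin 4), σ 0 = 0 ∧ σ 3 = 3 ∧ (σ s, σ t, σ u) ∈
      ([(1, 2, 3), (3, 1, 2), (2, 3, 1)] : List (Fin 4 × Fin 4 × Fin 4)) := by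
  decide +revert

theorem cnt_perm_three (hn : ∀ d, cnt P c d = [3, 3, 3, 1].getD d 0) {σ : Equiv.Perm (Fin 4)}
    (h3 : σ 3 = 3) (d : Fin 4) : cnt P (fun x => σ (c x)) d = [3, 3, 3, 1].getD d 0 := by
  rw [cnt_perm, hn]
  have : d = 3 ↔ σ.symm d = 3 := by rw [Equiv.symm_apply_eq, h3]
  generalize σ.symm d = d' at this
  decide +revert

theorem eq_of_color_three (hn : ∀ d, cnt P c d = [3, 3, 3, 1].getD d 0) {x y : ℝ × ℝ} (hx : x ∈ P)
    (hy : y ∈ P) (hxc : c x = 3) (hyc : c y = 3) : x = y := by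
  obtain ⟨z, hz⟩ := Finset.card_eq_one.1 (hn 3)
  have h1 : x ∈ ({z} : Finset _) := hz ▸ Finset.mem_filter.2 ⟨hx, hxc⟩
  have h2 : y ∈ ({z} : Finset _) := hz ▸ Finset.mem_filter.2 ⟨hy, hyc⟩
  rw [Finset.mem_singleton] at h1 h2
  rw [h1, h2]

theorem Blk.three_blockers_ne (h : Blk P c) {a₀ a₁ a₂ b₃ b₄ b₅ : ℝ × ℝ}
    (h0 : ∀ x, x ∈ P ∧ c x = 0 ↔ x ∈ [a₀, a₁, a₂]) (hb₃ : b₃ ∈ P)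
    (hb₄ : b₄ ∈ P) (hb₅ : b₅ ∈ P) (h₃ : Btw a₀ b₃ a₁) (h₄ : Btw a₁ b₄ a₂) (h₅ : Btw a₀ b₅ a₂) :
    c b₃ ≠ 0 ∧ c b₄ ≠ 0 ∧ c b₅ ≠ 0 := by
  obtain ⟨m0, z0⟩ := (h0 a₀).2 (by simp)
  obtain ⟨m1, z1⟩ := (h0 a₁).2 (by simp)
  obtain ⟨m2, z2⟩ := (h0 a₂).2 (by simp)
  refine ⟨fun e => ?_, fun e => ?_, fun e => ?_⟩
  exacts [h.btw_ne m0 hb₃ m1 h₃ (z0.trans e.symm), h.btw_ne m1 hb₄ m2 h₄ (z1.trans e.symm),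
    h.btw_ne m0 hb₅ m2 h₅ (z0.trans e.symm)]

theorem Blk.mem_midpoint_colors (h : Blk P c) (hn : ∀ d, cnt P c d = [3, 3, 3, 1].getD d 0)
    {a₀ a₁ a₂ b₃ b₄ b₅ : ℝ × ℝ} (ho : 0 < orient a₀ a₁ a₂)
    (h0 : ∀ x, x ∈ P ∧ c x = 0 ↔ x ∈ [a₀, a₁, a₂]) (hb₃ : b₃ ∈ P)
    (hb₄ : b₄ ∈ P) (hb₅ : b₅ ∈ P) (h₃ : Btw a₀ b₃ a₁) (h₄ : Btw a₁ b₄ a₂) (h₅ : Btw a₀ b₅ a₂)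
    {d : Fin 4} (hd : d ≠ 0) : c b₃ = d ∨ c b₄ = d ∨ c b₅ = d := by
  by_contra hr
  simp only [not_or] at hr
  obtain ⟨hd₃, hd₄, hd₅⟩ := hr
  have hnd := nodup_midpoints ho h₃ h₄ h₅
  simp only [List.nodup_cons, List.mem_cons, List.not_mem_nil, or_false, not_or] at hnd
  obtain ⟨e₃, e₄, e₅⟩ := h.three_blockers_ne h0 hb₃ hb₄ hb₅ h₃ h₄ h₅
  have h34 : c b₃ = c b₄ → c b₃ ≠ 3 := fun e e' =>
    hnd.1.1 (eq_of_color_three hn hb₃ hb₄ e' (e ▸ e'))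
  have h35 : c b₃ = c b₅ → c b₃ ≠ 3 := fun e e' =>
    hnd.1.2 (eq_of_color_three hn hb₃ hb₅ e' (e ▸ e'))
  have h45 : c b₄ = c b₅ → c b₄ ≠ 3 := fun e e' =>
    hnd.2.1 (eq_of_color_three hn hb₄ hb₅ e' (e ▸ e'))
  obtain ⟨σ, hσ, hσ3, hσ'⟩ := exists_swap_pattern (c b₃) (c b₄) (c b₅) e₃ e₄ e₅
    (not_all_eq_of_midpoints h ho h0 hb₃ hb₄ hb₅ h₃ h₄ h₅) (by
      by_contra hcon
      generalize c b₃ = s at *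
      generalize c b₄ = t at *
      generalize c b₅ = u at *
      clear * - hd e₃ e₄ e₅ hd₃ hd₄ hd₅ h34 h35 h45 hcon
      omega)
  have h0' : ∀ x, σ (c x) = 0 ↔ c x = 0 := fun x => by
    rw [← hσ, σ.apply_eq_iff_eq, hσ]
  simp only [List.mem_cons, List.not_mem_nil, or_false, Prod.mk.injEq] at hσ'
  have ho' : 0 < orient a₁ a₂ a₀ := by rwa [orient_rot]
  have ho'' : 0 < orient a₂ a₀ a₁ := by rwa [orient_rot, orient_rot]
  have H0 := (h.perm σ).three_absurd_pattern (cnt_perm_three hn hσ3) ho (fun x => by rw [h0', h0])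
    hb₃ hb₄ hb₅ h₃ h₄ h₅
  have H1 := (h.perm σ).three_absurd_pattern (cnt_perm_three hn hσ3) ho'
    (fun x => by rw [h0', h0, mem_rot]) hb₄ hb₅ hb₃ h₄ h₅.symm h₃.symm
  have H2 := (h.perm σ).three_absurd_pattern (cnt_perm_three hn hσ3) ho''
    (fun x => by rw [h0', h0, mem_rot, mem_rot]) hb₅ hb₃ hb₄ h₅.symm h₃ h₄.symm
  rcases hσ' with ⟨i, j, k⟩ | ⟨i, j, k⟩ | ⟨i, j, k⟩ | ⟨i, j, k⟩ | ⟨i, j, k⟩ | ⟨i, j, k⟩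
  exacts [H0 ⟨i, j, .inl k⟩, H0 ⟨i, j, .inr k⟩, H1 ⟨j, k, .inl i⟩, H1 ⟨j, k, .inr i⟩,
    H2 ⟨k, i, .inl j⟩, H2 ⟨k, i, .inr j⟩]

theorem Blk.blockedBy_zero (h : Blk P c) (hn : ∀ d, cnt P c d = [3, 3, 3, 1].getD d 0) {d : Fin 4}
    (hd : d ≠ 0) : BlockedBy P c 0 d := by
  obtain ⟨a₀, a₁, a₂, b₃, b₄, b₅, ho, h0, hb₃, hb₄, hb₅, h₃, h₄, h₅⟩ := h.exists_triangle (hn 0)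
  obtain ⟨m0, z0⟩ := (h0 a₀).2 (by simp)
  obtain ⟨m1, z1⟩ := (h0 a₁).2 (by simp)
  obtain ⟨m2, z2⟩ := (h0 a₂).2 (by simp)
  rcases h.mem_midpoint_colors hn ho h0 hb₃ hb₄ hb₅ h₃ h₄ h₅ hd with e | e | e
  exacts [⟨_, m0, _, hb₃, _, m1, h₃, z0, e, z1⟩, ⟨_, m1, _, hb₄, _, m2, h₄, z1, e, z2⟩,
    ⟨_, m0, _, hb₅, _, m2, h₅, z0, e, z2⟩]

theorem Blk.blockedBy (h : Blk P c) (hn : ∀ d, cnt P c d = [3, 3, 3, 1].getD d 0) {e d : Fin 4}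
    (he : e ≠ 3) (hd : d ≠ e) : BlockedBy P c e d := by
  have h3 : Equiv.swap 0 e 3 = 3 := Equiv.swap_apply_of_ne_of_ne (by decide) he.symm
  obtain ⟨x, hx, w, hw, y, hy, hb, hxc, hwc, hyc⟩ :=
    (h.perm (Equiv.swap 0 e)).blockedBy_zero (cnt_perm_three hn h3) (d := Equiv.swap 0 e d)
      (by rwa [Ne, Equiv.swap_apply_eq_iff, Equiv.swap_apply_left])
  rw [Equiv.swap_apply_eq_iff, Equiv.swap_apply_left] at hxc hyc
  exact ⟨x, hx, w, hw, y, hy, hb, hxc, (Equiv.swap 0 e).injective hwc, hyc⟩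

theorem blockerClause_holds {L : List (ℝ × ℝ)} (hLP : ∀ x, x ∈ L ↔ x ∈ P) {e d : Fin 4}
    (hb : BlockedBy P c e d) {p q r : ℕ} {l : List ℕ}
    (hl : ∀ x ∈ L, c x = d → x ∈ l.map (L.getD · 0))
    (hL : ∀ x ∈ L, c x = e → x ∈ [p, q, r].map (L.getD · 0)) (tbl : List (ℕ × ℕ × ℕ × ℕ)) :
    Holds c L tbl (blockerClause p q r l) := by
  obtain ⟨x, hx, w, hw, y, hy, hb, hxc, hwc, hyc⟩ := hb
  obtain ⟨k, hk, rfl⟩ := List.mem_map.1 (hl w ((hLP w).2 hw) hwc)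
  obtain ⟨i, hi, rfl⟩ := List.mem_map.1 (hL x ((hLP x).2 hx) hxc)
  obtain ⟨j, hj, rfl⟩ := List.mem_map.1 (hL y ((hLP y).2 hy) hyc)
  have key : ∀ i j, Btw (L.getD i 0) (L.getD k 0) (L.getD j 0) →
      (i = p ∧ j = q ∨ i = p ∧ j = r ∨ i = q ∧ j = r) → Holds c L tbl (blockerClause p q r l) := by
    intro i j hb hij
    refine ⟨.yes (.B i k j), ?_, hb⟩
    simp only [blockerClause, List.mem_append, List.mem_map]
    rcases hij with ⟨rfl, rfl⟩ | ⟨rfl, rfl⟩ | ⟨rfl, rfl⟩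
    exacts [.inl (.inl ⟨k, hk, rfl⟩), .inl (.inr ⟨k, hk, rfl⟩), .inr ⟨k, hk, rfl⟩]
  have hne : i ≠ j := fun e => hb.ne (by rw [e])
  simp only [List.mem_cons, List.not_mem_nil, or_false] at hi hj
  rcases hi with rfl | rfl | rfl <;> rcases hj with rfl | rfl | rfl <;>
    first
    | exact absurd rfl hne
    | (refine key _ _ hb ?_; simp; done)
    | (refine key _ _ hb.symm ?_; simp)

theorem Blk.rainbow_absurd (h : Blk P c) (hn : ∀ d, cnt P c d = [3, 3, 3, 1].getD d 0)
    {a₀ a₁ a₂ b₃ b₄ b₅ : ℝ × ℝ}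
    (ho : 0 < orient a₀ a₁ a₂) (h0 : ∀ x, x ∈ P ∧ c x = 0 ↔ x ∈ [a₀, a₁, a₂]) (hb₃ : b₃ ∈ P)
    (hb₄ : b₄ ∈ P) (hb₅ : b₅ ∈ P) (h₃ : Btw a₀ b₃ a₁) (h₄ : Btw a₁ b₄ a₂) (h₅ : Btw a₀ b₅ a₂)
    (c₃ : c b₃ = 1) (c₄ : c b₄ = 2) (c₅ : c b₅ = 3) : False := by
  have z0 := ((h0 a₀).2 (by simp)).2
  have z1 := ((h0 a₁).2 (by simp)).2
  have z2 := ((h0 a₂).2 (by simp)).2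
  obtain ⟨r₆, r₇, r₈, r₉, hL, hLP, h67, h78, h89, hcount, hS⟩ :=
    h.three_list hn ho h0 hb₃ hb₄ hb₅ h₃ h₄ h₅
  have hmax : ∀ d, cnt P c d ≤ [9, 9, 9, 9].getD d 0 := fun d => (hn d).le.trans (by decide +revert)
  simp only [List.map_cons, List.map_nil, z0, z1, z2, c₃, c₄, c₅] at hcount
  have hr : c r₆ = 1 ∧ c r₇ = 1 ∧ c r₈ = 2 ∧ c r₉ = 2 := by
    generalize c r₆ = s₆ at *
    generalize c r₇ = s₇ at *
    generalize c r₈ = s₈ at *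
    generalize c r₉ = s₉ at *
    clear * - hcount h67 h78 h89
    decide +revert
  refine h.not_refuted hL hLP hmax (fun tbl => exists_append_holds (hS _ ?_ tbl) ?_)
    refuted_three_rainbow
  · simp [z0, z1, z2, c₃, c₄, c₅, hr]
  · have hB (e d : Fin 4) (he : e ≠ 3) (hd : d ≠ e) (p q r : ℕ) (l : List ℕ) (h1) (h2) :=
      blockerClause_holds hLP (h.blockedBy hn he hd) (p := p) (q := q) (r := r) (l := l) h1 h2 tbl
    simp only [rainbowHyps, List.forall_mem_cons]
    refine ⟨hB 1 0 (by decide) (by decide) _ _ _ _ ?_ ?_, hB 1 2 (by decide) (by decide)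
      _ _ _ _ ?_ ?_,
      hB 1 3 (by decide) (by decide) _ _ _ _ ?_ ?_, hB 2 0 (by decide) (by decide) _ _ _ _ ?_ ?_,
      hB 2 1 (by decide) (by decide) _ _ _ _ ?_ ?_, hB 2 3 (by decide) (by decide) _ _ _ _ ?_ ?_,
      by simp⟩ <;>
    · simp only [List.forall_mem_cons]
      simp [z0, z1, z2, c₃, c₄, c₅, hr]

theorem Blk.not_three (h : Blk P c) : ¬ ∀ d, cnt P c d = [3, 3, 3, 1].getD d 0 := by
  intro hn
  obtain ⟨a₀, a₁, a₂, b₃, b₄, b₅, ho, h0, hb₃, hb₄, hb₅, h₃, h₄, h₅⟩ := h.exists_triangle (hn 0)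
  obtain ⟨e₃, e₄, e₅⟩ := h.three_blockers_ne h0 hb₃ hb₄ hb₅ h₃ h₄ h₅
  obtain ⟨h34, h35, h45⟩ : c b₃ ≠ c b₄ ∧ c b₃ ≠ c b₅ ∧ c b₄ ≠ c b₅ := by
    have hm (d : Fin 4) (hd : d ≠ 0) := h.mem_midpoint_colors hn ho h0 hb₃ hb₄ hb₅ h₃ h₄ h₅ hd
    generalize c b₃ = s at *
    generalize c b₄ = t at *
    generalize c b₅ = u at *
    clear * - hm
    decide +revert
  obtain ⟨σ, hσ, hσ3, hσ'⟩ := exists_swap_rainbow (c b₃) (c b₄) (c b₅) e₃ e₄ e₅ h34 h35 h45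
  have h0' : ∀ x, σ (c x) = 0 ↔ c x = 0 := fun x => by
    rw [← hσ, σ.apply_eq_iff_eq, hσ]
  simp only [List.mem_cons, List.not_mem_nil, or_false, Prod.mk.injEq] at hσ'
  have ho' : 0 < orient a₁ a₂ a₀ := by rwa [orient_rot]
  have ho'' : 0 < orient a₂ a₀ a₁ := by rwa [orient_rot, orient_rot]
  have H0 := (h.perm σ).rainbow_absurd (cnt_perm_three hn hσ3) ho (fun x => by rw [h0', h0])
    hb₃ hb₄ hb₅ h₃ h₄ h₅
  have H1 := (h.perm σ).rainbow_absurd (cnt_perm_three hn hσ3) ho'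
    (fun x => by rw [h0', h0, mem_rot]) hb₄ hb₅ hb₃ h₄ h₅.symm h₃.symm
  have H2 := (h.perm σ).rainbow_absurd (cnt_perm_three hn hσ3) ho''
    (fun x => by rw [h0', h0, mem_rot, mem_rot]) hb₅ hb₃ hb₄ h₅.symm h₃ h₄.symm
  rcases hσ' with ⟨i, j, k⟩ | ⟨i, j, k⟩ | ⟨i, j, k⟩
  exacts [H0 i j k, H1 j k i, H2 k i j]

end FourBlocked

namespace FourBlocked
variable {P : Finset (ℝ × ℝ)} {c : ℝ × ℝ → Fin 4}

theorem Blk.erase [DecidableEq (ℝ × ℝ)] (h : Blk P c) {v : ℝ × ℝ}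
    (hv : ∀ x ∈ P, ∀ y ∈ P, ¬ Btw x v y) : Blk (P.erase v) c := by
  intro x hx y hy hxy
  rw [Finset.mem_erase] at hx hy
  rw [h x hx.2 y hy.2 hxy]
  refine exists_congr fun w => ?_
  rw [Finset.mem_erase]
  exact ⟨fun hw => ⟨⟨fun e => hv x hx.2 y hy.2 (e ▸ hw.2), hw.1⟩, hw.2⟩, fun hw => ⟨hw.1.2, hw.2⟩⟩

theorem cnt_erase [DecidableEq (ℝ × ℝ)] {v : ℝ × ℝ} (hv : v ∈ P) (d : Fin 4) :
    cnt P c d = cnt (P.erase v) c d + if c v = d then 1 else 0 := by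
  rw [cnt, cnt, Finset.filter_erase]
  split_ifs with hd
  · exact (Finset.card_erase_add_one (Finset.mem_filter.2 ⟨hv, hd⟩)).symm
  · rw [add_zero, Finset.erase_eq_of_notMem]
    exact fun hm => hd (Finset.mem_filter.1 hm).2

/-- The admissible sizes of the colour classes. -/
def Good (P : Finset (ℝ × ℝ)) (c : ℝ × ℝ → Fin 4) : Prop :=
  (∀ d, cnt P c d ≤ 3) ∧ ¬ (P.card = 10 ∧ ∃ d, cnt P c d = 1) ∨
    9 ≤ P.card ∧ ∃ e, cnt P c e = 4 ∧ ∀ d, d ≠ e → cnt P c d ≤ 2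

theorem Good.of_perm {σ : Equiv.Perm (Fin 4)} (h : Good P (fun x => σ (c x))) : Good P c := by
  simp only [Good, cnt_perm] at h
  refine h.imp (fun h => ⟨fun d => ?_, fun ⟨h1, d, hd⟩ => h.2 ⟨h1, σ d, by simpa using hd⟩⟩) ?_
  · simpa using h.1 (σ d)
  · rintro ⟨h1, e, he, hd⟩
    refine ⟨h1, _, he, fun d hde => ?_⟩
    simpa using hd (σ d) fun e' => hde (by rw [← e', σ.symm_apply_apply])

theorem Good.of_four_le (h : Good P c) {e : Fin 4} (he : 4 ≤ cnt P c e) :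
    9 ≤ P.card ∧ cnt P c e = 4 ∧ ∀ d, d ≠ e → cnt P c d ≤ 2 := by
  rcases h with h | ⟨h9, e', he', hd⟩
  · exact absurd (h.1 e) (by omega)
  · obtain rfl : e = e' := by
      by_contra hne
      exact absurd (hd e hne) (by omega)
    exact ⟨h9, he', hd⟩

theorem Good.le_four (h : Good P c) (d : Fin 4) : cnt P c d ≤ 4 := by
  by_contra! hd
  exact hd.ne' (h.of_four_le hd.le).2.1

theorem exists_sort (P : Finset (ℝ × ℝ)) (c : ℝ × ℝ → Fin 4) :
    ∃ σ : Equiv.Perm (Fin 4), Antitone (cnt P (fun x => σ (c x))) := by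
  let f : Fin 4 → ℕᵒᵈ := fun d => OrderDual.toDual (cnt P c d)
  refine ⟨(Tuple.sort f).symm, fun i j hij => ?_⟩
  rw [cnt_perm, cnt_perm]
  exact Tuple.monotone_sort f hij

theorem Blk.cnt_pos (h : Blk P c) {e : Fin 4} (he : 3 ≤ cnt P c e) (d : Fin 4) : 0 < cnt P c d := by
  obtain ⟨p, q, r, hp, hq, hr, hpq, hpr, hqr⟩ := Finset.two_lt_card_iff.1 he
  rw [Finset.mem_filter] at hp hq hr
  obtain ⟨x, hx, -, hc⟩ := h.exists_color hp.1 hq.1 hr.1 hpq hpr hqr (hp.2.trans hq.2.symm)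
    (hp.2.trans hr.2.symm) d
  exact Finset.card_pos.2 ⟨x, Finset.mem_filter.2 ⟨hx, hc⟩⟩

theorem mem_of_cnt_eq_four [DecidableEq (ℝ × ℝ)] (h4 : cnt P c 0 = 4) : ∃ a₀ a₁ a₂ a₃,
    [a₀, a₁, a₂, a₃].Nodup ∧ ∀ x, x ∈ P ∧ c x = 0 ↔ x ∈ ({a₀, a₁, a₂, a₃} : Finset _) := by
  obtain ⟨l, hl⟩ := (P.filter (c · = 0)).exists_list_nodup_eq
  have hlen : l.length = 4 := by rw [← h4, cnt, ← hl.2, List.toFinset_card_of_nodup hl.1]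
  obtain ⟨a₀, a₁, a₂, a₃, rfl⟩ := List.length_eq_four.1 hlen
  refine ⟨a₀, a₁, a₂, a₃, hl.1, fun x => ?_⟩
  rw [← Finset.mem_filter (p := (c · = 0)), ← hl.2]
  simp

theorem Blk.four (h : Blk P c) (h4 : cnt P c 0 = 4) : 8 < P.card ∧
      ((∀ d : Fin 4, cnt P c d ≤ [4, 3, 2, 1].getD d 0) → P.card ≠ 10) ∧
      ((∀ d : Fin 4, cnt P c d ≤ [4, 3, 2, 2].getD d 0) → P.card ≠ 11) := by
  classical
  obtain ⟨a, b, d, e, hnd, h0⟩ := mem_of_cnt_eq_four h4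
  obtain ⟨m0, z0⟩ := (h0 a).2 (by simp)
  obtain ⟨m1, z1⟩ := (h0 b).2 (by simp)
  obtain ⟨m2, z2⟩ := (h0 d).2 (by simp)
  obtain ⟨m3, z3⟩ := (h0 e).2 (by simp)
  simp only [List.nodup_cons, List.mem_cons, List.not_mem_nil, or_false, not_or] at hnd
  obtain ⟨p, q, r, s, hS, hpq⟩ := around_or_quad
    (h.orient_ne_zero m0 m1 m2 hnd.1.1 hnd.1.2.1 hnd.2.1.1 (z0.trans z1.symm) (z0.trans z2.symm))
    (h.orient_ne_zero m0 m1 m3 hnd.1.1 hnd.1.2.2 hnd.2.1.2 (z0.trans z1.symm) (z0.trans z3.symm))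
    (h.orient_ne_zero m0 m2 m3 hnd.1.2.1 hnd.1.2.2 hnd.2.2.1 (z0.trans z2.symm) (z0.trans z3.symm))
    (h.orient_ne_zero m1 m2 m3 hnd.2.1.1 hnd.2.1.2 hnd.2.2.1 (z1.trans z2.symm) (z1.trans z3.symm))
  have h0' : ∀ x, x ∈ P ∧ c x = 0 ↔ x ∈ [p, q, r, s] := by
    intro x
    rw [h0, ← hS]
    simp
  rcases hpq with hA | hQ
  · obtain ⟨h10, hten⟩ := h.nonconvex_card hA h0'
    refine ⟨by omega, hten, fun hmax he => ?_⟩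
    exact h.nonconvex hA h0' (fun d => (hmax d).trans (by decide +revert)) (.inl he)
  · exact h.convex hQ h0'

/-- `v` does not block two points of `P`. -/
def NonBlocker (P : Finset (ℝ × ℝ)) (v : ℝ × ℝ) : Prop := ∀ x ∈ P, ∀ y ∈ P, ¬ Btw x v y

theorem nonBlocker_of_extreme {x : ℝ × ℝ}
    (hx : x ∈ (convexHull ℝ (P : Set (ℝ × ℝ))).extremePoints ℝ) : NonBlocker P x := by
  intro y hy z hz hb
  obtain ⟨-, he⟩ := mem_extremePoints.1 hx
  have := he y (subset_convexHull ℝ _ hy) z (subset_convexHull ℝ _ hz)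
    (btw_iff_mem_openSegment.1 hb).2
  exact hb.ne (this.1.trans this.2.symm)

theorem mem_convexHull_extreme {x : ℝ × ℝ} (hx : x ∈ P) :
    x ∈ convexHull ℝ ((convexHull ℝ (P : Set (ℝ × ℝ))).extremePoints ℝ) := by
  have h1 := closure_convexHull_extremePoints (P.finite_toSet.isCompact_convexHull ℝ)
    (convex_convexHull ℝ _)
  have h2 := P.finite_toSet.subset (extremePoints_convexHull_subset (𝕜 := ℝ))
  rw [(h2.isClosed_convexHull ℝ).closure_eq] at h1
  rw [h1]
  exact subset_convexHull ℝ _ hx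

theorem Blk.extreme_of_zero (h : Blk P c) (h4 : cnt P c 0 = 4)
    (hmax : ∀ d, cnt P c d ≤ [4, 3, 3, 3].getD d 0)
    (hA : ∀ v ∈ P, NonBlocker P v → c v = 0)
    (hne : P.card ≠ 10 ∨ ∀ d, cnt P c d ≤ [4, 3, 2, 1].getD d 0) {x : ℝ × ℝ} (hx : x ∈ P)
    (hx0 : c x = 0) : x ∈ (convexHull ℝ (P : Set (ℝ × ℝ))).extremePoints ℝ := by
  classical
  by_contra hE
  obtain ⟨a₁, a₂, a₃, h12, h13, h23, he⟩ := Finset.card_eq_three.1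
    (show ((P.filter (c · = 0)).erase x).card = 3 by
      rw [Finset.card_erase_of_mem (Finset.mem_filter.2 ⟨hx, hx0⟩)]
      exact congrArg (· - 1) h4)
  have h0 : ∀ y, y ∈ P ∧ c y = 0 ↔ y ∈ [x, a₁, a₂, a₃] := by
    intro y
    rw [← Finset.mem_filter (p := (c · = 0)), ← Finset.insert_erase (Finset.mem_filter.2 ⟨hx, hx0⟩),
      he]
    simp
  have hxa : x ≠ a₁ ∧ x ≠ a₂ ∧ x ≠ a₃ := by
    have := he ▸ Finset.notMem_erase x (P.filter (c · = 0))
    simpa using this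
  clear he
  have hsub : ∀ y ∈ P, y ∈ tri a₁ a₂ a₃ := by
    intro y hy
    refine convexHull_mono ?_ (mem_convexHull_extreme hy)
    intro z hz
    have hzP : z ∈ P := extremePoints_convexHull_subset hz
    have := (h0 z).1 ⟨hzP, hA z hzP (nonBlocker_of_extreme hz)⟩
    rw [List.mem_cons] at this
    rcases this with rfl | this
    · exact absurd hz hE
    · simpa using this
  wlog ho : 0 < orient a₁ a₂ a₃ generalizing a₂ a₃
  · obtain ⟨m1, z1⟩ := (h0 a₁).2 (by simp)
    obtain ⟨m2, z2⟩ := (h0 a₂).2 (by simp)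
    obtain ⟨m3, z3⟩ := (h0 a₃).2 (by simp)
    have hne := h.orient_ne_zero m1 m2 m3 h12 h13 h23 (z1.trans z2.symm) (z1.trans z3.symm)
    refine this a₃ a₂ h13 h12 h23.symm (fun x => by rw [h0]; simp; tauto) (by tauto) ?_ ?_
    · intro y hy
      rw [tri, Set.pair_comm]
      exact hsub y hy
    rw [orient_swap]
    exact neg_pos.2 ((not_lt.1 ho).lt_of_ne hne)
  obtain ⟨m1, z1⟩ := (h0 a₁).2 (by simp)
  obtain ⟨m2, z2⟩ := (h0 a₂).2 (by simp)
  obtain ⟨m3, z3⟩ := (h0 a₃).2 (by simp)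
  have hxt := hsub x hx
  have hpos {p q r : ℝ × ℝ} (hp : p ∈ P) (hq : q ∈ P) (hpc : c p = 0) (hqc : c q = 0) (hxp : x ≠ p)
      (hxq : x ≠ q) (hpq : p ≠ q) (ho : 0 < orient p q r) (hxt : x ∈ tri p q r) :
        0 < orient x p q := by
    rw [← orient_rot]
    exact (orient_nonneg_of_mem_tri ho hxt).lt_of_ne' (h.orient_ne_zero hp hq hx hpq hxp.symm
      hxq.symm
      (hpc.trans hqc.symm) (hpc.trans hx0.symm))
  have ha : Around x a₁ a₂ a₃ :=
    ⟨ho, hpos m1 m2 z1 z2 hxa.1 hxa.2.1 h12 ho hxt,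
      hpos m2 m3 z2 z3 hxa.2.1 hxa.2.2 h23 (by rwa [orient_rot]) (by rwa [tri_rot]),
      hpos m3 m1 z3 z1 hxa.2.2 hxa.1 h13.symm (by rwa [orient_rot, orient_rot])
        (by rwa [tri_rot, tri_rot])⟩
  obtain ⟨h10, hten⟩ := h.nonconvex_card ha h0
  have hcard := sum_cnt P c
  have hm1 : cnt P c 1 ≤ 3 := hmax 1
  have hm2 : cnt P c 2 ≤ 3 := hmax 2
  have hm3 : cnt P c 3 ≤ 3 := hmax 3
  have h10' : P.card ≠ 10 := hne.elim id hten
  refine h.nonconvex ha h0 hmax ?_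
  have : P.card = 11 ∨ P.card = 12 ∨ P.card = 13 := by omega
  exact this.imp id fun h => ⟨hsub, h⟩

theorem Blk.cnt_lt_three (h : Blk P c)
    (hE : ∀ x ∈ P, c x = 0 → x ∈ (convexHull ℝ (P : Set (ℝ × ℝ))).extremePoints ℝ) {d : Fin 4}
    (hd : d ≠ 0) : cnt P c d ≤ 2 := by
  by_contra! h3
  obtain ⟨p, q, r, hp, hq, hr, hpq, hpr, hqr⟩ := Finset.two_lt_card_iff.1 h3
  rw [Finset.mem_filter] at hp hq hr
  obtain ⟨x, hx, ht, hc⟩ := h.exists_color hp.1 hq.1 hr.1 hpq hpr hqr (hp.2.trans hq.2.symm)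
    (hp.2.trans hr.2.symm) 0
  have hsub : tri p q r ⊆ convexHull ℝ (P : Set (ℝ × ℝ)) :=
    tri_subset (convex_convexHull ℝ _) (subset_convexHull ℝ _ hp.1) (subset_convexHull ℝ _ hq.1)
      (subset_convexHull ℝ _ hr.1)
  have := extremePoints_convexHull_subset
    (inter_extremePoints_subset_extremePoints_of_subset hsub ⟨ht, hE x hx hc⟩)
  rcases this with rfl | rfl | rfl
  exacts [hd (hp.2.symm.trans hc), hd (hq.2.symm.trans hc), hd (hr.2.symm.trans hc)]

theorem forall_getD_iff {n : Fin 4 → ℕ} {a b d e : ℕ} :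
    (∀ i : Fin 4, n i ≤ [a, b, d, e].getD i 0) ↔ n 0 ≤ a ∧ n 1 ≤ b ∧ n 2 ≤ d ∧ n 3 ≤ e := by
  simp [Fin.forall_fin_succ]

theorem Blk.good (h : Blk P c) : Good P c := by
  classical
  induction hk : P.card using Nat.strong_induction_on generalizing P c with
  | _ k ih =>
  obtain ⟨σ, hσ⟩ := exists_sort P c
  refine Good.of_perm (σ := σ) ?_
  replace h := h.perm σ
  generalize (fun x => σ (c x)) = c at h hσ
  rcases P.eq_empty_or_nonempty with rfl | hne
  · exact .inl ⟨fun d => by simp [cnt], by simp⟩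
  have h01 : cnt P c 1 ≤ cnt P c 0 := hσ (by decide)
  have h12 : cnt P c 2 ≤ cnt P c 1 := hσ (by decide)
  have h23 : cnt P c 3 ≤ cnt P c 2 := hσ (by decide)
  have hsum := sum_cnt P c
  have ihe {v : ℝ × ℝ} (hv : v ∈ P) (hvb : NonBlocker P v) : Good (P.erase v) c :=
    ih _ (hk ▸ Finset.card_erase_lt_of_mem hv) (h.erase hvb) rfl
  obtain ⟨v, hv, hlex⟩ := exists_lexLt hne
  have hvb : NonBlocker P v := fun x hx y hy hb =>
    LexLt.not_btw (hlex x hx hb.ne_left.symm) (hlex y hy hb.ne_right.symm) hb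
  have hcard {v : ℝ × ℝ} (hv : v ∈ P) : (P.erase v).card + 1 = P.card :=
    Finset.card_erase_add_one hv
  rcases le_or_gt (cnt P c 0) 3 with h3 | h4
  · refine .inl ⟨fun d => (hσ d.zero_le).trans h3, ?_⟩
    rintro ⟨h10, d, hd⟩
    have hd3 : cnt P c 3 ≤ 1 := hd ▸ hσ d.le_last
    refine h.not_three ?_
    rw [Fin.forall_fin_succ, Fin.forall_fin_succ, Fin.forall_fin_two]
    change cnt P c 0 = 3 ∧ cnt P c 1 = 3 ∧ cnt P c 2 = 3 ∧ cnt P c 3 = 1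
    omega
  have hpos : 0 < cnt P c 3 := h.cnt_pos (e := 0) (by omega) 3
  have hgood (h0 : cnt P c 0 = 4) (h1 : cnt P c 1 ≤ 2) : Good P c := by
    have h9 := (h.four h0).1
    exact .inr ⟨h9, 0, h0, fun d hd => (hσ (Fin.one_le_of_ne_zero hd)).trans h1⟩
  have hv4 := (ihe hv hvb).le_four
  have hve := cnt_erase (c := c) hv
  have hcv := hcard hv
  have hv0 := hve 0
  rcases eq_or_ne (cnt P c 0) 4 with h0 | h0
  · by_cases hA : ∀ w ∈ P, NonBlocker P w → c w = 0
    · have h1 : cnt P c 1 ≤ 3 := by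
        have he := hve 1
        rw [hA v hv hvb] at he hv0
        rw [if_neg (by decide)] at he
        by_contra! h1
        have := (ihe hv hvb).of_four_le (e := 1) (by omega)
        have := this.2.2 0 (by decide)
        simp only [if_true] at hv0
        omega
      by_cases h222 : cnt P c 1 ≤ 2
      · exact hgood h0 h222
      refine absurd (h.cnt_lt_three (fun x hx hx0 => h.extreme_of_zero h0 ?_ hA ?_ hx hx0)
        one_ne_zero)
        h222
      · rw [forall_getD_iff]
        omega
      · rw [forall_getD_iff]
        omega
    · push Not at hA
      obtain ⟨w, hw, hwb, hw0⟩ := hA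
      have hwe := cnt_erase (c := c) hw
      have hcw := hcard hw
      have he0 := hwe 0
      rw [if_neg hw0, add_zero] at he0
      obtain ⟨h9, -, hle⟩ := (ihe hw hwb).of_four_le (e := 0) (by omega)
      have hle1 := hle 1 (by decide)
      have hle2 := hle 2 (by decide)
      have hle3 := hle 3 (by decide)
      have he1 := hwe 1
      have he2 := hwe 2
      have he3 := hwe 3
      obtain ⟨-, h10, h11⟩ := h.four h0
      rw [forall_getD_iff] at h10 h11
      by_cases h222 : cnt P c 1 ≤ 2
      · exact hgood h0 h222
      have hs : (P.erase w).card = _ := (sum_cnt (P.erase w) c).symm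
      have hcw' : c w = 1 ∨ c w = 2 ∨ c w = 3 := by
        generalize c w = s at hw0
        decide +revert
      exfalso
      rcases hcw' with hcw' | hcw' | hcw' <;> simp only [hcw'] at he1 he2 he3 <;>
        simp at he1 he2 he3 <;> omega
  · exfalso
    have hv0' := hv4 0
    have hcv0 : c v = 0 := by
      by_contra hc
      rw [if_neg hc] at hv0
      omega
    rw [hcv0, if_pos rfl] at hv0
    obtain ⟨h9, -, hle⟩ := (ihe hv hvb).of_four_le (e := 0) (by omega)
    have hle' : ∀ d, d ≠ 0 → cnt P c d ≤ 2 := fun d hd => by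
      rw [hve, hcv0, if_neg hd.symm]
      exact hle d hd
    have hle1 := hle' 1 (by decide)
    refine h.five hv hlex hcv0 (by omega) ?_ (by omega)
    rw [forall_getD_iff]
    omega

end FourBlocked

namespace FourBlocked
variable {P : Finset (ℝ × ℝ)} {c : ℝ × ℝ → Fin 4}

theorem visible_iff {v w : ℝ × ℝ} (hvw : v ≠ w) :
    Visible (P : Set (ℝ × ℝ)) v w ↔ ¬ ∃ x ∈ P, Btw v x w := by
  simp only [Visible, Blocks, not_exists, not_and, btw_iff_mem_openSegment, ne_eq, hvw,
    not_false_eq_true, true_and, Finset.mem_coe]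

theorem blockedColouring_iff : BlockedColouring (P : Set (ℝ × ℝ)) c ↔ Blk P c := by
  refine forall₂_congr fun v _ => forall₂_congr fun w _ => forall_congr' fun hvw => ?_
  rw [visible_iff hvw, Ne, not_iff_not]
  exact Iff.comm

theorem ncard_inter_preimage (d : Fin 4) : ((P : Set (ℝ × ℝ)) ∩ c ⁻¹' {d}).ncard = cnt P c d := by
  rw [cnt, ← Set.ncard_coe_finset, Finset.coe_filter]
  rfl

theorem representable_iff {N : Multiset ℕ} (hN : N.card = 4) : Representable N ↔
    ∃ P c, Blk P c ∧ N = {cnt P c 0, cnt P c 1, cnt P c 2, cnt P c 3} := by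
  have key (P : Finset (ℝ × ℝ)) (c : ℝ × ℝ → Fin 4) : Finset.univ.val.map
      (fun i : Fin 4 => ((P : Set (ℝ × ℝ)) ∩ c ⁻¹' {i}).ncard) =
        {cnt P c 0, cnt P c 1, cnt P c 2, cnt P c 3} := by
    simp only [ncard_inter_preimage]
    rfl
  constructor
  · rintro ⟨P, hP, k, c, hc, rfl⟩
    obtain rfl : k = 4 := by simpa using hN
    lift P to Finset (ℝ × ℝ) using hP
    exact ⟨P, c, blockedColouring_iff.1 hc, key P c⟩
  · rintro ⟨P, c, hc, rfl⟩
    exact ⟨P, P.finite_toSet, 4, c, blockedColouring_iff.2 hc, (key P c).symm⟩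

theorem four_multiset {a b d e : ℕ} (h9 : 9 ≤ a + b + d + e)
    (h : a = 4 ∧ b ≤ 2 ∧ d ≤ 2 ∧ e ≤ 2 ∨ b = 4 ∧ a ≤ 2 ∧ d ≤ 2 ∧ e ≤ 2 ∨
      d = 4 ∧ a ≤ 2 ∧ b ≤ 2 ∧ e ≤ 2 ∨ e = 4 ∧ a ≤ 2 ∧ b ≤ 2 ∧ d ≤ 2) :
    ({a, b, d, e} : Multiset ℕ) = {4, 2, 2, 1} ∨ ({a, b, d, e} : Multiset ℕ) = {4, 2, 2, 2} := by
  have key : ∀ a b d e : Fin 5, 9 ≤ a.val + b + d + e →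
    (a.val = 4 ∧ b.val ≤ 2 ∧ d.val ≤ 2 ∧ e.val ≤ 2 ∨ b.val = 4 ∧ a.val ≤ 2 ∧ d.val ≤ 2 ∧ e.val ≤ 2 ∨
      d.val = 4 ∧ a.val ≤ 2 ∧ b.val ≤ 2 ∧ e.val ≤ 2 ∨
        e.val = 4 ∧ a.val ≤ 2 ∧ b.val ≤ 2 ∧ d.val ≤ 2) →
    ({a.val, b.val, d.val, e.val} : Multiset ℕ) = {4, 2, 2, 1} ∨
      ({a.val, b.val, d.val, e.val} : Multiset ℕ) = {4, 2, 2, 2} := by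
    decide +kernel
  exact key ⟨a, by omega⟩ ⟨b, by omega⟩ ⟨d, by omega⟩ ⟨e, by omega⟩ h9 h

theorem of_representable {N : Multiset ℕ} (hN : N.card = 4) (h : Representable N) :
    N = {4, 2, 2, 1} ∨ N = {4, 2, 2, 2} ∨ (∀ n ∈ N, n ≤ 3) ∧ N ≠ {3, 3, 3, 1} := by
  obtain ⟨P, c, hc, rfl⟩ := (representable_iff hN).1 h
  have hsum := sum_cnt P c
  rcases hc.good with ⟨h3, h1⟩ | ⟨h9, e, he, hd⟩
  · refine .inr (.inr ⟨by simp [h3], fun hN => h1 ⟨?_, ?_⟩⟩)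
    · have := congrArg Multiset.sum hN
      simp only [Multiset.insert_eq_cons, Multiset.sum_cons, Multiset.sum_singleton] at this
      omega
    · have : 1 ∈ ({cnt P c 0, cnt P c 1, cnt P c 2, cnt P c 3} : Multiset ℕ) := hN ▸ by simp
      simp only [Multiset.insert_eq_cons, Multiset.mem_cons, Multiset.mem_singleton] at this
      rcases this with h | h | h | h <;> exact ⟨_, h.symm⟩
  · rw [← or_assoc]
    refine .inl (four_multiset (by omega) ?_)
    fin_cases e
    exacts [.inl ⟨he, hd 1 (by decide), hd 2 (by decide), hd 3 (by decide)⟩,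
      .inr (.inl ⟨he, hd 0 (by decide), hd 2 (by decide), hd 3 (by decide)⟩),
      .inr (.inr (.inl ⟨he, hd 0 (by decide), hd 1 (by decide), hd 3 (by decide)⟩)),
      .inr (.inr (.inr ⟨he, hd 0 (by decide), hd 1 (by decide), hd 2 (by decide)⟩))]

/-- `q` lies strictly between `p` and `r`, for points with integer coordinates. -/
abbrev LatticeBtw (p q r : ℤ × ℤ) : Prop :=
  (q.1 - p.1) * (r.2 - p.2) - (q.2 - p.2) * (r.1 - p.1) = 0 ∧
    (p.1 - q.1) * (r.1 - q.1) + (p.2 - q.2) * (r.2 - q.2) < 0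

theorem btw_cast {p q r : ℤ × ℤ} : Btw (p.1, p.2) (q.1, q.2) (r.1, r.2) ↔ LatticeBtw p q r := by
  simp only [Btw, orient]
  norm_cast

/-- The points of a list of four colour classes, with their colours. -/
def coloured (D : List (List (ℤ × ℤ))) : List ((ℤ × ℤ) × Fin 4) :=
  (List.finRange 4).flatMap fun d : Fin 4 => (D.getD d.val []).map fun x => (x, d)

/-- The four colour classes `D` form a blocked set. -/
abbrev BlockedClasses (D : List (List (ℤ × ℤ))) : Prop :=
  ((coloured D).map Prod.fst).Nodup ∧ ∀ v ∈ coloured D, ∀ w ∈ coloured D, v.1 ≠ w.1 →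
    (v.2 = w.2 ↔ ∃ x ∈ coloured D, LatticeBtw v.1 x.1 w.1)

theorem BlockedClasses.representable {D : List (List (ℤ × ℤ))} (h : BlockedClasses D) :
    Representable {((coloured D).map Prod.snd).count 0, ((coloured D).map Prod.snd).count 1,
      ((coloured D).map Prod.snd).count 2, ((coloured D).map Prod.snd).count 3} := by
  classical
  obtain ⟨hnd, hb⟩ := h
  generalize coloured D = l at *
  let f : (ℤ × ℤ) × Fin 4 → ℝ × ℝ := fun v => (v.1.1, v.1.2)
  have hf : ∀ {v w}, f v = f w → v.1 = w.1 := by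
    intro v w hvw
    simp only [f, Prod.mk.injEq, Int.cast_inj] at hvw
    exact Prod.ext hvw.1 hvw.2
  have hfl : ∀ v ∈ l, ∀ w ∈ l, f v = f w → v = w := fun v hv w hw hvw =>
    List.inj_on_of_nodup_map hnd hv hw (hf hvw)
  have : ∃ c : ℝ × ℝ → Fin 4, ∀ v ∈ l, c (f v) = v.2 := by
    refine ⟨fun y => if hy : ∃ v ∈ l, f v = y then hy.choose.2 else 0, fun v hv => ?_⟩
    have hy : ∃ w ∈ l, f w = f v := ⟨v, hv, rfl⟩
    simp only [dif_pos hy]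
    rw [hfl _ hy.choose_spec.1 _ hv hy.choose_spec.2]
  obtain ⟨c, hc⟩ := this
  rw [representable_iff rfl]
  have hmem : ∀ x, x ∈ l.map f ↔ x ∈ (l.map f).toFinset := fun x => List.mem_toFinset.symm
  have hmap : (l.map f).map c = l.map Prod.snd := by
    rw [List.map_map]
    exact List.map_congr_left hc
  have hcnt (d : Fin 4) : (l.map Prod.snd).count d = cnt (l.map f).toFinset c d := by
    rw [← hmap]
    exact count_map_eq_cnt (List.Nodup.map_on hfl hnd.of_map) hmem d
  refine ⟨(l.map f).toFinset, c, ?_, by simp [hcnt]⟩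
  intro x hx y hy hxy
  simp only [List.mem_toFinset, List.mem_map] at hx hy
  obtain ⟨v, hv, rfl⟩ := hx
  obtain ⟨w, hw, rfl⟩ := hy
  rw [hc v hv, hc w hw, hb v hv w hw fun e => hxy (by simp only [f, e])]
  simp only [List.mem_toFinset, List.mem_map, exists_exists_and_eq_and, f, btw_cast]

/-- Blocked sets with small colour classes. -/
def drawings : List (List (List (ℤ × ℤ))) :=
  [[[(0, 0)], [(0, 1)], [(1, 0)], [(1, 1)]],
  [[(0, 0), (0, 2)], [(0, 1)], [(1, 0)], [(1, 1)]],
  [[(0, 0), (0, 2)], [(0, 1), (2, 1)], [(1, 0)], [(1, 1)]],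
  [[(0, 0), (0, 2)], [(0, 1), (2, 1)], [(1, 0), (1, 2)], [(1, 1)]],
  [[(1, 2), (3, 0)], [(0, 1), (2, 1)], [(1, 1), (1, 3)], [(0, 0), (0, 2)]],
  [[(0, 0), (0, 2), (2, 0)], [(0, 1)], [(1, 0)], [(1, 1)]],
  [[(0, 0), (0, 2), (2, 0)], [(0, 1), (2, 1)], [(1, 0)], [(1, 1)]],
  [[(0, 0), (0, 2), (2, 0)], [(0, 1), (2, 1)], [(1, 0), (1, 2)], [(1, 1)]],
  [[(0, 1), (0, 4), (3, 1)], [(1, 1), (4, 4)], [(0, 3), (3, 3)], [(1, 0), (1, 3)]],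
  [[(0, 2), (2, 0), (2, 2)], [(0, 1), (0, 3), (2, 1)], [(1, 2)], [(1, 1)]],
  [[(0, 0), (0, 2), (2, 2)], [(0, 1), (2, 1), (2, 3)], [(1, 0), (1, 2)], [(1, 1)]],
  [[(0, 0), (0, 2), (2, 2)], [(0, 1), (2, 1), (2, 3)], [(1, 2), (3, 0)], [(1, 1), (1, 3)]],
  [[(1, 1), (3, 1), (3, 5)], [(0, 0), (2, 2), (4, 0)], [(1, 0), (1, 2), (3, 4)], [(2, 1), (2, 3)]],
  [[(2, 2), (2, 4), (4, 0)], [(1, 2), (3, 2), (5, 4)], [(0, 1), (2, 3), (4, 3)],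
    [(1, 5), (3, 1), (3, 3)]],
  [[(0, 0), (0, 2), (2, 0), (2, 2)], [(0, 1), (2, 1)], [(1, 0), (1, 2)], [(1, 1)]],
  [[(0, 0), (4, 2), (6, 0), (6, 6)], [(5, 1), (5, 5)], [(2, 1), (6, 1)], [(1, 0), (5, 4)]]]

theorem blockedClasses_of_mem_drawings : ∀ D ∈ drawings, BlockedClasses D := by
  decide +kernel

theorem count_of_mem_drawings : ∀ D ∈ drawings,
    ({((coloured D).map Prod.snd).count 0, ((coloured D).map Prod.snd).count 1,
      ((coloured D).map Prod.snd).count 2, ((coloured D).map Prod.snd).count 3} : Multiset ℕ) =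
    (D.map List.length : List ℕ) := by
  decide +kernel

theorem exists_drawing : ∀ a b c d : Fin 5, 0 < a.val → 0 < b.val → 0 < c.val → 0 < d.val →
    ({a.val, b.val, c.val, d.val} : Multiset ℕ) = {4, 2, 2, 1} ∨
      ({a.val, b.val, c.val, d.val} : Multiset ℕ) = {4, 2, 2, 2} ∨
      (a.val ≤ 3 ∧ b.val ≤ 3 ∧ c.val ≤ 3 ∧ d.val ≤ 3 ∧
        ({a.val, b.val, c.val, d.val} : Multiset ℕ) ≠ {3, 3, 3, 1}) →
    ∃ D ∈ drawings, ({a.val, b.val, c.val, d.val} : Multiset ℕ) = (D.map List.length : List ℕ) := by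
  decide +kernel

end FourBlocked

/-- Characterisation of representable 4-sets: `{a,b,c,d}` is representable iff it is
`{4,2,2,1}`, or `{4,2,2,2}`, or all entries are at most 3 and it is not `{3,3,3,1}`. -/
theorem representable_four_sets (a b c d : ℕ)
    (ha : 0 < a) (hb : 0 < b) (hc : 0 < c) (hd : 0 < d) :
    Representable {a, b, c, d} ↔
      ({a, b, c, d} : Multiset ℕ) = {4, 2, 2, 1} ∨
      ({a, b, c, d} : Multiset ℕ) = {4, 2, 2, 2} ∨
      (a ≤ 3 ∧ b ≤ 3 ∧ c ≤ 3 ∧ d ≤ 3 ∧ ({a, b, c, d} : Multiset ℕ) ≠ {3, 3, 3, 1}) := by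
  constructor
  · intro h
    simpa [and_assoc] using FourBlocked.of_representable (by simp) h
  · intro h
    have key : ∀ n ∈ ({a, b, c, d} : Multiset ℕ), n < 5 := by
      rcases h with h | h | ⟨h₁, h₂, h₃, h₄, -⟩
      · rw [h]; decide
      · rw [h]; decide
      · simp only [Multiset.insert_eq_cons, Multiset.mem_cons, Multiset.mem_singleton]
        omega
    obtain ⟨D, hD, hN⟩ := FourBlocked.exists_drawing ⟨a, key a (by simp)⟩ ⟨b, key b (by simp)⟩
      ⟨c, key c (by simp)⟩ ⟨d, key d (by simp)⟩ ha hb hc hd h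
    rw [hN, ← FourBlocked.count_of_mem_drawings D hD]
    exact (FourBlocked.blockedClasses_of_mem_drawings D hD).representable
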